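/- Assume β ∈ (ϖ2, 0) in Case [N2] (in particular θ < −2 and f_ρ(β) > 0). Then every positive solution u of equation (E) in Ω∖{0} satisfies exactly one of the following as |x| → 0: (i) there exists a ∈ (0,∞) with |x|^{ϖ1} u(x) → a and |x|^{ϖ1} (x·∇u(x)) → −a ϖ1; (ii) there exists b ∈ (0,∞) with u(x)/Φ_{ϖ2}(|x|) → b and (x·∇u(x))/Φ_{ϖ2}(|x|) → −b ϖ2; (iii) u(x)/U_{ρ,β}(x) → 1. -/

import Mathlib

open MeasureTheory Filter Topology Real RealInnerProductSpace

noncomputable section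

/-- The gradient factor `G_τ(x,z,ξ) = z^τ ‖ξ‖^(1-τ) / ‖x‖^(τ+1)`.
For `τ = 0` this equals `‖ξ‖ / ‖x‖`, since `z ^ (0:ℝ) = 1` for real powers. -/
def Gt {N : ℕ} (τ : ℝ) (x : EuclideanSpace ℝ (Fin N)) (z : ℝ)
    (ξ : EuclideanSpace ℝ (Fin N)) : ℝ :=
  z ^ τ * ‖ξ‖ ^ (1 - τ) / ‖x‖ ^ (τ + 1)

/-- Test functions: `C¹` functions with compact support contained in `Ω \ {0}`. -/
def IsTestFun {N : ℕ} (Ω : Set (EuclideanSpace ℝ (Fin N)))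
    (φ : EuclideanSpace ℝ (Fin N) → ℝ) : Prop :=
  ContDiff ℝ 1 φ ∧ HasCompactSupport φ ∧ tsupport φ ⊆ Ω \ {0}

/-- The distributional pairing of equation (E) with a test function `φ`:
`∫ ∇u·∇φ + (N-2+2ρ) ∫ ((x·∇u)/|x|²) φ - λ ∫ G_τ(x,u,∇u) φ + ∫ |x|^θ u^q φ`. -/
def weakE (N : ℕ) (ρ lam τ θ q : ℝ) (Ω : Set (EuclideanSpace ℝ (Fin N)))
    (u φ : EuclideanSpace ℝ (Fin N) → ℝ) : ℝ :=
  (∫ x in Ω \ {0}, ⟪gradient u x, gradient φ x⟫)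
    + ((N : ℝ) - 2 + 2 * ρ) * (∫ x in Ω \ {0}, ⟪x, gradient u x⟫ / ‖x‖ ^ 2 * φ x)
    - lam * (∫ x in Ω \ {0}, Gt τ x (u x) (gradient u x) * φ x)
    + ∫ x in Ω \ {0}, ‖x‖ ^ θ * u x ^ q * φ x

/-- A positive `C¹` function on `Ω \ {0}`. -/
def PosC1 {N : ℕ} (Ω : Set (EuclideanSpace ℝ (Fin N)))
    (u : EuclideanSpace ℝ (Fin N) → ℝ) : Prop :=
  ContDiffOn ℝ 1 u (Ω \ {0}) ∧ ∀ x ∈ Ω \ {0}, 0 < u x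

/-- Positive distributional solution of equation (E) in `Ω \ {0}`. -/
def IsSolutionE (N : ℕ) (ρ lam τ θ q : ℝ) (Ω : Set (EuclideanSpace ℝ (Fin N)))
    (u : EuclideanSpace ℝ (Fin N) → ℝ) : Prop :=
  PosC1 Ω u ∧ ∀ φ, IsTestFun Ω φ → weakE N ρ lam τ θ q Ω u φ = 0

/-- Positive sub-solution of equation (E) in `Ω \ {0}`. -/
def IsSubSolutionE (N : ℕ) (ρ lam τ θ q : ℝ) (Ω : Set (EuclideanSpace ℝ (Fin N)))
    (u : EuclideanSpace ℝ (Fin N) → ℝ) : Prop :=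
  PosC1 Ω u ∧ ∀ φ, IsTestFun Ω φ → (∀ x, 0 ≤ φ x) → weakE N ρ lam τ θ q Ω u φ ≤ 0

/-- Positive super-solution of equation (E) in `Ω \ {0}`. -/
def IsSuperSolutionE (N : ℕ) (ρ lam τ θ q : ℝ) (Ω : Set (EuclideanSpace ℝ (Fin N)))
    (u : EuclideanSpace ℝ (Fin N) → ℝ) : Prop :=
  PosC1 Ω u ∧ ∀ φ, IsTestFun Ω φ → (∀ x, 0 ≤ φ x) → 0 ≤ weakE N ρ lam τ θ q Ω u φ

/-- `f_ρ(t) = t (t + 2ρ) + λ |t|^(1-τ)`. -/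
def fRho (ρ lam τ t : ℝ) : ℝ := t * (t + 2 * ρ) + lam * |t| ^ (1 - τ)

/-- `Υ = ((τ+1)/(2τ)) (λτ)^(1/(τ+1))`. -/
def Upsilon (lam τ : ℝ) : ℝ := ((τ + 1) / (2 * τ)) * (lam * τ) ^ (1 / (τ + 1))

/-- Case [N₀]: (a) `τ = 0` and `λ ≥ 2ρ`, or (b) `λ > 0`, `τ ∈ (0,1)` and `ρ < Υ`. -/
def CaseN0 (ρ lam τ : ℝ) : Prop :=
  (τ = 0 ∧ 2 * ρ ≤ lam) ∨ (0 < lam ∧ 0 < τ ∧ τ < 1 ∧ ρ < Upsilon lam τ)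

/-- Case [N₁]: (a) `τ = 0` and `λ < 2ρ`, or (b) `λ < 0` and `τ ∈ (0,1)`. -/
def CaseN1 (ρ lam τ : ℝ) : Prop :=
  (τ = 0 ∧ lam < 2 * ρ) ∨ (lam < 0 ∧ 0 < τ ∧ τ < 1)

/-- Case [N₂]: `λ > 0`, `τ ∈ (0,1)` and `ρ ≥ Υ`. -/
def CaseN2 (ρ lam τ : ℝ) : Prop :=
  0 < lam ∧ 0 < τ ∧ τ < 1 ∧ Upsilon lam τ ≤ ρ

/-- `w` is the smallest negative root of `f_ρ` (i.e. `w = ϖ₁`). -/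
def IsMinNegRoot (ρ lam τ w : ℝ) : Prop :=
  w < 0 ∧ fRho ρ lam τ w = 0 ∧ ∀ t, t < 0 → fRho ρ lam τ t = 0 → w ≤ t

/-- `w` is the largest negative root of `f_ρ` (i.e. `w = ϖ₂`). -/
def IsMaxNegRoot (ρ lam τ w : ℝ) : Prop :=
  w < 0 ∧ fRho ρ lam τ w = 0 ∧ ∀ t, t < 0 → fRho ρ lam τ t = 0 → t ≤ w

/-- `Φ_{ϖ₂}(r)`: equal to `r^(-ϖ₂)` if `ρ > Υ` and to `r^(-ϖ₂) |log r|^(2/(1+τ))` if `ρ = Υ`. -/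
def Phi2 (ρ lam τ w2 r : ℝ) : ℝ :=
  if ρ = Upsilon lam τ then r ^ (-w2) * |Real.log r| ^ (2 / (1 + τ)) else r ^ (-w2)

/-- `Ψ_{ϖ₁}(t)`: equal to `t^(-ϖ₁)` if `ρ > Υ` and to `t^(-ϖ₁) (log t)^(2/(1+τ))` if `ρ = Υ`. -/
def Psi1 (ρ lam τ w1 t : ℝ) : ℝ :=
  if ρ = Upsilon lam τ then t ^ (-w1) * (Real.log t) ^ (2 / (1 + τ)) else t ^ (-w1)

/-- The radial operator `L_{ρ,λ,τ}[P](r) = P'' + (1-2ρ) P'/r + λ P^τ |P'|^(1-τ)/r^(1+τ)`. -/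
def Lrad (ρ lam τ : ℝ) (P : ℝ → ℝ) (r : ℝ) : ℝ :=
  deriv (deriv P) r + (1 - 2 * ρ) * deriv P r / r
    + lam * P r ^ τ * |deriv P r| ^ (1 - τ) / r ^ (1 + τ)

/-- The Laplacian of `u` at `x`, as the trace of the second derivative. -/
def lapl {N : ℕ} (u : EuclideanSpace ℝ (Fin N) → ℝ) (x : EuclideanSpace ℝ (Fin N)) : ℝ :=
  ∑ i : Fin N, iteratedFDeriv ℝ 2 u x ![EuclideanSpace.single i 1, EuclideanSpace.single i 1]
/-- Alternative (i): `u(x) ~ a |x|^{-ϖ₁}` and `x·∇u(x) ~ -a ϖ₁ |x|^{-ϖ₁}` for some `a > 0`. -/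
def AltI (N : ℕ) (w1 : ℝ) (u : EuclideanSpace ℝ (Fin N) → ℝ) : Prop :=
  ∃ a : ℝ, 0 < a ∧
    Filter.Tendsto (fun x : EuclideanSpace ℝ (Fin N) => ‖x‖ ^ w1 * u x)
      (𝓝[≠] (0 : EuclideanSpace ℝ (Fin N))) (𝓝 a) ∧
    Filter.Tendsto (fun x : EuclideanSpace ℝ (Fin N) => ‖x‖ ^ w1 * ⟪x, gradient u x⟫)
      (𝓝[≠] (0 : EuclideanSpace ℝ (Fin N))) (𝓝 (-(a * w1)))

/-- Alternative (ii): `u(x) ~ b Φ_{ϖ₂}(|x|)` and `x·∇u(x) ~ -b ϖ₂ Φ_{ϖ₂}(|x|)` for some `b > 0`. -/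
def AltII (N : ℕ) (ρ lam τ w2 : ℝ) (u : EuclideanSpace ℝ (Fin N) → ℝ) : Prop :=
  ∃ b : ℝ, 0 < b ∧
    Filter.Tendsto (fun x : EuclideanSpace ℝ (Fin N) => u x / Phi2 ρ lam τ w2 ‖x‖)
      (𝓝[≠] (0 : EuclideanSpace ℝ (Fin N))) (𝓝 b) ∧
    Filter.Tendsto (fun x : EuclideanSpace ℝ (Fin N) => ⟪x, gradient u x⟫ / Phi2 ρ lam τ w2 ‖x‖)
      (𝓝[≠] (0 : EuclideanSpace ℝ (Fin N))) (𝓝 (-(b * w2)))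

/-- Alternative (iii): `u(x)/U_{ρ,β}(x) → 1` as `|x| → 0`. -/
def AltIII (N : ℕ) (ρ lam τ θ q : ℝ) (u : EuclideanSpace ℝ (Fin N) → ℝ) : Prop :=
  Filter.Tendsto (fun x : EuclideanSpace ℝ (Fin N) =>
      u x / ((fRho ρ lam τ ((θ + 2) / (q - 1))) ^ (1 / (q - 1)) * ‖x‖ ^ (-((θ + 2) / (q - 1)))))
    (𝓝[≠] (0 : EuclideanSpace ℝ (Fin N))) (𝓝 1)

lemma tsupport_subset_of_imp {E α : Type*} [TopologicalSpace E] [Zero α] {φ : E → ℝ} {χ : E → α}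
    (h : ∀ x ∉ tsupport φ, χ x = 0) : tsupport χ ⊆ tsupport φ :=
  closure_minimal (fun x hx => by_contra fun hn => hx (h x hn)) (isClosed_tsupport φ)

lemma continuous_mul_of_tsupport {E : Type*} [TopologicalSpace E] {U : Set E}
    (hU : IsOpen U) {g φ : E → ℝ}
    (hg : ContinuousOn g U) (hφc : ContinuousOn φ U) (hφ : tsupport φ ⊆ U) :
    Continuous fun x => g x * φ x :=
  (hg.mul hφc).continuous_of_tsupport_subset hU
    ((tsupport_subset_of_imp fun x hx => by simp [image_eq_zero_of_notMem_tsupport hx]).trans hφ)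

/-- A continuous factor on `U` times a continuous function supported in `U` is continuous. -/
lemma continuous_inner_of_tsupport {E : Type*} [NormedAddCommGroup E] [InnerProductSpace ℝ E]
    {U : Set E} (hU : IsOpen U) {X Y : E → E} {φ : E → ℝ}
    (hX : ContinuousOn X U) (hY : ContinuousOn Y U) (hφ : tsupport φ ⊆ U)
    (h : ∀ x ∉ tsupport φ, Y x = 0) : Continuous fun x => ⟪X x, Y x⟫ :=
  (hX.inner hY).continuous_of_tsupport_subset hU
    ((tsupport_subset_of_imp fun x hx => by simp [h x hx]).trans hφ)

section Gradient

variable {E : Type*} [NormedAddCommGroup E] [InnerProductSpace ℝ E] [FiniteDimensional ℝ E]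

lemma contDiff_one_of_hasGradientAt {φ : E → ℝ} {Y : E → E}
    (h : ∀ x, HasGradientAt φ (Y x) x) (hY : Continuous Y) : ContDiff ℝ 1 φ := by
  rw [contDiff_one_iff_hasFDerivAt]
  refine ⟨fun x => (InnerProductSpace.toDual ℝ E) (Y x), ?_, fun x => ?_⟩
  · exact (InnerProductSpace.toDual ℝ E).continuous.comp hY
  · exact (h x).hasFDerivAt

lemma continuous_gradient {φ : E → ℝ} (h : ContDiff ℝ 1 φ) : Continuous (gradient φ) :=
  (InnerProductSpace.toDual ℝ E).symm.continuous.comp (h.continuous_fderiv (by simp))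

lemma gradient_eq_zero_of_notMem_tsupport {φ : E → ℝ} {x : E} (hx : x ∉ tsupport φ) :
    gradient φ x = 0 := by
  have : φ =ᶠ[𝓝 x] fun _ => 0 := notMem_tsupport_iff_eventuallyEq.1 hx
  simp [gradient, this.fderiv_eq]

lemma hasGradientAt_of_contDiff {φ : E → ℝ} (h : ContDiff ℝ 1 φ) (x : E) :
    HasGradientAt φ (gradient φ x) x :=
  (h.differentiable (by simp) x).hasGradientAt

lemma HasGradientAt.add' {f h : E → ℝ} {a b x : E} (hf : HasGradientAt f a x)
    (hh : HasGradientAt h b x) : HasGradientAt (fun y => f y + h y) (a + b) x := by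
  rw [hasGradientAt_iff_hasFDerivAt, map_add]
  exact hf.hasFDerivAt.add hh.hasFDerivAt

lemma HasGradientAt.const_mul' {f : E → ℝ} {a x : E} (c : ℝ) (hf : HasGradientAt f a x) :
    HasGradientAt (fun y => c * f y) (c • a) x := by
  rw [hasGradientAt_iff_hasFDerivAt, map_smul]
  exact hf.hasFDerivAt.const_mul c

lemma HasGradientAt.mul' {f h : E → ℝ} {a b x : E} (hf : HasGradientAt f a x)
    (hh : HasGradientAt h b x) :
    HasGradientAt (fun y => f y * h y) (f x • b + h x • a) x := by
  rw [hasGradientAt_iff_hasFDerivAt, map_add, map_smul, map_smul]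
  exact hf.hasFDerivAt.mul hh.hasFDerivAt

lemma HasGradientAt.comp_deriv {f : E → ℝ} {a x : E} {η : ℝ → ℝ} {d : ℝ}
    (hf : HasGradientAt f a x) (hη : HasDerivAt η d (f x)) :
    HasGradientAt (fun y => η (f y)) (d • a) x := by
  rw [hasGradientAt_iff_hasFDerivAt, map_smul]
  exact hη.comp_hasFDerivAt x hf.hasFDerivAt

lemma IsLocalMax.hasGradientAt_eq_zero {f : E → ℝ} {a x : E} (h : IsLocalMax f x)
    (hf : HasGradientAt f a x) : a = 0 := by
  have := h.hasFDerivAt_eq_zero hf.hasFDerivAt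
  simpa using this

end Gradient

section WeakLaplacian

variable {E : Type*} [NormedAddCommGroup E] [InnerProductSpace ℝ E] [FiniteDimensional ℝ E]
  [MeasurableSpace E] [BorelSpace E]

/-- `f` is a `C¹` function on the open set `U` with gradient `X` and continuous distributional
Laplacian `g`. -/
structure HasWeakLaplacian (U : Set E) (f : E → ℝ) (X : E → E) (g : E → ℝ) : Prop where
  isOpen : IsOpen U
  grad : ∀ x ∈ U, HasGradientAt f (X x) x
  contX : ContinuousOn X U
  contg : ContinuousOn g U
  weak : ∀ φ : E → ℝ, ContDiff ℝ 1 φ → HasCompactSupport φ → tsupport φ ⊆ U →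
    ∫ x, ⟪X x, gradient φ x⟫ = -∫ x, g x * φ x

namespace HasWeakLaplacian

variable {U V : Set E} {f f' : E → ℝ} {X X' : E → E} {g g' : E → ℝ}

lemma contf (h : HasWeakLaplacian U f X g) : ContinuousOn f U := fun x hx =>
  (h.grad x hx).hasFDerivAt.continuousAt.continuousWithinAt

lemma integrable_inner (hU : IsOpen U) (hX : ContinuousOn X U) {φ : E → ℝ}
    (hφ : ContDiff ℝ 1 φ) (hc : HasCompactSupport φ) (hs : tsupport φ ⊆ U) :
    Integrable fun x => ⟪X x, gradient φ x⟫ := by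
  refine (continuous_inner_of_tsupport hU hX (continuous_gradient hφ).continuousOn hs
    fun x hx => gradient_eq_zero_of_notMem_tsupport hx).integrable_of_hasCompactSupport ?_
  exact hc.of_isClosed_subset (isClosed_tsupport _)
    (tsupport_subset_of_imp fun x hx => by simp [gradient_eq_zero_of_notMem_tsupport hx])

lemma integrable_mul (hU : IsOpen U) (hg : ContinuousOn g U) {φ : E → ℝ}
    (hφ : ContinuousOn φ U) (hc : HasCompactSupport φ) (hs : tsupport φ ⊆ U) :
    Integrable fun x => g x * φ x := by
  refine (continuous_mul_of_tsupport hU hg hφ hs).integrable_of_hasCompactSupport ?_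
  exact hc.of_isClosed_subset (isClosed_tsupport _)
    (tsupport_subset_of_imp fun x hx => by simp [image_eq_zero_of_notMem_tsupport hx])

lemma mono (h : HasWeakLaplacian U f X g) (hV : IsOpen V) (hVU : V ⊆ U) :
    HasWeakLaplacian V f X g :=
  ⟨hV, fun x hx => h.grad x (hVU hx), h.contX.mono hVU, h.contg.mono hVU,
    fun φ h1 h2 h3 => h.weak φ h1 h2 (h3.trans hVU)⟩

lemma congr (h : HasWeakLaplacian U f X g) (hX : ∀ x ∈ U, X' x = X x) (hg : ∀ x ∈ U, g' x = g x) :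
    HasWeakLaplacian U f X' g' := by
  refine ⟨h.isOpen, fun x hx => (hX x hx).symm ▸ h.grad x hx, h.contX.congr hX, h.contg.congr hg,
    fun φ h1 h2 h3 => ?_⟩
  have e1 : ∫ x, ⟪X' x, gradient φ x⟫ = ∫ x, ⟪X x, gradient φ x⟫ := by
    refine integral_congr_ae (ae_of_all _ fun x => ?_)
    by_cases hx : x ∈ tsupport φ
    · simp [hX x (h3 hx)]
    · simp [gradient_eq_zero_of_notMem_tsupport hx]
  have e2 : ∫ x, g' x * φ x = ∫ x, g x * φ x := by
    refine integral_congr_ae (ae_of_all _ fun x => ?_)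
    by_cases hx : x ∈ tsupport φ
    · simp [hg x (h3 hx)]
    · simp [image_eq_zero_of_notMem_tsupport hx]
  rw [e1, e2, h.weak φ h1 h2 h3]

lemma add (h : HasWeakLaplacian U f X g) (h' : HasWeakLaplacian U f' X' g') :
    HasWeakLaplacian U (fun x => f x + f' x) (fun x => X x + X' x) (fun x => g x + g' x) := by
  refine ⟨h.isOpen, fun x hx => (h.grad x hx).add' (h'.grad x hx), h.contX.add h'.contX,
    h.contg.add h'.contg, fun φ h1 h2 h3 => ?_⟩
  simp only [inner_add_left, add_mul]
  rw [integral_add (integrable_inner h.isOpen h.contX h1 h2 h3)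
      (integrable_inner h.isOpen h'.contX h1 h2 h3),
    integral_add (integrable_mul h.isOpen h.contg h1.continuous.continuousOn h2 h3)
      (integrable_mul h.isOpen h'.contg h1.continuous.continuousOn h2 h3),
    h.weak φ h1 h2 h3, h'.weak φ h1 h2 h3]
  ring

lemma const_mul (h : HasWeakLaplacian U f X g) (c : ℝ) :
    HasWeakLaplacian U (fun x => c * f x) (fun x => c • X x) (fun x => c * g x) := by
  refine ⟨h.isOpen, fun x hx => (h.grad x hx).const_mul' c, h.contX.const_smul c,
    h.contg.const_mul c, fun φ h1 h2 h3 => ?_⟩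
  simp only [inner_smul_left, mul_assoc, conj_trivial]
  rw [integral_const_mul, integral_const_mul, h.weak φ h1 h2 h3]
  ring

lemma neg (h : HasWeakLaplacian U f X g) :
    HasWeakLaplacian U (fun x => -f x) (fun x => -X x) (fun x => -g x) := by
  simpa using h.const_mul (-1)

lemma sub (h : HasWeakLaplacian U f X g) (h' : HasWeakLaplacian U f' X' g') :
    HasWeakLaplacian U (fun x => f x - f' x) (fun x => X x - X' x) (fun x => g x - g' x) := by
  simpa [sub_eq_add_neg] using h.add h'.neg

lemma add_const (h : HasWeakLaplacian U f X g) (c : ℝ) :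
    HasWeakLaplacian U (fun x => f x + c) X g := by
  refine ⟨h.isOpen, fun x hx => ?_, h.contX, h.contg, h.weak⟩
  rw [hasGradientAt_iff_hasFDerivAt]
  exact (h.grad x hx).hasFDerivAt.add_const c

/-- A `C²` function has a weak Laplacian, the trace of the derivative of its gradient. -/
lemma of_hasFDerivAt (hU : IsOpen U) {X' : E → E →L[ℝ] E}
    (hf : ∀ x ∈ U, HasGradientAt f (X x) x) (hX : ∀ x ∈ U, HasFDerivAt X (X' x) x)
    (hX' : ContinuousOn X' U) {ι : Type*} [Fintype ι] (e : OrthonormalBasis ι ℝ E) :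
    HasWeakLaplacian U f X (fun x => ∑ i, ⟪e i, X' x (e i)⟫) := by
  have hXc : ContinuousOn X U := fun x hx => (hX x hx).continuousAt.continuousWithinAt
  have hXi : ∀ i, ContinuousOn (fun x => ⟪e i, X' x (e i)⟫) U := fun i =>
    continuousOn_const.inner (hX'.clm_apply continuousOn_const)
  refine ⟨hU, hf, hXc, continuousOn_finsetSum _ fun i _ => hXi i, fun φ h1 h2 h3 => ?_⟩
  have key : ∀ i, ∫ x, ⟪e i, X x⟫ * fderiv ℝ φ x (e i) = -∫ x, ⟪e i, X' x (e i)⟫ * φ x := by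
    intro i
    have hd : ∀ x ∈ tsupport φ, HasFDerivAt (fun x => ⟪e i, X x⟫)
        ((innerSL ℝ (e i)).comp (X' x)) x := fun x hx =>
      ((innerSL ℝ (e i)).hasFDerivAt.comp x (hX x (h3 hx)))
    have hfd : ∀ x, fderiv ℝ (fun x => ⟪e i, X x⟫) x (e i) * φ x = ⟪e i, X' x (e i)⟫ * φ x := by
      intro x
      by_cases hx : x ∈ tsupport φ
      · rw [(hd x hx).fderiv]; simp
      · simp [image_eq_zero_of_notMem_tsupport hx]
    have hfd0 : ∀ x ∉ tsupport φ, fderiv ℝ φ x (e i) = 0 := fun x hx => by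
      have : φ =ᶠ[𝓝 x] fun _ => 0 := notMem_tsupport_iff_eventuallyEq.1 hx
      simp [this.fderiv_eq]
    have hfdc : Continuous fun x => fderiv ℝ φ x (e i) :=
      (h1.continuous_fderiv (by simp)).clm_apply continuous_const
    have hts := tsupport_subset_of_imp hfd0
    rw [integral_mul_fderiv_eq_neg_fderiv_mul_of_integrable]
    · congr 1
      exact integral_congr_ae (ae_of_all _ hfd)
    · simp_rw [hfd]
      exact integrable_mul hU (hXi i) h1.continuous.continuousOn h2 h3
    · exact integrable_mul hU (continuousOn_const.inner hXc) hfdc.continuousOn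
        (h2.of_isClosed_subset (isClosed_tsupport _) hts) (hts.trans h3)
    · exact integrable_mul hU (continuousOn_const.inner hXc) h1.continuous.continuousOn h2 h3
    · exact fun x hx => (hd x hx).differentiableAt
    · exact fun x _ => h1.differentiable (by simp) x
  have e1 : ∀ x, ⟪X x, gradient φ x⟫ = ∑ i, ⟪e i, X x⟫ * fderiv ℝ φ x (e i) := by
    intro x
    rw [← e.sum_inner_mul_inner]
    refine Finset.sum_congr rfl fun i _ => ?_
    rw [real_inner_comm (e i) (X x), real_inner_comm (gradient φ x) (e i), inner_gradient_left]
  have hinteg : ∀ i, Integrable fun x => ⟪e i, X x⟫ * fderiv ℝ φ x (e i) := by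
    intro i
    have hfd0 : ∀ x ∉ tsupport φ, fderiv ℝ φ x (e i) = 0 := fun x hx => by
      have : φ =ᶠ[𝓝 x] fun _ => 0 := notMem_tsupport_iff_eventuallyEq.1 hx
      simp [this.fderiv_eq]
    have hts := tsupport_subset_of_imp hfd0
    exact integrable_mul hU (continuousOn_const.inner hXc)
      ((h1.continuous_fderiv (by simp)).clm_apply continuous_const).continuousOn
      (h2.of_isClosed_subset (isClosed_tsupport _) hts) (hts.trans h3)
  simp_rw [e1, Finset.sum_mul]
  rw [integral_finsetSum _ fun i _ => hinteg i,
    integral_finsetSum _ fun i _ => integrable_mul hU (hXi i) h1.continuous.continuousOn h2 h3,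
    ← Finset.sum_neg_distrib]
  exact Finset.sum_congr rfl fun i _ => key i

/-- Pull-back by the rigid motion `x ↦ σ x + v`. -/
lemma comp_isometry (h : HasWeakLaplacian U f X g) (σ : E ≃ₗᵢ[ℝ] E) (v : E) :
    HasWeakLaplacian ((fun x => σ x + v) ⁻¹' U) (fun x => f (σ x + v))
      (fun x => σ.symm (X (σ x + v))) (fun x => g (σ x + v)) := by
  have hc : Continuous fun x => σ x + v := σ.continuous.add continuous_const
  refine ⟨h.isOpen.preimage hc, fun x hx => ?_,
    σ.symm.continuous.comp_continuousOn (h.contX.comp hc.continuousOn fun x hx => hx),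
    h.contg.comp hc.continuousOn fun x hx => hx, fun φ h1 h2 h3 => ?_⟩
  · have h1 := (h.grad (σ x + v) hx).hasFDerivAt
    have h2 : HasFDerivAt (fun x => σ x + v) (σ : E →L[ℝ] E) x :=
      (σ : E →L[ℝ] E).hasFDerivAt.add_const v
    rw [hasGradientAt_iff_hasFDerivAt]
    refine (h1.comp x h2).congr_fderiv ?_
    ext y
    exact (σ.symm.inner_map_eq_flip (X (σ x + v)) y).symm
  · set T : E → E := fun y => σ.symm (y - v) with hT
    have hTc : Continuous T := σ.symm.continuous.comp (continuous_id.sub continuous_const)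
    have hmp : MeasurePreserving (fun x => σ x + v) (volume : Measure E) volume :=
      (measurePreserving_add_right volume v).comp σ.measurePreserving
    have hemb : MeasurableEmbedding (fun x => σ x + v) :=
      (MeasurableEquiv.addRight v).measurableEmbedding.comp
        σ.toMeasurableEquiv.measurableEmbedding
    have hTT : ∀ x, T (σ x + v) = x := fun x => by simp [hT]
    have hgr : ∀ y, HasGradientAt (φ ∘ T) (σ (gradient φ (T y))) y := by
      intro y
      have h1 := (hasGradientAt_of_contDiff h1 (T y)).hasFDerivAt
      have h2 : HasFDerivAt T (σ.symm : E →L[ℝ] E) y :=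
        (σ.symm : E →L[ℝ] E).hasFDerivAt.comp y ((hasFDerivAt_id y).sub_const v)
      rw [hasGradientAt_iff_hasFDerivAt]
      refine (h1.comp y h2).congr_fderiv ?_
      ext z
      exact (σ.inner_map_eq_flip (gradient φ (T y)) z).symm
    have hts : tsupport (φ ∘ T) ⊆ (fun x => σ x + v) '' tsupport φ := by
      refine closure_minimal (fun y hy => ⟨T y, subset_tsupport _ hy, by simp [hT]⟩) ?_
      exact (h2.isCompact.image hc).isClosed
    have := h.weak (φ ∘ T) (contDiff_one_of_hasGradientAt hgr
        (σ.continuous.comp ((continuous_gradient h1).comp hTc)))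
      (HasCompactSupport.of_support_subset_isCompact (h2.isCompact.image hc)
        ((subset_tsupport _).trans hts))
      (hts.trans (Set.image_subset_iff.2 h3))
    simp only [(hgr _).gradient, Function.comp_apply] at this
    rw [← hmp.integral_comp hemb fun y => ⟪X y, σ (gradient φ (T y))⟫,
      ← hmp.integral_comp hemb fun y => g y * φ (T y)] at this
    simp only [hTT] at this
    rw [← this]
    refine integral_congr_ae (ae_of_all _ fun x => ?_)
    exact (σ.symm.inner_map_eq_flip _ _)

/-- The weak Laplacian of the logarithm of a positive function. -/
lemma log (h : HasWeakLaplacian U f X g) (hpos : ∀ x ∈ U, 0 < f x) :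
    HasWeakLaplacian U (fun x => Real.log (f x)) (fun x => (f x)⁻¹ • X x)
      (fun x => g x / f x - ‖(f x)⁻¹ • X x‖ ^ 2) := by
  have hne : ∀ x ∈ U, f x ≠ 0 := fun x hx => (hpos x hx).ne'
  have hic : ContinuousOn (fun x => (f x)⁻¹) U := h.contf.inv₀ hne
  have hXc : ContinuousOn (fun x => (f x)⁻¹ • X x) U := hic.smul h.contX
  refine ⟨h.isOpen, fun x hx => ?_, hXc, (h.contg.div h.contf hne).sub (hXc.norm.pow 2),
    fun φ h1 h2 h3 => ?_⟩
  · exact (h.grad x hx).comp_deriv (Real.hasDerivAt_log (hne x hx))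
  · have hsupp : tsupport (fun x => φ x * (f x)⁻¹) ⊆ tsupport φ :=
      tsupport_subset_of_imp fun x hx => by simp [image_eq_zero_of_notMem_tsupport hx]
    set Y : E → E := fun x => φ x • ((-((f x) ^ 2)⁻¹) • X x) + (f x)⁻¹ • gradient φ x with hY
    have hY0 : ∀ x ∉ tsupport φ, Y x = 0 := fun x hx => by
      simp [hY, image_eq_zero_of_notMem_tsupport hx, gradient_eq_zero_of_notMem_tsupport hx]
    have hgr : ∀ x, HasGradientAt (fun x => φ x * (f x)⁻¹) (Y x) x := by
      intro x
      by_cases hx : x ∈ tsupport φ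
      · exact (hasGradientAt_of_contDiff h1 x).mul'
          ((h.grad x (h3 hx)).comp_deriv (hasDerivAt_inv (hne x (h3 hx))))
      · rw [hY0 x hx, hasGradientAt_iff_hasFDerivAt, map_zero]
        have : (fun x => φ x * (f x)⁻¹) =ᶠ[𝓝 x] fun _ => 0 := by
          filter_upwards [notMem_tsupport_iff_eventuallyEq.1 hx] with y hy
          simp [hy]
        exact (hasFDerivAt_const (0 : ℝ) x).congr_of_eventuallyEq this
    have hYc : Continuous Y := by
      refine ContinuousOn.continuous_of_tsupport_subset ?_ h.isOpen
        ((tsupport_subset_of_imp hY0).trans h3)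
      refine (h1.continuous.continuousOn.smul ((ContinuousOn.neg
        ((h.contf.pow 2).inv₀ fun x hx => pow_ne_zero 2 (hne x hx))).smul h.contX)).add
        (hic.smul (continuous_gradient h1).continuousOn)
    have hw := h.weak _ (contDiff_one_of_hasGradientAt hgr hYc)
      (h2.of_isClosed_subset (isClosed_tsupport _) hsupp) (hsupp.trans h3)
    simp only [(hgr _).gradient] at hw
    have e1 : ∀ x, ⟪X x, Y x⟫ =
        ⟪(f x)⁻¹ • X x, gradient φ x⟫ - ‖(f x)⁻¹ • X x‖ ^ 2 * φ x := by
      intro x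
      simp only [hY, inner_add_right, inner_smul_right, inner_smul_left, norm_smul,
        real_inner_self_eq_norm_sq, mul_pow, norm_inv, Real.norm_eq_abs, inv_pow, sq_abs,
        conj_trivial]
      ring
    have e2 : ∀ x, (g x / f x - ‖(f x)⁻¹ • X x‖ ^ 2) * φ x =
        g x * (φ x * (f x)⁻¹) - ‖(f x)⁻¹ • X x‖ ^ 2 * φ x := fun x => by
      rw [div_eq_mul_inv]; ring
    have i1 := integrable_inner h.isOpen hXc h1 h2 h3
    have i2 : Integrable fun x => ‖(f x)⁻¹ • X x‖ ^ 2 * φ x :=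
      integrable_mul h.isOpen (hXc.norm.pow 2) h1.continuous.continuousOn h2 h3
    have i3 : Integrable fun x => g x * (φ x * (f x)⁻¹) := integrable_mul h.isOpen h.contg
      (h1.continuous.continuousOn.mul hic) (h2.of_isClosed_subset (isClosed_tsupport _) hsupp)
      (hsupp.trans h3)
    simp_rw [e1] at hw
    simp_rw [e2]
    rw [integral_sub i1 i2] at hw
    rw [integral_sub i3 i2]
    linarith

end HasWeakLaplacian

lemma hasDerivAt_max_zero_sq (t : ℝ) :
    HasDerivAt (fun t : ℝ => max t 0 ^ 2) (2 * max t 0) t := by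
  rcases lt_trichotomy t 0 with ht | rfl | ht
  · have : (fun t : ℝ => max t 0 ^ 2) =ᶠ[𝓝 t] fun _ => 0 := by
      filter_upwards [Iio_mem_nhds ht] with s hs
      simp [max_eq_right (le_of_lt (Set.mem_Iio.1 hs))]
    rw [max_eq_right ht.le, mul_zero]
    exact (hasDerivAt_const t (0 : ℝ)).congr_of_eventuallyEq this
  · rw [hasDerivAt_iff_isLittleO_nhds_zero]
    simp only [zero_add, max_self, mul_zero, smul_zero, sub_zero, ne_eq, OfNat.ofNat_ne_zero,
      not_false_eq_true, zero_pow]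
    refine Asymptotics.IsBigO.trans_isLittleO (g := fun h : ℝ => h ^ 2) ?_ ?_
    · refine Asymptotics.isBigO_of_le _ fun h => ?_
      rw [norm_pow, norm_pow]
      gcongr
      rcases le_total h 0 with hh | hh <;> simp [hh]
    · simpa using Asymptotics.isLittleO_pow_id (𝕜 := ℝ) (n := 2) (by norm_num)
  · have : (fun t : ℝ => max t 0 ^ 2) =ᶠ[𝓝 t] fun t => t ^ 2 := by
      filter_upwards [Ioi_mem_nhds ht] with s hs
      simp [max_eq_left (le_of_lt (Set.mem_Ioi.1 hs))]
    rw [max_eq_left ht.le]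
    simpa using (hasDerivAt_pow 2 t).congr_of_eventuallyEq this

/-- Maximum principle: if the weak Laplacian is positive at every interior critical point where
the maximum over `D` is attained, then the maximum is controlled by the boundary values. -/
theorem HasWeakLaplacian.le_of_pos_at_max {U D V : Set E} {h : E → ℝ} {X : E → E} {g : E → ℝ}
    {c : ℝ} (H : HasWeakLaplacian U h X g) (hD : IsCompact D) (hDU : D ⊆ U) (hV : IsOpen V)
    (hVD : V ⊆ D) (hbd : ∀ x ∈ D, x ∉ V → h x ≤ c)
    (hpos : ∀ x ∈ V, c < h x → (∀ y ∈ D, h y ≤ h x) → X x = 0 → 0 < g x) :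
    ∀ x ∈ D, h x ≤ c := by
  by_contra! hcon
  obtain ⟨x0, hx0, hcx0⟩ := hcon
  obtain ⟨x1, hx1, hmax⟩ := hD.exists_isMaxOn ⟨x0, hx0⟩ (H.contf.mono hDU)
  have hc1 : c < h x1 := hcx0.trans_le (hmax hx0)
  obtain ⟨c', hcc', hc'1, hZ⟩ : ∃ c', c < c' ∧ c' < h x1 ∧ ∀ x ∈ D, g x ≤ 0 → h x < c' := by
    set Z := {x ∈ D | g x ≤ 0} with hZd
    have hZc : IsCompact Z := by
      have : IsClosed Z := (H.contg.mono hDU).preimage_isClosed_of_isClosed hD.isClosed isClosed_Iic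
      exact hD.of_isClosed_subset this fun x hx => hx.1
    have hlt : ∀ x ∈ Z, h x < h x1 := by
      intro x hx
      refine lt_of_le_of_ne (hmax hx.1) fun heq => ?_
      have hxV : x ∈ V := by
        by_contra hn
        linarith [hbd x hx.1 hn]
      have hxm : ∀ y ∈ D, h y ≤ h x := fun y hy => heq ▸ hmax hy
      have hX0 : X x = 0 := by
        refine IsLocalMax.hasGradientAt_eq_zero ?_ (H.grad x (hDU hx.1))
        filter_upwards [hV.mem_nhds hxV] with y hy using hxm y (hVD hy)
      exact absurd hx.2 (not_le.2 (hpos x hxV (heq ▸ hc1) hxm hX0))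
    rcases Z.eq_empty_or_nonempty with hZe | hZn
    · obtain ⟨c', h1, h2⟩ := exists_between hc1
      refine ⟨c', h1, h2, fun x hx hgx => ?_⟩
      have : x ∈ Z := ⟨hx, hgx⟩
      simp [hZe] at this
    · obtain ⟨z, hz, hzm⟩ := hZc.exists_isMaxOn hZn (H.contf.mono fun x hx => hDU hx.1)
      obtain ⟨c', h1, h2⟩ := exists_between (max_lt hc1 (hlt z hz))
      exact ⟨c', (le_max_left _ _).trans_lt h1, h2, fun x hx hgx =>
        (hzm (⟨hx, hgx⟩ : x ∈ Z)).trans_lt ((le_max_right _ _).trans_lt h1)⟩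
  classical
  set K := {x ∈ D | c' ≤ h x} with hK
  have hKc : IsCompact K := by
    have : IsClosed K := (H.contf.mono hDU).preimage_isClosed_of_isClosed hD.isClosed isClosed_Ici
    exact hD.of_isClosed_subset this fun x hx => hx.1
  have hKV : K ⊆ V := fun x hx => by
    by_contra hn
    linarith [hbd x hx.1 hn, hx.2]
  set φ : E → ℝ := fun x => if x ∈ V then max (h x - c') 0 ^ 2 else 0 with hφ
  set Y : E → E := fun x => if x ∈ V then (2 * max (h x - c') 0) • X x else 0 with hY
  have hm0 : ∀ x ∈ V, x ∉ K → max (h x - c') 0 = 0 := fun x hx hxK => by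
    have : h x < c' := by
      by_contra hn
      exact hxK ⟨hVD hx, not_lt.1 hn⟩
    exact max_eq_right (by linarith)
  have hφ0 : ∀ x ∉ K, φ x = 0 := fun x hx => by
    by_cases hxV : x ∈ V
    · simp [hφ, hxV, hm0 x hxV hx]
    · simp [hφ, hxV]
  have hY0 : ∀ x ∉ K, Y x = 0 := fun x hx => by
    by_cases hxV : x ∈ V
    · simp [hY, hxV, hm0 x hxV hx]
    · simp [hY, hxV]
  have hφs : tsupport φ ⊆ K :=
    closure_minimal (fun x hx => by_contra fun hn => hx (hφ0 x hn)) hKc.isClosed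
  have hYs : tsupport Y ⊆ K :=
    closure_minimal (fun x hx => by_contra fun hn => hx (hY0 x hn)) hKc.isClosed
  have hgr : ∀ x, HasGradientAt φ (Y x) x := by
    intro x
    by_cases hx : x ∈ V
    · have h1 : HasGradientAt (fun y => max (h y - c') 0 ^ 2) (Y x) x := by
        simp only [hY, hx, if_true]
        have h2 : HasGradientAt (fun y => h y - c') (X x) x := by
          rw [hasGradientAt_iff_hasFDerivAt]
          exact (H.grad x (hDU (hVD hx))).hasFDerivAt.sub_const c'
        exact h2.comp_deriv (hasDerivAt_max_zero_sq (h x - c'))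
      rw [hasGradientAt_iff_hasFDerivAt] at h1 ⊢
      refine h1.congr_of_eventuallyEq ?_
      filter_upwards [hV.mem_nhds hx] with y hy
      simp [hφ, hy]
    · have hxK : x ∉ K := fun hk => hx (hKV hk)
      rw [hY0 x hxK, hasGradientAt_iff_hasFDerivAt, map_zero]
      refine (hasFDerivAt_const (0 : ℝ) x).congr_of_eventuallyEq ?_
      filter_upwards [hKc.isClosed.isOpen_compl.mem_nhds hxK] with y hy using hφ0 y hy
  have hmc : ContinuousOn (fun x => max (h x - c') 0) V :=
    ((H.contf.mono (hVD.trans hDU)).sub continuousOn_const).sup continuousOn_const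
  have hYc : Continuous Y := by
    refine ContinuousOn.continuous_of_tsupport_subset ?_ hV (hYs.trans hKV)
    refine (((continuousOn_const (c := (2 : ℝ))).mul hmc).smul (H.contX.mono
      (hVD.trans hDU))).congr fun x hx => ?_
    simp [hY, hx]
  have hφC := contDiff_one_of_hasGradientAt hgr hYc
  have hφcs : HasCompactSupport φ := hKc.of_isClosed_subset (isClosed_tsupport _) hφs
  have hsU : tsupport φ ⊆ U := hφs.trans (hKV.trans (hVD.trans hDU))
  have hw := H.weak φ hφC hφcs hsU
  simp only [(hgr _).gradient] at hw
  have h1 : 0 ≤ ∫ x, ⟪X x, Y x⟫ := by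
    refine integral_nonneg fun x => ?_
    by_cases hx : x ∈ V
    · simp only [hY, hx, if_true, inner_smul_right, real_inner_self_eq_norm_sq]
      have := le_max_right (h x - c') 0
      positivity
    · simp [hY, hx]
  have h2 : 0 < ∫ x, g x * φ x := by
    have hφn : ∀ x, 0 ≤ φ x := fun x => by
      by_cases hx : x ∈ V
      · simp only [hφ, hx, if_true]; positivity
      · simp [hφ, hx]
    have hgp : ∀ x ∈ K, 0 < g x := fun x hx => by
      by_contra hn
      linarith [hZ x hx.1 (not_lt.1 hn), hx.2]
    refine (continuous_mul_of_tsupport H.isOpen H.contg hφC.continuous.continuousOn hsU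
      ).integral_pos_of_hasCompactSupport_nonneg_nonzero (x := x1) ?_ (fun x => ?_) ?_
    · exact hφcs.of_isClosed_subset (isClosed_tsupport _)
        (tsupport_subset_of_imp fun x hx => by simp [image_eq_zero_of_notMem_tsupport hx])
    · by_cases hx : x ∈ K
      · exact mul_nonneg (hgp x hx).le (hφn x)
      · simp [hφ0 x hx]
    · have hx1K : x1 ∈ K := ⟨hx1, hc'1.le⟩
      have : φ x1 ≠ 0 := by
        simp only [hφ, hKV hx1K, if_true]
        have : 0 < max (h x1 - c') 0 := lt_max_of_lt_left (by linarith)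
        positivity
      exact mul_ne_zero (hgp x1 hx1K).ne' this
  linarith

end WeakLaplacian

section Barriers

variable {E : Type*} [NormedAddCommGroup E] [InnerProductSpace ℝ E] [FiniteDimensional ℝ E]
  [MeasurableSpace E] [BorelSpace E]

/-- The Laplacian of a radial function `η(‖x - y‖²)`. -/
lemma HasWeakLaplacian.radial {U : Set E} (hU : IsOpen U) (y : E) {η η₁ η₂ : ℝ → ℝ}
    (h1 : ∀ x ∈ U, HasDerivAt η (η₁ (‖x - y‖ ^ 2)) (‖x - y‖ ^ 2))
    (h2 : ∀ x ∈ U, HasDerivAt η₁ (η₂ (‖x - y‖ ^ 2)) (‖x - y‖ ^ 2))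
    (h3 : ContinuousOn (fun x => η₂ (‖x - y‖ ^ 2)) U) :
    HasWeakLaplacian U (fun x => η (‖x - y‖ ^ 2)) (fun x => (2 * η₁ (‖x - y‖ ^ 2)) • (x - y))
      (fun x => 4 * η₂ (‖x - y‖ ^ 2) * ‖x - y‖ ^ 2
        + 2 * Module.finrank ℝ E * η₁ (‖x - y‖ ^ 2)) := by
  have hsq : ∀ x, HasGradientAt (fun x : E => ‖x - y‖ ^ 2) ((2 : ℝ) • (x - y)) x := by
    intro x
    rw [hasGradientAt_iff_hasFDerivAt]
    refine ((hasFDerivAt_id x).sub_const y).norm_sq.congr_fderiv ?_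
    ext v
    simp [InnerProductSpace.toDual_apply_apply, two_mul]
  have hη1c : ContinuousOn (fun x => η₁ (‖x - y‖ ^ 2)) U := fun x hx =>
    (ContinuousAt.comp (f := fun x => ‖x - y‖ ^ 2) (h2 x hx).continuousAt
      (hsq x).hasFDerivAt.continuousAt).continuousWithinAt
  have key := HasWeakLaplacian.of_hasFDerivAt (f := fun x => η (‖x - y‖ ^ 2))
    (X := fun x => (2 * η₁ (‖x - y‖ ^ 2)) • (x - y))
    (X' := fun x => (2 * η₁ (‖x - y‖ ^ 2)) • ContinuousLinearMap.id ℝ E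
      + (4 * η₂ (‖x - y‖ ^ 2)) • (innerSL ℝ (x - y)).smulRight (x - y)) hU
    (fun x hx => ?_) (fun x hx => ?_) ?_ (stdOrthonormalBasis ℝ E)
  · refine key.congr (fun x _ => rfl) fun x _ => ?_
    set b := stdOrthonormalBasis ℝ E
    have e1 : ∀ i, ⟪b i, ((2 * η₁ (‖x - y‖ ^ 2)) • ContinuousLinearMap.id ℝ E
        + (4 * η₂ (‖x - y‖ ^ 2)) • (innerSL ℝ (x - y)).smulRight (x - y)) (b i)⟫
        = 2 * η₁ (‖x - y‖ ^ 2) + 4 * η₂ (‖x - y‖ ^ 2) * (⟪x - y, b i⟫ * ⟪b i, x - y⟫) := by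
      intro i
      simp only [add_apply, smul_apply, ContinuousLinearMap.id_apply,
        ContinuousLinearMap.smulRight_apply, innerSL_apply_apply, inner_add_right, inner_smul_right,
        real_inner_self_eq_norm_sq, b.norm_eq_one]
      ring
    simp only [e1]
    rw [Finset.sum_add_distrib, ← Finset.mul_sum (f := fun i => ⟪x - y, b i⟫ * ⟪b i, x - y⟫),
      b.sum_inner_mul_inner,
      real_inner_self_eq_norm_sq]
    simp
    ring
  · convert (hsq x).comp_deriv (h1 x hx) using 1
    rw [smul_smul]; ring_nf
  · have a1 := ((h2 x hx).comp_hasFDerivAt x (hsq x).hasFDerivAt).const_mul 2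
    refine (a1.smul ((hasFDerivAt_id x).sub_const y)).congr_fderiv ?_
    ext v
    simp only [add_apply, smul_apply,
      ContinuousLinearMap.smulRight_apply, InnerProductSpace.toDual_apply_apply, inner_smul_left,
      innerSL_apply_apply, conj_trivial, smul_smul, smul_eq_mul, Function.comp_apply,
      ContinuousLinearMap.id_apply, id]
    congr 2
    ring
  · refine ((hη1c.const_mul 2).smul continuousOn_const).add
      ((h3.const_mul 4).smul (Continuous.continuousOn ?_))
    have : Continuous fun x : E => x - y := continuous_id.sub continuous_const
    exact ((ContinuousLinearMap.smulRightL ℝ E E).continuous₂).comp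
      (((innerSL ℝ).continuous.comp this).prodMk this)

/-- The Laplacian of a quadratic polynomial of one linear coordinate. -/
lemma HasWeakLaplacian.quadratic_coord (e x₀ : E) (c₁ c₂ : ℝ) :
    HasWeakLaplacian Set.univ (fun x => c₁ * ⟪e, x - x₀⟫ - c₂ * ⟪e, x - x₀⟫ ^ 2)
      (fun x => (c₁ - 2 * c₂ * ⟪e, x - x₀⟫) • e) (fun _ => -(2 * c₂ * ‖e‖ ^ 2)) := by
  have hlin : ∀ x, HasGradientAt (fun x : E => ⟪e, x - x₀⟫) e x := by
    intro x
    rw [hasGradientAt_iff_hasFDerivAt]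
    exact (innerSL ℝ e).hasFDerivAt.comp x ((hasFDerivAt_id x).sub_const x₀)
  have key := HasWeakLaplacian.of_hasFDerivAt
    (f := fun x => c₁ * ⟪e, x - x₀⟫ - c₂ * ⟪e, x - x₀⟫ ^ 2)
    (X := fun x => (c₁ - 2 * c₂ * ⟪e, x - x₀⟫) • e)
    (X' := fun _ => (-(2 * c₂)) • (innerSL ℝ e).smulRight e) isOpen_univ
    (fun x _ => ?_) (fun x _ => ?_) continuousOn_const (stdOrthonormalBasis ℝ E)
  · refine key.congr (fun x _ => rfl) fun x _ => ?_
    set b := stdOrthonormalBasis ℝ E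
    have e1 : ∀ i, ⟪b i, ((-(2 * c₂)) • (innerSL ℝ e).smulRight e) (b i)⟫
        = -(2 * c₂) * (⟪e, b i⟫ * ⟪b i, e⟫) := by
      intro i
      simp only [smul_apply, ContinuousLinearMap.smulRight_apply,
        innerSL_apply_apply, inner_smul_right]
    simp only [e1]
    rw [← Finset.mul_sum, b.sum_inner_mul_inner, real_inner_self_eq_norm_sq]
    ring
  · have := ((hasDerivAt_id ⟪e, x - x₀⟫).const_mul c₁).sub
      ((hasDerivAt_pow 2 ⟪e, x - x₀⟫).const_mul c₂)
    convert (hlin x).comp_deriv this using 2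
    simp; ring
  · have := ((hlin x).hasFDerivAt.const_mul (2 * c₂)).const_sub c₁
    refine (this.smul_const e).congr_fderiv ?_
    ext v
    simp [InnerProductSpace.toDual_apply_apply, smul_smul]

end Barriers

section GradientEstimate

variable {E : Type*} [NormedAddCommGroup E] [InnerProductSpace ℝ E] [FiniteDimensional ℝ E]

lemma inner_nonpos_of_le_along_ray {k : E → ℝ} {a x e : E} {R : ℝ} (hR : 0 < R)
    (hk : HasGradientAt k a x) (hx : k x = 0) (h : ∀ t, 0 < t → t < R → k (x + t • e) ≤ 0) :
    ⟪a, e⟫ ≤ 0 := by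
  have h1 : HasDerivAt (fun t : ℝ => x + t • e) e 0 := by
    simpa using ((hasDerivAt_id (0 : ℝ)).smul_const e).const_add x
  have h2 : HasDerivAt (fun t : ℝ => k (x + t • e)) ⟪a, e⟫ 0 := by
    have hk' : HasFDerivAt k ((InnerProductSpace.toDual ℝ E) a) (x + (0 : ℝ) • e) := by
      simpa using hk.hasFDerivAt
    exact hk'.comp_hasDerivAt (0 : ℝ) h1
  have h3 := (hasDerivAt_iff_tendsto_slope.1 h2).mono_left
    (nhdsWithin_mono 0 fun t (ht : t ∈ Set.Ioi (0 : ℝ)) => (ne_of_gt ht : t ≠ 0))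
  refine le_of_tendsto h3 ?_
  filter_upwards [Ioo_mem_nhdsGT hR] with t ht
  rw [slope_def_field]
  simp only [zero_smul, add_zero, hx, sub_zero]
  exact div_nonpos_of_nonpos_of_nonneg (h t ht.1 ht.2) ht.1.le

variable [MeasurableSpace E] [BorelSpace E]

/-- Interior gradient estimate for functions with bounded weak Laplacian. -/
theorem HasWeakLaplacian.norm_gradient_le {U : Set E} {f : E → ℝ} {X : E → E} {g : E → ℝ}
    (H : HasWeakLaplacian U f X g) {x₀ : E} {R A B : ℝ} (hR : 0 < R)
    (hU : Metric.closedBall x₀ R ⊆ U) (hf : ∀ x ∈ Metric.closedBall x₀ R, |f x| ≤ A)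
    (hg : ∀ x ∈ Metric.closedBall x₀ R, |g x| ≤ B) :
    ‖X x₀‖ ≤ Module.finrank ℝ E * A / R + B * R := by
  have hx₀ : x₀ ∈ Metric.closedBall x₀ R := Metric.mem_closedBall_self hR.le
  have hA : 0 ≤ A := (abs_nonneg _).trans (hf x₀ hx₀)
  have hB : 0 ≤ B := (abs_nonneg _).trans (hg x₀ hx₀)
  rcases eq_or_ne (X x₀) 0 with h0 | h0
  · rw [h0, norm_zero]; positivity
  refine le_of_forall_pos_le_add fun ε hε => ?_
  set n : ℝ := (Module.finrank ℝ E : ℝ)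
  set e : E := ‖X x₀‖⁻¹ • X x₀ with he
  have hX0 : 0 < ‖X x₀‖ := norm_pos_iff.2 h0
  have hen : ‖e‖ = 1 := by rw [he, norm_smul, norm_inv, norm_norm, inv_mul_cancel₀ hX0.ne']
  have hee : ⟪e, e⟫ = 1 := by rw [real_inner_self_eq_norm_sq, hen]; norm_num
  set σ : E ≃ₗᵢ[ℝ] E := (ℝ ∙ e)ᗮ.reflection with hσ
  have hσa : ∀ v, σ v = v - (2 * ⟪e, v⟫) • e := by
    intro v
    rw [hσ, Submodule.reflection_orthogonal_apply, Submodule.reflection_singleton_apply]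
    simp [hen, two_smul, two_mul, add_smul]
  have hσs : σ.symm = σ := Submodule.reflection_symm
  set v : E := x₀ - σ x₀
  have hσv : ∀ x, σ x + v = x₀ + σ (x - x₀) := fun x => by rw [map_sub]; simp only [v]; abel
  have hσb : ∀ x ∈ Metric.closedBall x₀ R, σ x + v ∈ Metric.closedBall x₀ R := by
    intro x hx
    rw [mem_closedBall_iff_norm] at hx ⊢
    rw [hσv, add_sub_cancel_left, σ.norm_map]
    exact hx
  set W : Set E := U ∩ (fun x => σ x + v) ⁻¹' U
  have hW : IsOpen W := H.isOpen.inter (H.comp_isometry σ v).isOpen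
  have hBW : Metric.closedBall x₀ R ⊆ W := fun x hx => ⟨hU hx, hU (hσb x hx)⟩
  set c₂ : ℝ := n * A / R ^ 2 + B / 2 + ε / R with hc₂
  have hc₂0 : 0 ≤ c₂ := by positivity
  have H1 := ((H.mono hW Set.inter_subset_left).sub
    ((H.comp_isometry σ v).mono hW Set.inter_subset_right)).const_mul (1 / 2)
  have H2 := ((HasWeakLaplacian.radial (U := W) hW x₀ (η := fun t => t) (η₁ := fun _ => 1)
    (η₂ := fun _ => 0) (fun x _ => hasDerivAt_id _) (fun x _ => hasDerivAt_const _ _)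
    continuousOn_const).const_mul (A / R ^ 2)).add
    ((HasWeakLaplacian.quadratic_coord e x₀ (c₂ * R) c₂).mono hW (Set.subset_univ _))
  have H3 := H1.sub H2
  set y : E → ℝ := fun x => ⟪e, x - x₀⟫ with hy
  have hyc : Continuous y := continuous_const.inner (continuous_id.sub continuous_const)
  have hyR : ∀ x ∈ Metric.closedBall x₀ R, y x ≤ R := by
    intro x hx
    rw [mem_closedBall_iff_norm] at hx
    calc y x ≤ ‖e‖ * ‖x - x₀‖ := real_inner_le_norm _ _
      _ ≤ R := by rw [hen, one_mul]; exact hx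
  have hcomp := H3.le_of_pos_at_max (D := Metric.closedBall x₀ R ∩ {x | 0 ≤ y x})
    (V := Metric.ball x₀ R ∩ {x | 0 < y x}) (c := 0)
    ((isCompact_closedBall x₀ R).inter_right (isClosed_le continuous_const hyc))
    (fun x hx => hBW hx.1)
    (Metric.isOpen_ball.inter (isOpen_lt continuous_const hyc))
    (fun x hx => ⟨Metric.ball_subset_closedBall hx.1, le_of_lt (show 0 < y x from hx.2)⟩) ?_ ?_
  · have hgr := H3.grad x₀ (hBW hx₀)
    have hle := inner_nonpos_of_le_along_ray (e := e) hR hgr ?_ ?_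
    · have hXe : X x₀ = ‖X x₀‖ • e := by
        rw [he, smul_smul, mul_inv_cancel₀ hX0.ne', one_smul]
      have hsx : σ x₀ + v = x₀ := by rw [hσv]; simp
      simp only [hsx, sub_self, smul_zero, inner_zero_right, mul_zero, sub_zero, zero_add, hσs,
        inner_sub_left, inner_smul_left, conj_trivial] at hle
      rw [hσa] at hle
      simp only [inner_sub_left, inner_smul_left, hee, conj_trivial] at hle
      have h5 : ⟪X x₀, e⟫ = ‖X x₀‖ := by
        conv_lhs => rw [hXe]
        rw [inner_smul_left, hee]; simp
      rw [real_inner_comm] at h5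
      simp only [real_inner_comm e (X x₀), h5] at hle
      have : c₂ * R = n * A / R + B / 2 * R + ε := by
        rw [hc₂]; field_simp
      nlinarith
    · have hsx : σ x₀ + v = x₀ := by rw [hσv]; simp
      simp [hsx]
    · intro t ht0 htR
      refine hcomp (x₀ + t • e) ⟨?_, ?_⟩
      · rw [mem_closedBall_iff_norm, add_sub_cancel_left, norm_smul, hen, mul_one,
          Real.norm_eq_abs, abs_of_pos ht0]
        exact htR.le
      · simp only [hy, Set.mem_ofPred_eq, add_sub_cancel_left, inner_smul_right, hee]
        linarith
  · rintro x ⟨hxb, hxy⟩ hxV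
    have hq : 0 ≤ c₂ * R * y x - c₂ * y x ^ 2 := by
      have := hyR x hxb
      have h0 : 0 ≤ y x := hxy
      have : 0 ≤ c₂ * y x * (R - y x) := by
        apply mul_nonneg (by positivity); linarith
      nlinarith
    by_cases hy0 : y x = 0
    · have : σ x + v = x := by
        rw [hσv, hσa]
        have : ⟪e, x - x₀⟫ = 0 := hy0
        rw [this]; simp
      simp only [this, sub_self, mul_zero, zero_sub, neg_nonpos]
      have : 0 ≤ A / R ^ 2 * ‖x - x₀‖ ^ 2 := by positivity
      linarith
    · have hn : ‖x - x₀‖ = R := by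
        rw [mem_closedBall_iff_norm] at hxb
        refine le_antisymm hxb (not_lt.1 fun hlt => hxV ⟨mem_ball_iff_norm.2 hlt, ?_⟩)
        exact lt_of_le_of_ne hxy (Ne.symm hy0)
      have h1 := abs_le.1 (hf x hxb)
      have h2 := abs_le.1 (hf _ (hσb x hxb))
      have h3 : A / R ^ 2 * ‖x - x₀‖ ^ 2 = A := by rw [hn]; field_simp
      linarith
  · rintro x ⟨hxb, _⟩ _ _ _
    have hxb' := Metric.ball_subset_closedBall hxb
    have h1 := abs_le.1 (hg x hxb')
    have h2 := abs_le.1 (hg _ (hσb x hxb'))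
    have h3 : 2 * c₂ = 2 * (A / R ^ 2 * n) + B + 2 * (ε / R) := by rw [hc₂]; ring
    have h4 : 0 < ε / R := by positivity
    rw [hen]
    simp only [mul_zero, zero_mul, zero_add, mul_one, one_pow]
    nlinarith

end GradientEstimate

section Harnack

variable {E : Type*} [NormedAddCommGroup E] [InnerProductSpace ℝ E] [FiniteDimensional ℝ E]
  [MeasurableSpace E] [BorelSpace E]

/-- Gradient estimate when the weak Laplacian is controlled by the gradient. -/
theorem HasWeakLaplacian.norm_gradient_le_of_abs_le {U : Set E} {f : E → ℝ} {X : E → E}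
    {g : E → ℝ} (H : HasWeakLaplacian U f X g) {y : E} {r A M : ℝ} (hr : 0 < r) (hA : 0 ≤ A)
    (hU : Metric.closedBall y r ⊆ U) (hf : ∀ x ∈ Metric.closedBall y r, |f x| ≤ M)
    (hg : ∀ x ∈ Metric.closedBall y r, |g x| ≤ A * (‖X x‖ / r + M / r ^ 2)) :
    ∀ x ∈ Metric.closedBall y (r / 2),
      ‖X x‖ ≤ (4 * Module.finrank ℝ E * (2 + 4 * A) + 1) * M / r := by
  set n : ℝ := (Module.finrank ℝ E : ℝ) with hn
  have hy : y ∈ Metric.closedBall y r := Metric.mem_closedBall_self hr.le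
  have hM : 0 ≤ M := (abs_nonneg _).trans (hf y hy)
  have hcont : ContinuousOn (fun x => (r - ‖x - y‖) * ‖X x‖) (Metric.closedBall y r) :=
    (Continuous.continuousOn (by fun_prop)).mul (H.contX.mono hU).norm
  obtain ⟨x₁, hx₁, hmax⟩ := (isCompact_closedBall y r).exists_isMaxOn ⟨y, hy⟩ hcont
  set δ := r - ‖x₁ - y‖ with hδ
  set P := δ * ‖X x₁‖ with hP
  have hle : ∀ x ∈ Metric.closedBall y r, (r - ‖x - y‖) * ‖X x‖ ≤ P := fun x hx => hmax hx
  have hδ0 : 0 ≤ δ := by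
    have := mem_closedBall_iff_norm.1 hx₁
    linarith
  have hδr : δ ≤ r := by linarith [norm_nonneg (x₁ - y)]
  have hPM : P ≤ (2 * n * (2 + 4 * A) + 1 / 2) * M := by
    rcases hδ0.eq_or_lt with h0 | h0
    · rw [hP, ← h0, zero_mul]; positivity
    have hP0 : 0 ≤ P := by positivity
    set κ := 1 / (2 + 4 * A) with hκ
    have hκ0 : 0 < κ := by positivity
    have hκ2 : κ ≤ 1 / 2 := by
      rw [hκ]; apply one_div_le_one_div_of_le <;> linarith
    have hAκ : A * κ ≤ 1 / 4 := by
      rw [hκ, mul_one_div, div_le_iff₀ (by positivity)]; linarith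
    have hball : ∀ x ∈ Metric.closedBall x₁ (κ * δ), δ / 2 ≤ r - ‖x - y‖ := by
      intro x hx
      rw [mem_closedBall_iff_norm] at hx
      have h1 : ‖x - y‖ ≤ ‖x - x₁‖ + ‖x₁ - y‖ := by
        simpa using norm_add_le (x - x₁) (x₁ - y)
      nlinarith
    have hsub : Metric.closedBall x₁ (κ * δ) ⊆ Metric.closedBall y r := fun x hx => by
      rw [mem_closedBall_iff_norm]
      linarith [hball x hx]
    have hgb : ∀ x ∈ Metric.closedBall x₁ (κ * δ), |g x| ≤ A * (2 * P + M) / δ ^ 2 := by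
      intro x hx
      refine (hg x (hsub hx)).trans ?_
      have h1 := hball x hx
      have h2 : ‖X x‖ ≤ 2 * P / δ := by
        rw [le_div_iff₀ h0]
        nlinarith [hle x (hsub hx), norm_nonneg (X x)]
      have h3 : ‖X x‖ / r ≤ 2 * P / δ / δ := div_le_div₀ (by positivity) h2 h0 hδr
      have h4 : M / r ^ 2 ≤ M / δ ^ 2 := by gcongr
      calc A * (‖X x‖ / r + M / r ^ 2) ≤ A * (2 * P / δ / δ + M / δ ^ 2) := by gcongr
        _ = _ := by field_simp
    have key := H.norm_gradient_le (x₀ := x₁) (R := κ * δ) (by positivity) (hsub.trans hU)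
      (fun x hx => hf x (hsub hx)) hgb
    have h5 : P ≤ n * M * (2 + 4 * A) + (A * κ) * (2 * P + M) := by
      calc P ≤ δ * (n * M / (κ * δ) + A * (2 * P + M) / δ ^ 2 * (κ * δ)) := by
            rw [hP]; gcongr
        _ = n * M / κ + A * κ * (2 * P + M) := by field_simp
        _ = _ := by rw [hκ]; field_simp
    nlinarith
  intro x hx
  have hx' := Metric.closedBall_subset_closedBall (by linarith : r / 2 ≤ r) hx
  have h1 := hle x hx'
  rw [mem_closedBall_iff_norm] at hx
  rw [le_div_iff₀ hr]
  have h2 : r / 2 * ‖X x‖ ≤ P := by nlinarith [norm_nonneg (X x)]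
  nlinarith

/-- Comparison of a positive function with the barrier `‖x - y‖^(-2k)` in an annulus. -/
lemma HasWeakLaplacian.barrier_le {U : Set E} {f : E → ℝ} {X : E → E} {g : E → ℝ} {y : E}
    {R A r₂ K : ℝ} {k : ℕ} (H : HasWeakLaplacian U f X g) (hR : 0 < R) (hr₂0 : 0 < r₂)
    (hA : 0 < A) (hkn : (Module.finrank ℝ E : ℝ) < k) (hkA : 2 * A < k) (hK0 : 0 < K)
    (hU : Metric.closedBall y (2 * R) ⊆ U) (hf : ∀ x ∈ Metric.closedBall y (2 * R), 0 < f x)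
    (hg : ∀ x ∈ Metric.closedBall y (2 * R), |g x| ≤ A * (‖X x‖ / R + f x / R ^ 2))
    (hlow : ∀ x, ‖x - y‖ = r₂ → K * (r₂ ^ (2 * k))⁻¹ ≤ f x) :
    ∀ x ∈ Metric.closedBall y (2 * R) ∩ {x | r₂ ≤ ‖x - y‖},
      K * (((‖x - y‖ ^ 2) ^ k)⁻¹ - ((2 * R) ^ (2 * k))⁻¹) ≤ f x := by
  set W : Set E := U ∩ {x | x ≠ y} with hW
  have hWo : IsOpen W := H.isOpen.inter isOpen_ne
  have hW0 : ∀ x ∈ W, ‖x - y‖ ^ 2 ≠ 0 := fun x hx => by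
    have : x - y ≠ 0 := sub_ne_zero.2 hx.2
    positivity
  have H2 := (((HasWeakLaplacian.radial (U := W) hWo y (η := fun t => t ^ (-(k : ℤ)))
    (η₁ := fun t => ((-(k : ℤ) : ℤ) : ℝ) * t ^ (-(k : ℤ) - 1))
    (η₂ := fun t => ((-(k : ℤ) : ℤ) : ℝ) * (((-(k : ℤ) - 1 : ℤ) : ℝ) * t ^ (-(k : ℤ) - 1 - 1)))
    (fun x hx => hasDerivAt_zpow _ _ (Or.inl (hW0 x hx)))
    (fun x hx => (hasDerivAt_zpow _ _ (Or.inl (hW0 x hx))).const_mul _)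
    (by
      refine ContinuousOn.mul continuousOn_const (ContinuousOn.mul continuousOn_const ?_)
      exact ContinuousOn.zpow₀ (Continuous.continuousOn (by fun_prop)) _
        fun x hx => Or.inl (hW0 x hx))).const_mul K).add_const
      (-(K * ((2 * R) ^ (2 * k))⁻¹))).sub (H.mono hWo Set.inter_subset_left)
  have hnc : Continuous fun x : E => ‖x - y‖ := by fun_prop
  have hcomp := H2.le_of_pos_at_max (D := Metric.closedBall y (2 * R) ∩ {x | r₂ ≤ ‖x - y‖})
    (V := Metric.ball y (2 * R) ∩ {x | r₂ < ‖x - y‖}) (c := 0)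
    ((isCompact_closedBall y (2 * R)).inter_right (isClosed_le continuous_const hnc))
    (fun x hx => ⟨hU hx.1, fun h => ?_⟩)
    (Metric.isOpen_ball.inter (isOpen_lt continuous_const hnc))
    (fun x hx => ⟨Metric.ball_subset_closedBall hx.1,
      le_of_lt (show r₂ < ‖x - y‖ from hx.2)⟩) ?_ ?_
  · intro x hx
    have := hcomp x hx
    simp only [zpow_neg, zpow_natCast] at this
    linarith
  · have h2 : r₂ ≤ ‖x - y‖ := hx.2
    rw [show x = y from h, sub_self, norm_zero] at h2
    linarith
  · rintro x ⟨hxb, hxr⟩ hxV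
    have hfx := hf x (hxb)
    have hxr' : r₂ ≤ ‖x - y‖ := hxr
    simp only [zpow_neg, zpow_natCast]
    rcases hxr'.eq_or_lt with he | hlt
    · have h1 := hlow x he.symm
      rw [← he, ← pow_mul]
      have h3 : 0 < K * ((2 * R) ^ (2 * k))⁻¹ := by positivity
      linarith
    · have hn2 : ‖x - y‖ = 2 * R := by
        rw [mem_closedBall_iff_norm] at hxb
        exact le_antisymm hxb (not_lt.1 fun h => hxV ⟨mem_ball_iff_norm.2 h, hlt⟩)
      rw [hn2, ← pow_mul]
      linarith
  · rintro x ⟨hxb, hxr⟩ hpos _ hX0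
    have hxr' : r₂ < ‖x - y‖ := hxr
    set ρ := ‖x - y‖ with hρ
    have hρ0 : 0 < ρ := hr₂0.trans hxr'
    have hρR : ρ ≤ 2 * R := (mem_ball_iff_norm.1 hxb).le
    have hgx := hg x (Metric.ball_subset_closedBall hxb)
    set T : ℝ := (ρ ^ 2) ^ (-(k : ℤ)) with hT
    have hT0 : 0 < T := by positivity
    have hρ2 : ρ ^ 2 ≠ 0 := by positivity
    have hT1 : (ρ ^ 2) ^ (-(k : ℤ) - 1) = T / ρ ^ 2 := by
      rw [zpow_sub_one₀ hρ2, hT]; rfl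
    have hT2 : (ρ ^ 2) ^ (-(k : ℤ) - 1 - 1) = T / ρ ^ 2 / ρ ^ 2 := by
      rw [zpow_sub_one₀ hρ2, hT1]; rfl
    simp only [hT1, hT2] at hX0 ⊢
    push_cast at hX0 ⊢
    have hXn : ‖X x‖ = 2 * k * K * T / ρ := by
      rw [← sub_eq_zero.1 hX0, norm_smul, norm_smul, ← hρ, Real.norm_eq_abs, Real.norm_eq_abs,
        abs_of_pos hK0, show 2 * (-(k : ℝ) * (T / ρ ^ 2)) = -(2 * (k * (T / ρ ^ 2))) by ring,
        abs_neg, abs_of_nonneg (by positivity)]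
      field_simp
    have hfx : f x ≤ K * T := by
      have : 0 < K * ((2 * R) ^ (2 * k))⁻¹ := by positivity
      linarith
    have hRi : 1 / R ≤ 2 / ρ := by
      rw [div_le_div_iff₀ hR hρ0]; linarith
    have hgle : g x ≤ A * (4 * k + 4) * (K * T / ρ ^ 2) := by
      refine (le_abs_self _).trans (hgx.trans ?_)
      have h1 : ‖X x‖ / R ≤ 4 * k * (K * T / ρ ^ 2) := by
        rw [hXn, div_eq_mul_one_div]
        calc 2 * k * K * T / ρ * (1 / R) ≤ 2 * k * K * T / ρ * (2 / ρ) := by gcongr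
          _ = _ := by field_simp; ring
      have h2 : f x / R ^ 2 ≤ 4 * (K * T / ρ ^ 2) := by
        calc f x / R ^ 2 = f x * (1 / R) ^ 2 := by field_simp
          _ ≤ K * T * (2 / ρ) ^ 2 := by gcongr
          _ = _ := by field_simp; ring
      calc A * (‖X x‖ / R + f x / R ^ 2)
          ≤ A * (4 * k * (K * T / ρ ^ 2) + 4 * (K * T / ρ ^ 2)) := by gcongr
        _ = _ := by ring
    have hlap : K * (4 * (-(k : ℝ) * ((-(k : ℝ) - 1) * (T / ρ ^ 2 / ρ ^ 2))) * ρ ^ 2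
        + 2 * (Module.finrank ℝ E : ℝ) * (-(k : ℝ) * (T / ρ ^ 2)))
        = 2 * k * (2 * k + 2 - Module.finrank ℝ E) * (K * T / ρ ^ 2) := by
      field_simp; ring
    rw [hlap]
    have hpos' : 0 < K * T / ρ ^ 2 := by positivity
    have : 0 < 2 * k * (2 * k + 2 - Module.finrank ℝ E) - A * (4 * k + 4) := by nlinarith
    nlinarith

variable (E) in
/-- Harnack-type gradient bound for positive functions. -/
theorem exists_norm_gradient_le_mul (A : ℝ) (hA : 0 < A) : ∃ C : ℝ, 0 < C ∧
    ∀ (U : Set E) (f : E → ℝ) (X : E → E) (g : E → ℝ) (x₀ : E) (R : ℝ),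
      HasWeakLaplacian U f X g → 0 < R → Metric.closedBall x₀ (3 * R) ⊆ U →
      (∀ x ∈ Metric.closedBall x₀ (3 * R), 0 < f x) →
      (∀ x ∈ Metric.closedBall x₀ (3 * R), |g x| ≤ A * (‖X x‖ / R + f x / R ^ 2)) →
      R * ‖X x₀‖ ≤ C * f x₀ := by
  set n : ℝ := (Module.finrank ℝ E : ℝ) with hn
  set C₀ : ℝ := 4 * n * (2 + 4 * A) + 1 with hC₀
  have hC₀1 : 1 ≤ C₀ := by
    have : 0 ≤ 4 * n * (2 + 4 * A) := by positivity
    linarith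
  obtain ⟨k, hk⟩ := exists_nat_gt (max n (max (2 * A) 1))
  have hkn : n < k := (le_max_left _ _).trans_lt hk
  have hkA : 2 * A < k := ((le_max_left _ _).trans (le_max_right _ _)).trans_lt hk
  have hk1 : (1 : ℝ) < k := ((le_max_right _ _).trans (le_max_right _ _)).trans_lt hk
  set c₂ : ℝ := 1 / (4 * C₀ * 2 ^ (2 * k) + 4) with hc₂
  have hc₂0 : 0 < c₂ := by positivity
  have hc₂4 : c₂ ≤ 1 / 4 := by
    rw [hc₂]
    apply one_div_le_one_div_of_le (by norm_num)
    have : 0 ≤ 4 * C₀ * 2 ^ (2 * k) := by positivity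
    linarith
  have hc₂C : 2 * c₂ * C₀ * 2 ^ (2 * k) ≤ 1 / 2 := by
    rw [hc₂]
    have : 0 ≤ 4 * C₀ * 2 ^ (2 * k) := by positivity
    rw [show 2 * (1 / (4 * C₀ * 2 ^ (2 * k) + 4)) * C₀ * 2 ^ (2 * k)
      = (2 * C₀ * 2 ^ (2 * k)) / (4 * C₀ * 2 ^ (2 * k) + 4) by ring, div_le_iff₀ (by positivity)]
    linarith
  set M : ℝ := 8 * (2 / c₂) ^ (2 * k) with hM
  refine ⟨2 * C₀ * M, by positivity, fun U f X g x₀ R H hR hU hf hg => ?_⟩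
  have hx₀R : x₀ ∈ Metric.closedBall x₀ R := Metric.mem_closedBall_self hR.le
  have hR3 : Metric.closedBall x₀ R ⊆ Metric.closedBall x₀ (3 * R) :=
    Metric.closedBall_subset_closedBall (by linarith)
  have hcont : ContinuousOn (fun x => (R - ‖x - x₀‖) ^ (2 * k) * f x) (Metric.closedBall x₀ R) :=
    (Continuous.continuousOn (by fun_prop)).mul (H.contf.mono (hR3.trans hU))
  obtain ⟨y, hy, hmax⟩ := (isCompact_closedBall x₀ R).exists_isMaxOn ⟨x₀, hx₀R⟩ hcont
  set d := R - ‖y - x₀‖ with hd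
  have hle : ∀ x ∈ Metric.closedBall x₀ R,
      (R - ‖x - x₀‖) ^ (2 * k) * f x ≤ d ^ (2 * k) * f y := fun x hx => hmax hx
  have hyR := mem_closedBall_iff_norm.1 hy
  have hfx₀ := hf x₀ (hR3 hx₀R)
  have hfy := hf y (hR3 hy)
  have hk0 : 2 * k ≠ 0 := by
    have : (0 : ℝ) < k := by linarith
    have : 0 < k := by exact_mod_cast this
    omega
  have hd0 : 0 < d := by
    have h1 := hle x₀ hx₀R
    simp only [sub_self, norm_zero, sub_zero] at h1
    have h2 : 0 < R ^ (2 * k) * f x₀ := by positivity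
    refine lt_of_le_of_ne (by linarith) fun h => ?_
    rw [← h, zero_pow hk0, zero_mul] at h1
    linarith
  have hdR : d ≤ R := by linarith [norm_nonneg (y - x₀)]
  have hball : ∀ x ∈ Metric.closedBall y (d / 2), d / 2 ≤ R - ‖x - x₀‖ := by
    intro x hx
    rw [mem_closedBall_iff_norm] at hx
    have h1 : ‖x - x₀‖ ≤ ‖x - y‖ + ‖y - x₀‖ := by simpa using norm_add_le (x - y) (y - x₀)
    linarith
  have hsub : Metric.closedBall y (d / 2) ⊆ Metric.closedBall x₀ R := fun x hx => by
    rw [mem_closedBall_iff_norm]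
    linarith [hball x hx]
  have hfle : ∀ x ∈ Metric.closedBall y (d / 2), f x ≤ 2 ^ (2 * k) * f y := by
    intro x hx
    have h1 := hle x (hsub hx)
    have h2 : (d / 2) ^ (2 * k) * f x ≤ d ^ (2 * k) * f y := by
      refine le_trans ?_ h1
      have := (hf x (hR3 (hsub hx))).le
      gcongr
      exact hball x hx
    rw [div_pow, div_mul_eq_mul_div, div_le_iff₀ (by positivity)] at h2
    have h3 : 0 < d ^ (2 * k) := by positivity
    nlinarith
  have habs : ∀ x ∈ Metric.closedBall x₀ (3 * R), |f x| = f x := fun x hx => abs_of_pos (hf x hx)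
  have hgrad := H.norm_gradient_le_of_abs_le (y := y) (r := d / 2) (A := A)
    (M := 2 ^ (2 * k) * f y) (by positivity) hA.le ((hsub.trans hR3).trans hU)
    (fun x hx => by rw [habs x (hR3 (hsub hx))]; exact hfle x hx)
    (fun x hx => by
      refine (hg x (hR3 (hsub hx))).trans ?_
      have h1 := hfle x hx
      have h2 : d / 2 ≤ R := by linarith
      gcongr)
  set r₂ := c₂ * d with hr₂
  have hr₂0 : 0 < r₂ := by positivity
  have hr₂4 : r₂ ≤ d / 2 / 2 := by nlinarith
  have hlow : ∀ x ∈ Metric.closedBall y r₂, f y / 2 ≤ f x := by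
    intro x hx
    have hs : Metric.closedBall y r₂ ⊆ Metric.closedBall y (d / 2 / 2) :=
      Metric.closedBall_subset_closedBall hr₂4
    have hs' : Metric.closedBall y r₂ ⊆ Metric.closedBall y (d / 2) :=
      Metric.closedBall_subset_closedBall (by linarith)
    have h1 := (convex_closedBall y r₂).norm_image_sub_le_of_norm_hasFDerivWithin_le
      (f := f) (f' := fun z => (InnerProductSpace.toDual ℝ E) (X z))
      (C := C₀ * (2 ^ (2 * k) * f y) / (d / 2))
      (fun z hz => (H.grad z (hU (hR3 (hsub (hs' hz))))).hasFDerivAt.hasFDerivWithinAt)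
      (fun z hz => by
        rw [LinearIsometryEquiv.norm_map]
        exact hgrad z (hs hz))
      (Metric.mem_closedBall_self hr₂0.le) hx
    rw [mem_closedBall_iff_norm] at hx
    have h2 : ‖f x - f y‖ ≤ f y / 2 := by
      refine h1.trans ?_
      calc C₀ * (2 ^ (2 * k) * f y) / (d / 2) * ‖x - y‖
          ≤ C₀ * (2 ^ (2 * k) * f y) / (d / 2) * r₂ := by gcongr
        _ = (2 * c₂ * C₀ * 2 ^ (2 * k)) * f y := by rw [hr₂]; field_simp
        _ ≤ 1 / 2 * f y := by gcongr
        _ = f y / 2 := by ring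
    rw [Real.norm_eq_abs] at h2
    linarith [(abs_le.1 h2).1]
  set K : ℝ := f y / 4 * r₂ ^ (2 * k) with hK
  have hK0 : 0 < K := by positivity
  have hyB : Metric.closedBall y (2 * R) ⊆ Metric.closedBall x₀ (3 * R) := fun x hx => by
    rw [mem_closedBall_iff_norm] at hx ⊢
    have h1 : ‖x - x₀‖ ≤ ‖x - y‖ + ‖y - x₀‖ := by simpa using norm_add_le (x - y) (y - x₀)
    linarith
  have hbar := H.barrier_le hR hr₂0 hA hkn hkA hK0 (hyB.trans hU) (fun x hx => hf x (hyB hx))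
    (fun x hx => hg x (hyB hx)) (fun x hx => by
      have h1 := hlow x (by rw [mem_closedBall_iff_norm, hx])
      have h2 : K * (r₂ ^ (2 * k))⁻¹ = f y / 4 := by rw [hK]; field_simp
      linarith)
  have hfinal : d ^ (2 * k) * f y ≤ 8 * (1 / c₂) ^ (2 * k) * R ^ (2 * k) * f x₀ := by
    have h1 : f y / 8 * (r₂ / R) ^ (2 * k) ≤ f x₀ := by
      rcases le_total r₂ ‖x₀ - y‖ with h | h
      · have hxy : ‖x₀ - y‖ ≤ R := by rw [norm_sub_rev]; exact hyR
        have h2 := hbar x₀ ⟨by rw [mem_closedBall_iff_norm]; linarith, h⟩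
        refine le_trans ?_ h2
        have h0 : 0 < ‖x₀ - y‖ := hr₂0.trans_le h
        have h3 : (R ^ (2 * k))⁻¹ ≤ ((‖x₀ - y‖ ^ 2) ^ k)⁻¹ := by
          rw [← pow_mul]; gcongr
        have h4 : ((2 * R) ^ (2 * k))⁻¹ ≤ 1 / 2 * (R ^ (2 * k))⁻¹ := by
          rw [mul_pow, mul_inv]
          gcongr
          rw [one_div]
          apply inv_anti₀ (by norm_num)
          exact le_self_pow₀ (by norm_num) hk0
        calc f y / 8 * (r₂ / R) ^ (2 * k) = K * (1 / 2 * (R ^ (2 * k))⁻¹) := by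
              rw [hK, div_pow]; field_simp; ring
          _ ≤ _ := by gcongr; linarith
      · have h2 := hlow x₀ (by rw [mem_closedBall_iff_norm]; exact h)
        refine le_trans ?_ h2
        have h3 : (r₂ / R) ^ (2 * k) ≤ 1 := by
          apply pow_le_one₀ (by positivity)
          rw [div_le_one hR]
          linarith
        nlinarith
    calc d ^ (2 * k) * f y
        = 8 * (1 / c₂) ^ (2 * k) * R ^ (2 * k) * (f y / 8 * (r₂ / R) ^ (2 * k)) := by
          have h2 : d = 1 / c₂ * R * (r₂ / R) := by
            rw [hr₂, one_div_mul_eq_div, div_mul_div_comm, eq_div_iff (by positivity)]; ring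
          conv_lhs => rw [h2, mul_pow, mul_pow]
          ring
      _ ≤ _ := by gcongr
  have hsup : ∀ x ∈ Metric.closedBall x₀ (R / 2), f x ≤ M * f x₀ := by
    intro x hx
    have hx' := Metric.closedBall_subset_closedBall (by linarith : R / 2 ≤ R) hx
    have h1 := (hle x hx').trans hfinal
    rw [mem_closedBall_iff_norm] at hx
    have h2 : (R / 2) ^ (2 * k) * f x ≤ (R - ‖x - x₀‖) ^ (2 * k) * f x := by
      have := (hf x (hR3 hx')).le
      gcongr
      linarith
    have h3 := h2.trans h1
    have h4 : 8 * (1 / c₂) ^ (2 * k) * R ^ (2 * k) * f x₀ = (R / 2) ^ (2 * k) * (M * f x₀) := by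
      have h5 : (1 / c₂) ^ (2 * k) * R ^ (2 * k) = (R / 2) ^ (2 * k) * (2 / c₂) ^ (2 * k) := by
        rw [← mul_pow, ← mul_pow]
        congr 1
        ring
      rw [hM]
      linear_combination (8 * f x₀) * h5
    rw [h4] at h3
    exact le_of_mul_le_mul_left h3 (by positivity)
  have hR23 : Metric.closedBall x₀ (R / 2) ⊆ Metric.closedBall x₀ (3 * R) :=
    Metric.closedBall_subset_closedBall (by linarith)
  have hlast := H.norm_gradient_le_of_abs_le (y := x₀) (r := R / 2) (A := A) (M := M * f x₀)
    (by positivity) hA.le (hR23.trans hU) (fun x hx => by rw [habs x (hR23 hx)]; exact hsup x hx)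
    (fun x hx => by
      refine (hg x (hR23 hx)).trans ?_
      have h1 := hsup x hx
      have h2 : R / 2 ≤ R := by linarith
      gcongr) x₀ (Metric.mem_closedBall_self (by positivity))
  rw [le_div_iff₀ (by positivity)] at hlast
  linarith

end Harnack

section Sphere

variable {E : Type*} [NormedAddCommGroup E] [InnerProductSpace ℝ E] [FiniteDimensional ℝ E]

/-- Oscillation bound along a segment joining two points of a sphere that form an acute angle. -/
lemma abs_sub_le_of_inner_nonneg {f : E → ℝ} {X : E → E} {r C : ℝ} (hr : 0 < r)
    (hf : ∀ z, r / 2 ≤ ‖z‖ → ‖z‖ ≤ r → HasGradientAt f (X z) z)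
    (hX : ∀ z, r / 2 ≤ ‖z‖ → ‖z‖ ≤ r → ‖z‖ * ‖X z‖ ≤ C) {x y : E} (hx : ‖x‖ = r) (hy : ‖y‖ = r)
    (hxy : 0 ≤ ⟪x, y⟫) : |f x - f y| ≤ 4 * C := by
  have hseg : ∀ z ∈ segment ℝ y x, r / 2 ≤ ‖z‖ ∧ ‖z‖ ≤ r := by
    rintro z ⟨a, c, ha, hc, hac, rfl⟩
    constructor
    · have h1 : ‖a • y + c • x‖ ^ 2 = a ^ 2 * r ^ 2 + 2 * (a * c * ⟪x, y⟫) + c ^ 2 * r ^ 2 := by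
        rw [norm_add_sq_real, norm_smul, norm_smul, inner_smul_left, inner_smul_right, hx, hy,
          real_inner_comm, mul_pow, mul_pow, Real.norm_eq_abs, Real.norm_eq_abs, sq_abs, sq_abs]
        simp only [conj_trivial]
        ring
      have h2 : 0 ≤ a * c * ⟪x, y⟫ := by positivity
      have h3 : 1 / 2 ≤ a ^ 2 + c ^ 2 := by nlinarith [sq_nonneg (a - c)]
      have h4 : r ^ 2 * (1 / 2) ≤ r ^ 2 * (a ^ 2 + c ^ 2) := by gcongr
      refine le_of_sq_le_sq ?_ (norm_nonneg _)
      nlinarith [sq_nonneg r]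
    · calc ‖a • y + c • x‖ ≤ ‖a • y‖ + ‖c • x‖ := norm_add_le _ _
        _ = a * r + c * r := by
          rw [norm_smul, norm_smul, hx, hy, Real.norm_of_nonneg ha, Real.norm_of_nonneg hc]
        _ = r := by rw [← add_mul, hac, one_mul]
  have h1 := (convex_segment y x).norm_image_sub_le_of_norm_hasFDerivWithin_le
    (f := f) (f' := fun z => (InnerProductSpace.toDual ℝ E) (X z)) (C := 2 * C / r)
    (fun z hz => (hf z (hseg z hz).1 (hseg z hz).2).hasFDerivAt.hasFDerivWithinAt)
    (fun z hz => by
      rw [LinearIsometryEquiv.norm_map, le_div_iff₀ hr]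
      have h2 := hX z (hseg z hz).1 (hseg z hz).2
      nlinarith [(hseg z hz).1, norm_nonneg (X z)])
    (left_mem_segment ℝ y x) (right_mem_segment ℝ y x)
  have h2 : ‖x - y‖ ≤ 2 * r := by
    calc ‖x - y‖ ≤ ‖x‖ + ‖y‖ := norm_sub_le _ _
      _ = 2 * r := by rw [hx, hy]; ring
  have hC : 0 ≤ C := (by positivity : 0 ≤ ‖x‖ * ‖X x‖).trans
    (hX x (by rw [hx]; linarith) hx.le)
  rw [← Real.norm_eq_abs]
  calc ‖f x - f y‖ ≤ 2 * C / r * ‖x - y‖ := h1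
    _ ≤ 2 * C / r * (2 * r) := by gcongr
    _ = 4 * C := by field_simp; ring

lemma exists_norm_eq_orthogonal (hdim : 2 ≤ Module.finrank ℝ E) (x : E) {r : ℝ} (hr : 0 < r) :
    ∃ y : E, ‖y‖ = r ∧ ⟪x, y⟫ = 0 := by
  have h1 := (ℝ ∙ x).finrank_add_finrank_orthogonal
  have h2 : Module.finrank ℝ (ℝ ∙ x) ≤ 1 := by
    simpa using finrank_span_le_card (R := ℝ) ({x} : Set E)
  have h3 : (ℝ ∙ x)ᗮ ≠ ⊥ := by
    intro h
    rw [h, finrank_bot] at h1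
    omega
  obtain ⟨v, hv, hv0⟩ := Submodule.exists_mem_ne_zero_of_ne_bot h3
  have hvn : 0 < ‖v‖ := norm_pos_iff.2 hv0
  refine ⟨(r / ‖v‖) • v, ?_, ?_⟩
  · rw [norm_smul, Real.norm_of_nonneg (by positivity)]
    field_simp
  · rw [inner_smul_right, Submodule.mem_orthogonal_singleton_iff_inner_right.1 hv, mul_zero]

/-- Oscillation bound on a sphere under a scale invariant gradient bound. -/
lemma abs_sub_le_of_norm_gradient_le (hdim : 2 ≤ Module.finrank ℝ E) {f : E → ℝ} {X : E → E}
    {r C : ℝ} (hr : 0 < r)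
    (hf : ∀ z, r / 2 ≤ ‖z‖ → ‖z‖ ≤ r → HasGradientAt f (X z) z)
    (hX : ∀ z, r / 2 ≤ ‖z‖ → ‖z‖ ≤ r → ‖z‖ * ‖X z‖ ≤ C) {x y : E} (hx : ‖x‖ = r) (hy : ‖y‖ = r) :
    |f x - f y| ≤ 8 * C := by
  obtain ⟨v, hv, hxv⟩ := exists_norm_eq_orthogonal hdim x hr
  have key : ∀ v', ‖v'‖ = r → ⟪x, v'⟫ = 0 → 0 ≤ ⟪v', y⟫ → |f x - f y| ≤ 8 * C := by
    intro v' hv' h1 h2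
    have h3 := abs_sub_le_of_inner_nonneg hr hf hX hx hv' h1.ge
    have h4 := abs_sub_le_of_inner_nonneg hr hf hX hv' hy h2
    calc |f x - f y| ≤ |f x - f v'| + |f v' - f y| := abs_sub_le _ _ _
      _ ≤ 8 * C := by linarith
  rcases le_total 0 ⟪v, y⟫ with h | h
  · exact key v hv hxv h
  · exact key (-v) (by rw [norm_neg, hv]) (by rw [inner_neg_right, hxv, neg_zero])
      (by rw [inner_neg_left]; linarith)

end Sphere

section LogEquation

/-- The function `F(p) = 2ρp - p² - λ|p|^{1-τ}`, which is `-f_ρ(-p)`. -/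
def slopeFun (ρ lam τ p : ℝ) : ℝ := 2 * ρ * p - p ^ 2 - lam * |p| ^ (1 - τ)

/-- The right-hand side of the equation satisfied by the logarithm of a positive solution. -/
def logRhs {E : Type*} [NormedAddCommGroup E] [InnerProductSpace ℝ E] (n ρ lam τ b κ : ℝ)
    (w : E → ℝ) (X : E → E) (x : E) : ℝ :=
  ((n - 2 + 2 * ρ) * ⟪x, X x⟫ - lam * (‖x‖ * ‖X x‖) ^ (1 - τ) - (‖x‖ * ‖X x‖) ^ 2
    + Real.exp (κ * (w x - b * Real.log ‖x‖))) / ‖x‖ ^ 2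

variable {N : ℕ} {ρ lam τ θ q : ℝ} {Ω : Set (EuclideanSpace ℝ (Fin N))}
  {u : EuclideanSpace ℝ (Fin N) → ℝ}

/-- A positive solution of (E) has a continuous weak Laplacian given by the equation. -/
lemma IsSolutionE.hasWeakLaplacian (hΩ : IsOpen Ω) (hτ1 : τ < 1)
    (hu : IsSolutionE N ρ lam τ θ q Ω u) :
    HasWeakLaplacian (Ω \ {0}) u (gradient u) (fun x =>
      ((N : ℝ) - 2 + 2 * ρ) * (⟪x, gradient u x⟫ / ‖x‖ ^ 2) - lam * Gt τ x (u x) (gradient u x)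
        + ‖x‖ ^ θ * u x ^ q) := by
  obtain ⟨⟨hC, hpos⟩, hw⟩ := hu
  have hU : IsOpen (Ω \ {0}) := hΩ.sdiff isClosed_singleton
  have hne : ∀ x ∈ Ω \ {0}, ‖x‖ ≠ 0 := fun x hx => norm_ne_zero_iff.2 hx.2
  have hX : ContinuousOn (gradient u) (Ω \ {0}) :=
    (InnerProductSpace.toDual ℝ _).symm.continuous.comp_continuousOn
      (hC.continuousOn_fderiv_of_isOpen hU le_rfl)
  have hn : ContinuousOn (fun x : EuclideanSpace ℝ (Fin N) => ‖x‖) (Ω \ {0}) :=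
    continuous_norm.continuousOn
  have h1 : ContinuousOn (fun x => ⟪x, gradient u x⟫ / ‖x‖ ^ 2) (Ω \ {0}) :=
    (continuousOn_id.inner hX).div (hn.pow 2) fun x hx => pow_ne_zero 2 (hne x hx)
  have h2 : ContinuousOn (fun x => Gt τ x (u x) (gradient u x)) (Ω \ {0}) := by
    unfold Gt
    refine ((hC.continuousOn.rpow_const fun x hx => Or.inl (hpos x hx).ne').mul
      (hX.norm.rpow_const fun x _ => Or.inr (by linarith))).div
      (hn.rpow_const fun x hx => Or.inl (hne x hx)) fun x hx => ?_
    have := (norm_nonneg x).lt_of_ne' (hne x hx)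
    positivity
  have h3 : ContinuousOn (fun x => ‖x‖ ^ θ * u x ^ q) (Ω \ {0}) :=
    (hn.rpow_const fun x hx => Or.inl (hne x hx)).mul
      (hC.continuousOn.rpow_const fun x hx => Or.inl (hpos x hx).ne')
  refine ⟨hU, fun x hx => ((hC.differentiableOn (by simp)).differentiableAt
    (hU.mem_nhds hx)).hasGradientAt, hX,
    ((continuousOn_const.mul h1).sub (continuousOn_const.mul h2)).add h3,
    fun φ hφ hφc hφs => ?_⟩
  have hset : ∀ F : EuclideanSpace ℝ (Fin N) → ℝ, (∀ x ∉ tsupport φ, F x = 0) →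
      ∫ x in Ω \ {0}, F x = ∫ x, F x := fun F hF =>
    setIntegral_eq_integral_of_forall_compl_eq_zero fun x hx => hF x fun h => hx (hφs h)
  have h0 : ∀ x ∉ tsupport φ, φ x = 0 := fun x hx => image_eq_zero_of_notMem_tsupport hx
  have hE := hw φ ⟨hφ, hφc, hφs⟩
  unfold weakE at hE
  rw [hset _ fun x hx => by rw [gradient_eq_zero_of_notMem_tsupport hx, inner_zero_right],
    hset _ fun x hx => by rw [h0 x hx, mul_zero], hset _ fun x hx => by rw [h0 x hx, mul_zero],
    hset _ fun x hx => by rw [h0 x hx, mul_zero]] at hE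
  have i1 := HasWeakLaplacian.integrable_mul hU h1 hφ.continuous.continuousOn hφc hφs
  have i2 := HasWeakLaplacian.integrable_mul hU h2 hφ.continuous.continuousOn hφc hφs
  have i3 := HasWeakLaplacian.integrable_mul hU h3 hφ.continuous.continuousOn hφc hφs
  have hsum : ∫ x, (((N : ℝ) - 2 + 2 * ρ) * (⟪x, gradient u x⟫ / ‖x‖ ^ 2)
      - lam * Gt τ x (u x) (gradient u x) + ‖x‖ ^ θ * u x ^ q) * φ x
      = ((N : ℝ) - 2 + 2 * ρ) * (∫ x, ⟪x, gradient u x⟫ / ‖x‖ ^ 2 * φ x)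
        - lam * (∫ x, Gt τ x (u x) (gradient u x) * φ x) + ∫ x, ‖x‖ ^ θ * u x ^ q * φ x := by
    rw [← integral_const_mul, ← integral_const_mul,
      ← integral_sub (i1.const_mul _) (i2.const_mul _),
      ← integral_add (Integrable.sub' (i1.const_mul _) (i2.const_mul _)) i3]
    congr 1 with x
    ring
  linarith

/-- The equation satisfied by the logarithm of a positive solution. -/
lemma IsSolutionE.log (hΩ : IsOpen Ω) (hτ1 : τ < 1) (hq : 1 < q)
    (hu : IsSolutionE N ρ lam τ θ q Ω u) :
    HasWeakLaplacian (Ω \ {0}) (fun x => Real.log (u x)) (fun x => (u x)⁻¹ • gradient u x)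
      (logRhs N ρ lam τ (-((θ + 2) / (q - 1))) (q - 1) (fun x => Real.log (u x))
        (fun x => (u x)⁻¹ • gradient u x)) := by
  have hpos := hu.1.2
  refine ((hu.hasWeakLaplacian hΩ hτ1).log hpos).congr (fun x _ => rfl) fun x hx => ?_
  have hux := hpos x hx
  have hx0 : 0 < ‖x‖ := norm_pos_iff.2 hx.2
  have hq' : q - 1 ≠ 0 := by linarith
  have h1 : Real.exp ((q - 1) * (Real.log (u x) - -((θ + 2) / (q - 1)) * Real.log ‖x‖))
      = ‖x‖ ^ θ * u x ^ q * ‖x‖ ^ 2 / u x := by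
    rw [eq_div_iff hux.ne']
    have e1 : ‖x‖ ^ (2 : ℕ) = Real.exp (2 * Real.log ‖x‖) := by
      rw [mul_comm, ← Real.rpow_def_of_pos hx0]; norm_num
    conv_lhs => rw [← Real.exp_log hux, Real.log_exp]
    rw [Real.rpow_def_of_pos hx0, Real.rpow_def_of_pos hux, e1, ← Real.exp_add, ← Real.exp_add,
      ← Real.exp_add]
    congr 1
    field_simp
    ring
  have h2 : (‖x‖ * ‖(u x)⁻¹ • gradient u x‖) ^ (1 - τ)
      = Gt τ x (u x) (gradient u x) * ‖x‖ ^ 2 / u x := by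
    unfold Gt
    rw [norm_smul, norm_inv, Real.norm_of_nonneg hux.le, ← mul_assoc,
      Real.mul_rpow (by positivity) (norm_nonneg _), Real.mul_rpow hx0.le (by positivity),
      Real.inv_rpow hux.le, Real.rpow_sub hux, Real.rpow_one]
    have e1 : ‖x‖ ^ (1 - τ) = ‖x‖ ^ 2 / ‖x‖ ^ (τ + 1) := by
      rw [← Real.rpow_natCast, ← Real.rpow_sub hx0]
      congr 1
      push_cast
      ring
    rw [e1]
    have := Real.rpow_pos_of_pos hx0 (τ + 1)
    have := Real.rpow_pos_of_pos hux τ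
    field_simp
  unfold logRhs
  rw [h1, h2, inner_smul_right]
  field_simp
  ring

end LogEquation

/-- `z` is twice continuously differentiable on the open set `O`, with derivatives `z₁`, `z₂`. -/
structure HasTwoDerivs (O : Set ℝ) (z z₁ z₂ : ℝ → ℝ) : Prop where
  isOpen : IsOpen O
  first : ∀ s ∈ O, HasDerivAt z (z₁ s) s
  second : ∀ s ∈ O, HasDerivAt z₁ (z₂ s) s
  cont : ContinuousOn z₂ O

/-- `M` and `m` satisfy one-dimensional comparison principles with respect to
`z'' = F(z') + exp (κ (z - b s))` on `(-∞, s₀)`. -/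
structure IsEnvelope (F : ℝ → ℝ) (b κ s₀ : ℝ) (m M : ℝ → ℝ) : Prop where
  le : ∀ s < s₀, m s ≤ M s
  upper : ∀ (O : Set ℝ) (z z₁ z₂ : ℝ → ℝ) (a c k : ℝ), HasTwoDerivs O z z₁ z₂ →
    Set.Icc a c ⊆ O → c < s₀ → M a - z a ≤ k → M c - z c ≤ k →
    (∀ s ∈ Set.Ioo a c, k < M s - z s → z₂ s < F (z₁ s) + Real.exp (κ * (M s - b * s))) →
    ∀ s ∈ Set.Icc a c, M s - z s ≤ k
  lower : ∀ (O : Set ℝ) (z z₁ z₂ : ℝ → ℝ) (a c k : ℝ), HasTwoDerivs O z z₁ z₂ →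
    Set.Icc a c ⊆ O → c < s₀ → k ≤ m a - z a → k ≤ m c - z c →
    (∀ s ∈ Set.Ioo a c, m s - z s < k → F (z₁ s) + Real.exp (κ * (m s - b * s)) < z₂ s) →
    ∀ s ∈ Set.Icc a c, k ≤ m s - z s

section SphereExtrema

variable {E : Type*} [NormedAddCommGroup E]

/-- The maximum of `w` on the sphere of radius `exp s`. -/
def sphereMax (w : E → ℝ) (s : ℝ) : ℝ := sSup (w '' Metric.sphere 0 (Real.exp s))

/-- The minimum of `w` on the sphere of radius `exp s`. -/
def sphereMin (w : E → ℝ) (s : ℝ) : ℝ := sInf (w '' Metric.sphere 0 (Real.exp s))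

variable (E) in
/-- The punctured open ball of radius `exp s₀`. -/
def logBall (s₀ : ℝ) : Set E := {x | 0 < ‖x‖ ∧ ‖x‖ < Real.exp s₀}

lemma isOpen_logBall (s₀ : ℝ) : IsOpen (logBall E s₀) :=
  (isOpen_lt continuous_const continuous_norm).inter (isOpen_lt continuous_norm continuous_const)

lemma sphere_subset_logBall {s s₀ : ℝ} (hs : s < s₀) :
    Metric.sphere (0 : E) (Real.exp s) ⊆ logBall E s₀ := fun x hx => by
  rw [mem_sphere_zero_iff_norm] at hx
  exact ⟨show 0 < ‖x‖ by rw [hx]; positivity, show ‖x‖ < _ by rw [hx]; exact Real.exp_lt_exp.2 hs⟩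

lemma norm_eq_exp_log {x : E} (hx : 0 < ‖x‖) : ‖x‖ = Real.exp (Real.log ‖x‖) :=
  (Real.exp_log hx).symm

lemma log_norm_lt {x : E} {s₀ : ℝ} (hx : x ∈ logBall E s₀) : Real.log ‖x‖ < s₀ :=
  (Real.log_lt_iff_lt_exp hx.1).2 hx.2

variable [InnerProductSpace ℝ E] [FiniteDimensional ℝ E]

lemma isGreatest_sphereMax (hdim : 2 ≤ Module.finrank ℝ E) {w : E → ℝ} {s s₀ : ℝ} (hs : s < s₀)
    (hw : ContinuousOn w (logBall E s₀)) :
    IsGreatest (w '' Metric.sphere 0 (Real.exp s)) (sphereMax w s) := by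
  obtain ⟨y, hy, -⟩ := exists_norm_eq_orthogonal hdim (0 : E) (Real.exp_pos s)
  exact ((isCompact_sphere _ _).image_of_continuousOn
    (hw.mono (sphere_subset_logBall hs))).isGreatest_sSup ⟨w y, y, by simpa using hy, rfl⟩

lemma isLeast_sphereMin (hdim : 2 ≤ Module.finrank ℝ E) {w : E → ℝ} {s s₀ : ℝ} (hs : s < s₀)
    (hw : ContinuousOn w (logBall E s₀)) :
    IsLeast (w '' Metric.sphere 0 (Real.exp s)) (sphereMin w s) := by
  obtain ⟨y, hy, -⟩ := exists_norm_eq_orthogonal hdim (0 : E) (Real.exp_pos s)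
  exact ((isCompact_sphere _ _).image_of_continuousOn
    (hw.mono (sphere_subset_logBall hs))).isLeast_sInf ⟨w y, y, by simpa using hy, rfl⟩

lemma le_sphereMax (hdim : 2 ≤ Module.finrank ℝ E) {w : E → ℝ} {s₀ : ℝ}
    (hw : ContinuousOn w (logBall E s₀)) {x : E} (hx : x ∈ logBall E s₀) :
    w x ≤ sphereMax w (Real.log ‖x‖) :=
  (isGreatest_sphereMax hdim (log_norm_lt hx) hw).2
    ⟨x, mem_sphere_zero_iff_norm.2 (norm_eq_exp_log hx.1), rfl⟩

lemma sphereMin_le (hdim : 2 ≤ Module.finrank ℝ E) {w : E → ℝ} {s₀ : ℝ}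
    (hw : ContinuousOn w (logBall E s₀)) {x : E} (hx : x ∈ logBall E s₀) :
    sphereMin w (Real.log ‖x‖) ≤ w x :=
  (isLeast_sphereMin hdim (log_norm_lt hx) hw).2
    ⟨x, mem_sphere_zero_iff_norm.2 (norm_eq_exp_log hx.1), rfl⟩

variable [MeasurableSpace E] [BorelSpace E]

/-- The Laplacian of a radial function in logarithmic coordinates. -/
lemma HasTwoDerivs.hasWeakLaplacian {O : Set ℝ} {z z₁ z₂ : ℝ → ℝ} (hz : HasTwoDerivs O z z₁ z₂) :
    HasWeakLaplacian {x : E | 0 < ‖x‖ ∧ Real.log ‖x‖ ∈ O} (fun x => z (Real.log ‖x‖))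
      (fun x => (z₁ (Real.log ‖x‖) / ‖x‖ ^ 2) • x)
      (fun x => (z₂ (Real.log ‖x‖) + ((Module.finrank ℝ E : ℝ) - 2) * z₁ (Real.log ‖x‖))
        / ‖x‖ ^ 2) := by
  set U : Set E := {x : E | 0 < ‖x‖ ∧ Real.log ‖x‖ ∈ O} with hUdef
  have hlog : ContinuousOn (fun x : E => Real.log ‖x‖) {x : E | 0 < ‖x‖} :=
    continuous_norm.continuousOn.log fun x hx => (show 0 < ‖x‖ from hx).ne'
  have hU : IsOpen U :=
    hlog.isOpen_inter_preimage (isOpen_lt continuous_const continuous_norm) hz.isOpen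
  have hU0 : ∀ x ∈ U, 0 < ‖x‖ := fun x hx => hx.1
  have hhalf : ∀ x : E, 1 / 2 * Real.log (‖x - 0‖ ^ 2) = Real.log ‖x‖ := fun x => by
    rw [sub_zero, Real.log_pow]; push_cast; ring
  have hd : ∀ t : ℝ, 0 < t → HasDerivAt (fun t => 1 / 2 * Real.log t) (1 / (2 * t)) t := by
    intro t ht
    refine ((Real.hasDerivAt_log ht.ne').const_mul (1 / 2)).congr_deriv ?_
    field_simp
  have key := HasWeakLaplacian.radial (E := E) hU 0 (η := fun t => z (1 / 2 * Real.log t))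
    (η₁ := fun t => z₁ (1 / 2 * Real.log t) / (2 * t))
    (η₂ := fun t => z₂ (1 / 2 * Real.log t) / (4 * t ^ 2) - z₁ (1 / 2 * Real.log t) / (2 * t ^ 2))
    (fun x hx => by
      have h0 : 0 < ‖x - 0‖ ^ 2 := by rw [sub_zero]; have := hU0 x hx; positivity
      have h1 := hz.first (1 / 2 * Real.log (‖x - 0‖ ^ 2)) (by rw [hhalf]; exact hx.2)
      refine (h1.comp (‖x - 0‖ ^ 2) (hd _ h0)).congr_deriv ?_
      ring)
    (fun x hx => by
      have h0 : 0 < ‖x - 0‖ ^ 2 := by rw [sub_zero]; have := hU0 x hx; positivity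
      have h1 := hz.second (1 / 2 * Real.log (‖x - 0‖ ^ 2)) (by rw [hhalf]; exact hx.2)
      generalize ‖x - 0‖ ^ 2 = t at h0 h1 ⊢
      refine ((h1.comp t (hd t h0)).div ((hasDerivAt_id t).const_mul 2)
        (by positivity)).congr_deriv ?_
      simp only [Function.comp, id]
      field_simp
      ring)
    (by
      have hl : ContinuousOn (fun x : E => Real.log ‖x‖) U := hlog.mono fun x hx => hx.1
      have h1 : ContinuousOn (fun x : E => z₂ (Real.log ‖x‖)) U :=
        hz.cont.comp hl fun x hx => hx.2
      have h2 : ContinuousOn (fun x : E => z₁ (Real.log ‖x‖)) U :=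
        ContinuousOn.comp (g := z₁) (t := O)
          (fun s hs => (hz.second s hs).continuousAt.continuousWithinAt) hl fun x hx => hx.2
      have hn : ContinuousOn (fun x : E => ‖x‖) U := continuous_norm.continuousOn
      simp only [hhalf]
      simp only [sub_zero]
      exact (h1.div ((continuousOn_const (c := (4 : ℝ))).mul ((hn.pow 2).pow 2)) fun x hx => by
          exact (by have := hU0 x hx; positivity : 4 * (‖x‖ ^ 2) ^ 2 ≠ 0)).sub
        (h2.div ((continuousOn_const (c := (2 : ℝ))).mul ((hn.pow 2).pow 2)) fun x hx => by
          exact (by have := hU0 x hx; positivity : 2 * (‖x‖ ^ 2) ^ 2 ≠ 0)))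
  simp only [hhalf] at key
  refine key.congr (fun x hx => ?_) fun x hx => ?_
  · have := hU0 x hx
    rw [sub_zero]
    congr 1
    field_simp
  · have := hU0 x hx
    rw [sub_zero]
    field_simp
    ring

end SphereExtrema

section Envelope

/-- The value of the logarithmic operator at a point where the gradient is radial. -/
lemma logRhs_of_radial {E : Type*} [NormedAddCommGroup E] [InnerProductSpace ℝ E]
    {n ρ lam τ b κ : ℝ} {w : E → ℝ} {X : E → E} {x : E} {p : ℝ}
    (hx : 0 < ‖x‖) (hX : X x = (p / ‖x‖ ^ 2) • x) :
    logRhs n ρ lam τ b κ w X x = (slopeFun ρ lam τ p + (n - 2) * p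
      + Real.exp (κ * (w x - b * Real.log ‖x‖))) / ‖x‖ ^ 2 := by
  have h1 : ⟪x, X x⟫ = p := by
    rw [hX, inner_smul_right, real_inner_self_eq_norm_sq]; field_simp
  have h2 : ‖x‖ * ‖X x‖ = |p| := by
    rw [hX, norm_smul, norm_div, norm_pow, norm_norm, Real.norm_eq_abs]; field_simp
  unfold logRhs slopeFun
  rw [h1, h2, sq_abs]
  ring

variable {E : Type*} [NormedAddCommGroup E] [InnerProductSpace ℝ E] [FiniteDimensional ℝ E]
  [MeasurableSpace E] [BorelSpace E]

/-- The spherical maximum and minimum of a solution of the logarithmic equation satisfy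
one-dimensional comparison principles. -/
theorem HasWeakLaplacian.isEnvelope (hdim : 2 ≤ Module.finrank ℝ E) {ρ lam τ b κ s₀ : ℝ}
    {w : E → ℝ} {X : E → E} (H : HasWeakLaplacian (logBall E s₀) w X
      (logRhs (Module.finrank ℝ E) ρ lam τ b κ w X)) :
    IsEnvelope (slopeFun ρ lam τ) b κ s₀ (sphereMin w) (sphereMax w) := by
  have hG := fun s (hs : s < s₀) => isGreatest_sphereMax hdim hs H.contf
  have hL := fun s (hs : s < s₀) => isLeast_sphereMin hdim hs H.contf
  have hann : ∀ a c : ℝ, IsCompact {x : E | Real.exp a ≤ ‖x‖ ∧ ‖x‖ ≤ Real.exp c} := fun a c =>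
    (isCompact_closedBall (0 : E) (Real.exp c)).of_isClosed_subset
      ((isClosed_le continuous_const continuous_norm).inter
        (isClosed_le continuous_norm continuous_const))
      fun x hx => mem_closedBall_zero_iff.2 hx.2
  have hopen : ∀ a c : ℝ, IsOpen {x : E | Real.exp a < ‖x‖ ∧ ‖x‖ < Real.exp c} := fun a c =>
    (isOpen_lt continuous_const continuous_norm).inter (isOpen_lt continuous_norm continuous_const)
  have hmem : ∀ {a c : ℝ} {x : E}, Real.exp a ≤ ‖x‖ → ‖x‖ ≤ Real.exp c →
      0 < ‖x‖ ∧ Real.log ‖x‖ ∈ Set.Icc a c := fun {a c x} h1 h2 => by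
    have h0 : 0 < ‖x‖ := (Real.exp_pos a).trans_le h1
    exact ⟨h0, (Real.le_log_iff_exp_le h0).2 h1, (Real.log_le_iff_le_exp h0).2 h2⟩
  have hends : ∀ {a c : ℝ} {x : E}, x ∈ {x : E | Real.exp a ≤ ‖x‖ ∧ ‖x‖ ≤ Real.exp c} →
      x ∉ {x : E | Real.exp a < ‖x‖ ∧ ‖x‖ < Real.exp c} →
      Real.log ‖x‖ = a ∨ Real.log ‖x‖ = c := fun {a c x} hx hx' => by
    rcases eq_or_lt_of_le hx.1 with h | h
    · left; rw [← h, Real.log_exp]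
    · right
      rcases eq_or_lt_of_le hx.2 with h' | h'
      · rw [h', Real.log_exp]
      · exact absurd ⟨h, h'⟩ hx'
  refine ⟨fun s hs => ?_, ?_, ?_⟩
  · obtain ⟨x, hx, hxw⟩ := (hG s hs).1
    exact ((hL s hs).2 ⟨x, hx, rfl⟩).trans ((hG s hs).2 ⟨x, hx, rfl⟩)
  · intro O z z₁ z₂ a c k hz hO hc hka hkc hcmp s hs
    have hD := H.mono ((isOpen_logBall s₀).inter (hz.hasWeakLaplacian (E := E)).isOpen)
      Set.inter_subset_left
    have hZ := (hz.hasWeakLaplacian (E := E)).mono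
      ((isOpen_logBall s₀).inter (hz.hasWeakLaplacian (E := E)).isOpen) Set.inter_subset_right
    have hsub : {x : E | Real.exp a ≤ ‖x‖ ∧ ‖x‖ ≤ Real.exp c} ⊆
        logBall E s₀ ∩ {x : E | 0 < ‖x‖ ∧ Real.log ‖x‖ ∈ O} := fun x hx =>
      ⟨⟨(hmem hx.1 hx.2).1, lt_of_le_of_lt hx.2 (Real.exp_lt_exp.2 hc)⟩, (hmem hx.1 hx.2).1,
        hO (hmem hx.1 hx.2).2⟩
    have hle := fun x hx => le_sphereMax hdim H.contf (x := x) (hsub hx).1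
    have hmax := (hD.sub hZ).le_of_pos_at_max (c := k) (hann a c) hsub (hopen a c)
      (fun x hx => ⟨hx.1.le, hx.2.le⟩)
      (fun x hx hx' => by
        have h1 := hle x hx
        rcases hends hx hx' with h | h <;> rw [h] at h1 ⊢ <;> linarith)
      (fun x hx hkx hmaxx hX => by
        have hxD : x ∈ {x : E | Real.exp a ≤ ‖x‖ ∧ ‖x‖ ≤ Real.exp c} := ⟨hx.1.le, hx.2.le⟩
        have hx0 : 0 < ‖x‖ := (hmem hxD.1 hxD.2).1
        have hX' := sub_eq_zero.1 hX
        have hwM : w x = sphereMax w (Real.log ‖x‖) := by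
          refine le_antisymm (hle x hxD) ?_
          obtain ⟨y, hy, hyw⟩ := (hG _ (log_norm_lt (hsub hxD).1)).1
          rw [mem_sphere_zero_iff_norm, Real.exp_log hx0] at hy
          rw [← hyw]
          have := hmaxx y (by show _ ∧ _; rw [hy]; exact hxD)
          rw [hy] at this
          linarith
        have hs' : Real.log ‖x‖ ∈ Set.Ioo a c :=
          ⟨(Real.lt_log_iff_exp_lt hx0).2 hx.1, (Real.log_lt_iff_lt_exp hx0).2 hx.2⟩
        have h1 := hcmp _ hs' (by rw [← hwM]; exact hkx)
        rw [← hwM] at h1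
        rw [logRhs_of_radial hx0 hX', ← sub_div]
        apply div_pos _ (by positivity)
        linarith)
    obtain ⟨y, hy, hyw⟩ := (hG s (hs.2.trans_lt hc)).1
    rw [mem_sphere_zero_iff_norm] at hy
    have := hmax y (by
      show _ ∧ _
      rw [hy]
      exact ⟨Real.exp_le_exp.2 hs.1, Real.exp_le_exp.2 hs.2⟩)
    rwa [hy, Real.log_exp, hyw] at this
  · intro O z z₁ z₂ a c k hz hO hc hka hkc hcmp s hs
    have hD := H.mono ((isOpen_logBall s₀).inter (hz.hasWeakLaplacian (E := E)).isOpen)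
      Set.inter_subset_left
    have hZ := (hz.hasWeakLaplacian (E := E)).mono
      ((isOpen_logBall s₀).inter (hz.hasWeakLaplacian (E := E)).isOpen) Set.inter_subset_right
    have hsub : {x : E | Real.exp a ≤ ‖x‖ ∧ ‖x‖ ≤ Real.exp c} ⊆
        logBall E s₀ ∩ {x : E | 0 < ‖x‖ ∧ Real.log ‖x‖ ∈ O} := fun x hx =>
      ⟨⟨(hmem hx.1 hx.2).1, lt_of_le_of_lt hx.2 (Real.exp_lt_exp.2 hc)⟩, (hmem hx.1 hx.2).1,
        hO (hmem hx.1 hx.2).2⟩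
    have hle := fun x hx => sphereMin_le hdim H.contf (x := x) (hsub hx).1
    have hmax := (hZ.sub hD).le_of_pos_at_max (c := -k) (hann a c) hsub (hopen a c)
      (fun x hx => ⟨hx.1.le, hx.2.le⟩)
      (fun x hx hx' => by
        have h1 := hle x hx
        rcases hends hx hx' with h | h <;> rw [h] at h1 ⊢ <;> linarith)
      (fun x hx hkx hmaxx hX => by
        have hxD : x ∈ {x : E | Real.exp a ≤ ‖x‖ ∧ ‖x‖ ≤ Real.exp c} := ⟨hx.1.le, hx.2.le⟩
        have hx0 : 0 < ‖x‖ := (hmem hxD.1 hxD.2).1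
        have hX' := (sub_eq_zero.1 hX).symm
        have hwM : w x = sphereMin w (Real.log ‖x‖) := by
          refine le_antisymm ?_ (hle x hxD)
          obtain ⟨y, hy, hyw⟩ := (hL _ (log_norm_lt (hsub hxD).1)).1
          rw [mem_sphere_zero_iff_norm, Real.exp_log hx0] at hy
          rw [← hyw]
          have := hmaxx y (by show _ ∧ _; rw [hy]; exact hxD)
          rw [hy] at this
          linarith
        have hs' : Real.log ‖x‖ ∈ Set.Ioo a c :=
          ⟨(Real.lt_log_iff_exp_lt hx0).2 hx.1, (Real.log_lt_iff_lt_exp hx0).2 hx.2⟩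
        have h1 := hcmp _ hs' (by rw [← hwM]; linarith)
        rw [← hwM] at h1
        rw [logRhs_of_radial hx0 hX', ← sub_div]
        apply div_pos _ (by positivity)
        linarith)
    obtain ⟨y, hy, hyw⟩ := (hL s (hs.2.trans_lt hc)).1
    rw [mem_sphere_zero_iff_norm] at hy
    have := hmax y (by
      show _ ∧ _
      rw [hy]
      exact ⟨Real.exp_le_exp.2 hs.1, Real.exp_le_exp.2 hs.2⟩)
    rw [hy, Real.log_exp, hyw] at this
    linarith

end Envelope

lemma neg_mul_one_add_sq_le_slopeFun {ρ lam τ : ℝ} (hτ0 : 0 ≤ τ) (hτ1 : τ < 1) (p : ℝ) :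
    -(ρ ^ 2 + |lam| + 2) * (1 + p ^ 2) ≤ slopeFun ρ lam τ p := by
  have h1 : |p| ^ (1 - τ) ≤ 1 + p ^ 2 := by
    rcases le_total |p| 1 with h | h
    · have := Real.rpow_le_one (abs_nonneg p) h (by linarith : 0 ≤ 1 - τ)
      nlinarith [sq_nonneg p]
    · have := Real.rpow_le_rpow_of_exponent_le h (by linarith : 1 - τ ≤ 2)
      rw [Real.rpow_two, sq_abs] at this
      linarith
  have h2 : lam * |p| ^ (1 - τ) ≤ |lam| * (1 + p ^ 2) := by
    have := Real.rpow_nonneg (abs_nonneg p) (1 - τ)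
    calc lam * |p| ^ (1 - τ) ≤ |lam| * |p| ^ (1 - τ) := by gcongr; exact le_abs_self _
      _ ≤ _ := by gcongr
  unfold slopeFun
  nlinarith [sq_nonneg (ρ + p), sq_nonneg p, sq_nonneg (ρ * p), sq_nonneg ρ]

/-- Derivatives of the boundary blow-up profile. -/
lemma hasTwoDerivs_blowup (b k γ s₁ : ℝ) :
    HasTwoDerivs (Set.Ioo (s₁ - 1) (s₁ + 1))
      (fun t => b * t + k - γ * Real.log (1 - (t - s₁) ^ 2))
      (fun t => b + γ * (2 * (t - s₁) / (1 - (t - s₁) ^ 2)))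
      (fun t => γ * (2 / (1 - (t - s₁) ^ 2) + 4 * (t - s₁) ^ 2 / (1 - (t - s₁) ^ 2) ^ 2)) := by
  have hD : ∀ t ∈ Set.Ioo (s₁ - 1) (s₁ + 1), 0 < 1 - (t - s₁) ^ 2 := fun t ht => by
    nlinarith [ht.1, ht.2]
  have hd : ∀ t, HasDerivAt (fun t => 1 - (t - s₁) ^ 2) (-(2 * (t - s₁))) t := fun t => by
    refine ((((hasDerivAt_id t).sub_const s₁).pow 2).const_sub 1).congr_deriv ?_
    simp
  refine ⟨isOpen_Ioo, fun t ht => ?_, fun t ht => ?_, ?_⟩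
  · have h0 := hD t ht
    refine ((((hasDerivAt_id t).const_mul b).add_const k).sub
      (((hd t).log h0.ne').const_mul γ)).congr_deriv ?_
    field_simp
    ring
  · have h0 := hD t ht
    refine ((((((hasDerivAt_id t).sub_const s₁).const_mul 2).div (hd t) h0.ne').const_mul
      γ).const_add b).congr_deriv ?_
    simp only [id]
    field_simp
    ring
  · have hc : ContinuousOn (fun t => 1 - (t - s₁) ^ 2) (Set.Ioo (s₁ - 1) (s₁ + 1)) := by fun_prop
    refine continuousOn_const.mul ((continuousOn_const.div hc fun t ht => (hD t ht).ne').add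
      (ContinuousOn.div (by fun_prop) (hc.pow 2) fun t ht => pow_ne_zero 2 (hD t ht).ne'))

lemma blowup_estimate {b γ C D y : ℝ} (hD : 0 < D) (hD1 : D ≤ 1) (hy : y ^ 2 ≤ 1) (hγ : 0 ≤ γ)
    (hC : 0 ≤ C) : γ * (2 / D + 4 * y ^ 2 / D ^ 2) + C * (1 + (b + γ * (2 * y / D)) ^ 2)
      < (6 * γ + C * (1 + 2 * b ^ 2 + 8 * γ ^ 2) + 1) / D ^ 2 := by
  have hD2 : D ^ 2 ≤ 1 := by nlinarith
  have e0 : γ * (2 / D + 4 * y ^ 2 / D ^ 2) + C * (1 + (b + γ * (2 * y / D)) ^ 2)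
      = (γ * (2 * D + 4 * y ^ 2) + C * (D ^ 2 + (b * D + 2 * γ * y) ^ 2)) / D ^ 2 := by
    field_simp
  rw [e0]
  have e2 : (b * D) ^ 2 ≤ b ^ 2 := by
    rw [mul_pow]; exact mul_le_of_le_one_right (sq_nonneg b) hD2
  have e3 : (2 * γ * y) ^ 2 ≤ 4 * γ ^ 2 := by
    rw [mul_pow, mul_pow]; nlinarith [sq_nonneg γ]
  have e4 : D ^ 2 + (b * D + 2 * γ * y) ^ 2 ≤ 1 + 2 * b ^ 2 + 8 * γ ^ 2 := by
    nlinarith [sq_nonneg (b * D - 2 * γ * y)]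
  have e5 : γ * (2 * D + 4 * y ^ 2) ≤ γ * 6 := by gcongr; linarith
  have e6 := mul_le_mul_of_nonneg_left e4 hC
  refine div_lt_div_of_pos_right ?_ (by positivity)
  linarith

/-- Keller–Osserman estimate. -/
lemma IsEnvelope.exists_upper_bound {F : ℝ → ℝ} {b κ s₀ C : ℝ} {m M : ℝ → ℝ}
    (h : IsEnvelope F b κ s₀ m M) (hκ : 0 < κ) (hC : 0 ≤ C)
    (hF : ∀ p, -C * (1 + p ^ 2) ≤ F p)
    (hM : ∀ a c, c < s₀ → ∃ B, ∀ s ∈ Set.Icc a c, M s ≤ B) :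
    ∃ k, ∀ s ≤ s₀ - 2, M s ≤ b * s + k := by
  set γ : ℝ := 2 / κ with hγ
  have hγ0 : 0 < γ := by positivity
  set K : ℝ := 6 * γ + C * (1 + 2 * b ^ 2 + 8 * γ ^ 2) + 1 with hK
  have hK0 : 0 < K := by positivity
  set k : ℝ := Real.log K / κ with hk
  have hκk : Real.exp (κ * k) = K := by
    rw [hk, mul_div_cancel₀ _ hκ.ne', Real.exp_log hK0]
  refine ⟨k, fun s₁ hs₁ => ?_⟩
  obtain ⟨B, hB⟩ := hM (s₁ - 1) (s₁ + 1) (by linarith)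
  set T : ℝ := (|B| + |b| * (|s₁| + 1) + |k| + 1) / γ with hT
  have hT0 : 0 < T := by positivity
  have hγT : γ * T = |B| + |b| * (|s₁| + 1) + |k| + 1 := by rw [hT]; field_simp
  set y : ℝ := Real.sqrt (1 - Real.exp (-T)) with hy
  have he1 : Real.exp (-T) < 1 := by rw [Real.exp_lt_one_iff]; linarith
  have hy0 : 0 ≤ y := Real.sqrt_nonneg _
  have hysq : y ^ 2 = 1 - Real.exp (-T) := Real.sq_sqrt (by linarith)
  have hy1 : y < 1 := by nlinarith [Real.exp_pos (-T)]
  have hend : ∀ σ : ℝ, |σ| < 1 → σ ^ 2 = y ^ 2 →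
      M (s₁ + σ) - (b * (s₁ + σ) + k - γ * Real.log (1 - (s₁ + σ - s₁) ^ 2)) ≤ 0 := by
    intro σ hσ hσy
    have h1 := hB (s₁ + σ) ⟨by linarith [(abs_lt.1 hσ).1], by linarith [(abs_lt.1 hσ).2]⟩
    rw [add_sub_cancel_left, hσy, hysq, sub_sub_cancel, Real.log_exp]
    have h2 : |b * (s₁ + σ)| ≤ |b| * (|s₁| + 1) := by
      rw [abs_mul]
      gcongr
      exact (abs_add_le _ _).trans (by linarith)
    linarith [neg_abs_le (b * (s₁ + σ)), neg_abs_le k, le_abs_self B]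
  have key := h.upper _ _ _ _ (s₁ - y) (s₁ + y) 0 (hasTwoDerivs_blowup b k γ s₁)
    (fun t ht => ⟨by linarith [ht.1], by linarith [ht.2]⟩) (by linarith)
    (by
      have := hend (-y) (by rw [abs_neg, abs_of_nonneg hy0]; exact hy1) (by ring)
      simpa only [sub_eq_add_neg] using this)
    (hend y (by rw [abs_of_nonneg hy0]; exact hy1) rfl)
    (fun t ht hMt => by
      have hty : (t - s₁) ^ 2 ≤ y ^ 2 := by
        apply sq_le_sq'
        · linarith [ht.1]
        · linarith [ht.2]
      have hD : 0 < 1 - (t - s₁) ^ 2 := by nlinarith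
      have hD1 : 1 - (t - s₁) ^ 2 ≤ 1 := by nlinarith [sq_nonneg (t - s₁)]
      have hexp : K / (1 - (t - s₁) ^ 2) ^ 2 ≤ Real.exp (κ * (M t - b * t)) := by
        have e1 : Real.exp (κ * (k - γ * Real.log (1 - (t - s₁) ^ 2)))
            = K / (1 - (t - s₁) ^ 2) ^ 2 := by
          rw [mul_sub, Real.exp_sub, hκk, ← mul_assoc, hγ, mul_div_cancel₀ _ hκ.ne']
          congr 1
          rw [mul_comm, ← Real.rpow_def_of_pos hD, Real.rpow_two]
        rw [← e1, Real.exp_le_exp]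
        refine mul_le_mul_of_nonneg_left ?_ hκ.le
        linarith
      have hy2 : (t - s₁) ^ 2 ≤ 1 := by linarith
      have h1 := blowup_estimate (b := b) hD hD1 hy2 hγ0.le hC
      have h2 := hF (b + γ * (2 * (t - s₁) / (1 - (t - s₁) ^ 2)))
      linarith)
    s₁ ⟨by linarith, by linarith⟩
  simp only [sub_self, ne_eq, OfNat.ofNat_ne_zero, not_false_eq_true, zero_pow, sub_zero,
    Real.log_one, mul_zero] at key
  linarith

section GradientBound

lemma exists_sphereMax_le {E : Type*} [NormedAddCommGroup E] [InnerProductSpace ℝ E]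
    [FiniteDimensional ℝ E] (hdim : 2 ≤ Module.finrank ℝ E) {w : E → ℝ} {s₀ : ℝ}
    (hw : ContinuousOn w (logBall E s₀)) (a c : ℝ) (hc : c < s₀) :
    ∃ B, ∀ s ∈ Set.Icc a c, sphereMax w s ≤ B := by
  have hcomp : IsCompact {x : E | Real.exp a ≤ ‖x‖ ∧ ‖x‖ ≤ Real.exp c} :=
    (isCompact_closedBall (0 : E) (Real.exp c)).of_isClosed_subset
      ((isClosed_le continuous_const continuous_norm).inter
        (isClosed_le continuous_norm continuous_const))
      fun x hx => mem_closedBall_zero_iff.2 hx.2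
  obtain ⟨B, hB⟩ := hcomp.bddAbove_image (hw.mono fun x hx =>
    ⟨(Real.exp_pos a).trans_le hx.1, hx.2.trans_lt (Real.exp_lt_exp.2 hc)⟩)
  refine ⟨B, fun s hs => ?_⟩
  obtain ⟨x, hx, hxw⟩ := (isGreatest_sphereMax hdim (hs.2.trans_lt hc) hw).1
  rw [mem_sphere_zero_iff_norm] at hx
  rw [← hxw]
  refine hB ⟨x, ⟨?_, ?_⟩, rfl⟩
  · rw [hx]; exact Real.exp_le_exp.2 hs.1
  · rw [hx]; exact Real.exp_le_exp.2 hs.2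

lemma norm_bounds_of_mem_closedBall {E : Type*} [NormedAddCommGroup E] {x y : E}
    (hy : y ∈ Metric.closedBall x (3 * (‖x‖ / 6))) : ‖x‖ / 2 ≤ ‖y‖ ∧ ‖y‖ ≤ 3 / 2 * ‖x‖ := by
  rw [mem_closedBall_iff_norm] at hy
  have h1 := norm_sub_norm_le x y
  have h2 := norm_sub_norm_le y x
  rw [norm_sub_rev] at h1
  constructor <;> linarith

lemma closedBall_subset_logBall {E : Type*} [NormedAddCommGroup E] {x : E} {s₀ : ℝ}
    (hx : x ∈ logBall E (s₀ - 1)) : Metric.closedBall x (3 * (‖x‖ / 6)) ⊆ logBall E s₀ := by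
  intro y hy
  obtain ⟨h1, h2⟩ := norm_bounds_of_mem_closedBall hy
  have h3 : 0 < ‖x‖ := hx.1
  have h4 : ‖x‖ < Real.exp (s₀ - 1) := hx.2
  refine ⟨show 0 < ‖y‖ by linarith, show ‖y‖ < _ from ?_⟩
  have h5 : Real.exp s₀ = Real.exp (s₀ - 1) * Real.exp 1 := by rw [← Real.exp_add]; ring_nf
  have h6 : (2 : ℝ) ≤ Real.exp 1 := by linarith [Real.add_one_le_exp (1 : ℝ)]
  nlinarith [Real.exp_pos (s₀ - 1)]

variable {N : ℕ} {ρ lam τ θ q : ℝ} {Ω : Set (EuclideanSpace ℝ (Fin N))}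
  {u : EuclideanSpace ℝ (Fin N) → ℝ}

/-- Scale invariant bound for the logarithmic gradient of a solution. -/
lemma IsSolutionE.exists_norm_gradient_log_le (hΩ : IsOpen Ω) (hτ0 : 0 ≤ τ) (hτ1 : τ < 1)
    (hq : 1 < q) (hu : IsSolutionE N ρ lam τ θ q Ω u) {s₀ k : ℝ}
    (hball : logBall (EuclideanSpace ℝ (Fin N)) s₀ ⊆ Ω \ {0})
    (hk : ∀ x ∈ logBall (EuclideanSpace ℝ (Fin N)) s₀,
      Real.log (u x) ≤ -((θ + 2) / (q - 1)) * Real.log ‖x‖ + k) :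
    ∃ C, 0 < C ∧ ∀ x ∈ logBall (EuclideanSpace ℝ (Fin N)) (s₀ - 1),
      ‖x‖ * ‖(u x)⁻¹ • gradient u x‖ ≤ C := by
  set A : ℝ := |(N : ℝ) - 2 + 2 * ρ| + |lam| + Real.exp ((q - 1) * k) with hA
  have hA0 : 0 < A := by positivity
  obtain ⟨C, hC, hmain⟩ := exists_norm_gradient_le_mul (EuclideanSpace ℝ (Fin N)) A hA0
  refine ⟨6 * C, by positivity, fun x hx => ?_⟩
  have hx0 : 0 < ‖x‖ := hx.1
  have hsub := (closedBall_subset_logBall hx).trans hball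
  have hgr := hmain _ _ _ _ x (‖x‖ / 6) (hu.hasWeakLaplacian hΩ hτ1) (by positivity) hsub
    (fun y hy => hu.1.2 y (hsub hy)) (fun y hy => by
      obtain ⟨hy1, -⟩ := norm_bounds_of_mem_closedBall hy
      have hu0 := hu.1.2 y (hsub hy)
      have hy0 : 0 < ‖y‖ := by linarith
      have hRy : ‖x‖ / 6 ≤ ‖y‖ := by linarith
      set R := ‖x‖ / 6 with hR
      have hR0 : 0 < R := by positivity
      set P := ‖gradient u y‖ / R with hP
      set Q := u y / R ^ 2 with hQ
      have hP0 : 0 ≤ P := by positivity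
      have hQ0 : 0 ≤ Q := by positivity
      have hP' : ‖gradient u y‖ / ‖y‖ ≤ P := by rw [hP]; gcongr
      have hQ' : u y / ‖y‖ ^ 2 ≤ Q := by rw [hQ]; gcongr
      have h1 : |((N : ℝ) - 2 + 2 * ρ) * (⟪y, gradient u y⟫ / ‖y‖ ^ 2)|
          ≤ |(N : ℝ) - 2 + 2 * ρ| * (P + Q) := by
        rw [abs_mul]
        gcongr
        rw [abs_div, abs_of_pos (by positivity : 0 < ‖y‖ ^ 2)]
        calc |⟪y, gradient u y⟫| / ‖y‖ ^ 2 ≤ ‖y‖ * ‖gradient u y‖ / ‖y‖ ^ 2 := by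
              gcongr; exact abs_real_inner_le_norm _ _
          _ = ‖gradient u y‖ / ‖y‖ := by field_simp
          _ ≤ P + Q := by linarith
      have h2 : |lam * Gt τ y (u y) (gradient u y)| ≤ |lam| * (P + Q) := by
        rw [abs_mul]
        gcongr
        have e1 : Gt τ y (u y) (gradient u y)
            = (u y / ‖y‖ ^ 2) ^ τ * (‖gradient u y‖ / ‖y‖) ^ (1 - τ) := by
          unfold Gt
          rw [Real.div_rpow hu0.le (by positivity), Real.div_rpow (norm_nonneg _) hy0.le,
            div_mul_div_comm]
          congr 1
          rw [← Real.rpow_natCast, ← Real.rpow_mul hy0.le, ← Real.rpow_add hy0]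
          congr 1
          push_cast
          ring
        have e2 := Real.geom_mean_le_arith_mean2_weighted hτ0 (by linarith : 0 ≤ 1 - τ)
          (by positivity : 0 ≤ u y / ‖y‖ ^ 2) (by positivity : 0 ≤ ‖gradient u y‖ / ‖y‖) (by ring)
        rw [e1, abs_of_nonneg (by positivity)]
        refine e2.trans ?_
        nlinarith
      have h3 : |‖y‖ ^ θ * u y ^ q| ≤ Real.exp ((q - 1) * k) * (P + Q) := by
        rw [abs_of_nonneg (by positivity)]
        have e1 : ‖y‖ ^ θ * u y ^ q = u y / ‖y‖ ^ 2 * Real.exp ((q - 1) * (Real.log (u y)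
            - -((θ + 2) / (q - 1)) * Real.log ‖y‖)) := by
          have e2 : ‖y‖ ^ (2 : ℕ) = Real.exp (2 * Real.log ‖y‖) := by
            rw [mul_comm, ← Real.rpow_def_of_pos hy0]; norm_num
          have hq' : q - 1 ≠ 0 := by linarith
          conv_rhs => rw [← Real.exp_log hu0, Real.log_exp]
          rw [Real.rpow_def_of_pos hy0, Real.rpow_def_of_pos hu0, e2, ← Real.exp_add,
            ← Real.exp_sub, ← Real.exp_add]
          congr 1
          field_simp
          ring
        have e3 : Real.exp ((q - 1) * (Real.log (u y) - -((θ + 2) / (q - 1)) * Real.log ‖y‖))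
            ≤ Real.exp ((q - 1) * k) := by
          rw [Real.exp_le_exp]
          have := hk y (closedBall_subset_logBall hx hy)
          have : 0 ≤ q - 1 := by linarith
          gcongr
          linarith
        rw [e1, mul_comm]
        gcongr
        linarith
      calc _ ≤ |((N : ℝ) - 2 + 2 * ρ) * (⟪y, gradient u y⟫ / ‖y‖ ^ 2)|
            + |lam * Gt τ y (u y) (gradient u y)| + |‖y‖ ^ θ * u y ^ q| :=
            (abs_add_le _ _).trans (by gcongr; exact abs_sub _ _)
        _ ≤ A * (P + Q) := by rw [hA]; linarith)
  have hu0 := hu.1.2 x (hsub (Metric.mem_closedBall_self (by positivity)))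
  rw [norm_smul, norm_inv, Real.norm_of_nonneg hu0.le, ← mul_assoc, mul_comm ‖x‖, mul_assoc,
    inv_mul_le_iff₀ hu0]
  linarith

end GradientBound

lemma tendsto_atBot_of_monotoneOn {h : ℝ → ℝ} {c : ℝ} (hm : MonotoneOn h (Set.Iic c)) :
    Tendsto h atBot atBot ∨ ∃ l, Tendsto h atBot (𝓝 l) := by
  have hmono : Monotone fun s => h (min s c) := fun a d had =>
    hm (Set.mem_Iic.2 (min_le_right _ _)) (Set.mem_Iic.2 (min_le_right _ _))
      (min_le_min_right c had)
  have heq : (fun s => h (min s c)) =ᶠ[atBot] h :=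
    (eventually_le_atBot c).mono fun s hs => by simp [min_eq_left hs]
  rcases tendsto_atBot_of_monotone hmono with hl | ⟨l, hl⟩
  · exact Or.inl (hl.congr' heq)
  · exact Or.inr ⟨l, hl.congr' heq⟩

lemma tendsto_atBot_of_antitoneOn {h : ℝ → ℝ} {c : ℝ} (hm : AntitoneOn h (Set.Iic c)) :
    Tendsto h atBot atTop ∨ ∃ l, Tendsto h atBot (𝓝 l) := by
  rcases tendsto_atBot_of_monotoneOn (h := fun s => -h s) hm.neg with hl | ⟨l, hl⟩
  · exact Or.inl (tendsto_neg_atBot_iff.1 hl)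
  · exact Or.inr ⟨-l, by simpa using hl.neg⟩

/-- A quasi-convex function on a left half-line is eventually monotone at `-∞`. -/
lemma exists_monotoneOn_or_antitoneOn {h : ℝ → ℝ} {c : ℝ}
    (hq : ∀ a d, d ≤ c → ∀ t ∈ Set.Icc a d, h t ≤ max (h a) (h d)) :
    ∃ c' ≤ c, MonotoneOn h (Set.Iic c') ∨ AntitoneOn h (Set.Iic c') := by
  by_cases hm : MonotoneOn h (Set.Iic c)
  · exact ⟨c, le_rfl, Or.inl hm⟩
  · simp only [MonotoneOn, not_forall, not_le] at hm
    obtain ⟨s, hs, d, hd, hsd, hlt⟩ := hm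
    refine ⟨s, hs, Or.inr fun x hx y hy hxy => ?_⟩
    have hxs : h s ≤ h x := by
      rcases le_max_iff.1 (hq x d hd s ⟨hx, hsd⟩) with h1 | h1
      · exact h1
      · exact absurd h1 (not_le.2 hlt)
    rcases le_max_iff.1 (hq x s hs y ⟨hxy, hy⟩) with h1 | h1
    · exact h1
    · exact h1.trans hxs

lemma tendsto_atBot_of_quasiconvex {h : ℝ → ℝ} {c : ℝ}
    (hq : ∀ a d, d ≤ c → ∀ t ∈ Set.Icc a d, h t ≤ max (h a) (h d)) :
    Tendsto h atBot atBot ∨ Tendsto h atBot atTop ∨ ∃ l, Tendsto h atBot (𝓝 l) := by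
  obtain ⟨c', -, hm | hm⟩ := exists_monotoneOn_or_antitoneOn hq
  · exact (tendsto_atBot_of_monotoneOn hm).imp id Or.inr
  · exact Or.inr (tendsto_atBot_of_antitoneOn hm)

/-- A quasi-concave function on a left half-line that is not bounded below near `-∞`
tends to `-∞` and is eventually monotone. -/
lemma exists_monotoneOn_of_quasiconcave {h : ℝ → ℝ} {c : ℝ}
    (hq : ∀ a d, d ≤ c → ∀ t ∈ Set.Icc a d, min (h a) (h d) ≤ h t)
    (hb : ¬ ∃ B, ∀ᶠ s in atBot, B ≤ h s) :
    Tendsto h atBot atBot ∧ ∃ c' ≤ c, MonotoneOn h (Set.Iic c') := by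
  obtain ⟨c', hc', hm⟩ := exists_monotoneOn_or_antitoneOn (h := fun s => -h s) (c := c)
    fun a d hd t ht => by
      have := hq a d hd t ht
      rw [max_neg_neg]
      linarith
  rcases hm with hm | hm
  · refine absurd ⟨h c', (eventually_le_atBot c').mono fun s hs => ?_⟩ hb
    have := hm (Set.mem_Iic.2 hs) (Set.mem_Iic.2 le_rfl) hs
    simpa using this
  · have hm' : MonotoneOn h (Set.Iic c') := by simpa using hm.neg
    refine ⟨(tendsto_atBot_of_monotoneOn hm').resolve_right ?_, c', hc', hm'⟩
    rintro ⟨l, hl⟩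
    exact hb ⟨l - 1, (hl.eventually (lt_mem_nhds (sub_one_lt l))).mono fun s hs => hs.le⟩

/-- A line, as a comparison function. -/
lemma hasTwoDerivs_line (p : ℝ) :
    HasTwoDerivs Set.univ (fun s => p * s) (fun _ => p) (fun _ => 0) where
  isOpen := isOpen_univ
  first s _ := by simpa using (hasDerivAt_id s).const_mul p
  second s _ := hasDerivAt_const s p
  cont := continuousOn_const

/-- A parabola, as a comparison function. -/
lemma hasTwoDerivs_parabola (b k H c : ℝ) :
    HasTwoDerivs Set.univ (fun s => b * s + k + H * (s - c) ^ 2)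
      (fun s => b + 2 * H * (s - c)) (fun _ => 2 * H) where
  isOpen := isOpen_univ
  first s _ := by
    convert! ((hasDerivAt_id s).const_mul b).add_const k |>.add
      ((((hasDerivAt_id s).sub_const c).pow 2).const_mul H) using 1
    simp
    ring
  second s _ := by
    convert! ((((hasDerivAt_id s).sub_const c).const_mul (2 * H))).const_add b using 1
    simp
  cont := continuousOn_const

/-- An exponential perturbation of a line, as a comparison function. -/
lemma hasTwoDerivs_exp (p A γ c : ℝ) :
    HasTwoDerivs Set.univ (fun s => p * s + A * Real.exp (γ * (s - c)))
      (fun s => p + A * γ * Real.exp (γ * (s - c)))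
      (fun s => A * γ ^ 2 * Real.exp (γ * (s - c))) where
  isOpen := isOpen_univ
  first s _ := by
    have h : HasDerivAt (fun s => γ * (s - c)) γ s := by
      simpa using ((hasDerivAt_id s).sub_const c).const_mul γ
    convert! ((hasDerivAt_id s).const_mul p).add (h.exp.const_mul A) using 1
    ring
  second s _ := by
    have h : HasDerivAt (fun s => γ * (s - c)) γ s := by
      simpa using ((hasDerivAt_id s).sub_const c).const_mul γ
    convert! (h.exp.const_mul (A * γ)).const_add p using 1
    ring
  cont := by fun_prop

/-- The logistic transition from slope `α + δ` at `-∞` to slope `α` at `+∞`. -/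
lemma hasTwoDerivs_logistic (α δ c : ℝ) {γ : ℝ} (hγ : 0 < γ) :
    HasTwoDerivs Set.univ
      (fun s => α * s - δ / γ * Real.log (1 + Real.exp (γ * (c - s))))
      (fun s => α + δ * (Real.exp (γ * (c - s)) / (1 + Real.exp (γ * (c - s)))))
      (fun s => -(δ * γ) * (Real.exp (γ * (c - s)) / (1 + Real.exp (γ * (c - s))))
        * (1 - Real.exp (γ * (c - s)) / (1 + Real.exp (γ * (c - s))))) where
  isOpen := isOpen_univ
  first s _ := by
    have h : HasDerivAt (fun s => γ * (c - s)) (-γ) s := by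
      simpa using ((hasDerivAt_id s).const_sub c).const_mul γ
    have h1 : 0 < 1 + Real.exp (γ * (c - s)) := by positivity
    convert! ((hasDerivAt_id s).const_mul α).sub
      (((h.exp.const_add 1).log h1.ne').const_mul (δ / γ)) using 1
    field_simp
    ring
  second s _ := by
    have h : HasDerivAt (fun s => γ * (c - s)) (-γ) s := by
      simpa using ((hasDerivAt_id s).const_sub c).const_mul γ
    have h1 : 0 < 1 + Real.exp (γ * (c - s)) := by positivity
    convert! ((h.exp.div (h.exp.const_add 1) h1.ne').const_mul δ).const_add α using 1
    field_simp
    ring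
  cont := by
    have h1 : ∀ s, 1 + Real.exp (γ * (c - s)) ≠ 0 := fun s => by positivity
    have : Continuous fun s => Real.exp (γ * (c - s)) / (1 + Real.exp (γ * (c - s))) :=
      Continuous.div (by fun_prop) (by fun_prop) h1
    fun_prop

lemma le_log_one_add_exp (x : ℝ) : x ≤ Real.log (1 + Real.exp x) := by
  rw [Real.le_log_iff_exp_le (by positivity)]
  linarith

/-- The logistic transition converges to a line when the transition point goes to `-∞`. -/
lemma tendsto_logistic (α δ γ s : ℝ) (hγ : 0 < γ) :
    Tendsto (fun c => α * s - δ / γ * Real.log (1 + Real.exp (γ * (c - s)))) atBot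
      (𝓝 (α * s)) := by
  have h1 : Tendsto (fun c => γ * (c - s)) atBot atBot :=
    (tendsto_atBot_add_const_right atBot (-s) tendsto_id).const_mul_atBot hγ
  have h2 : Tendsto (fun c => 1 + Real.exp (γ * (c - s))) atBot (𝓝 (1 + 0)) :=
    (Real.tendsto_exp_atBot.comp h1).const_add 1
  have h3 := (h2.log (by norm_num)).const_mul (δ / γ) |>.const_sub (α * s)
  simpa using h3

namespace IsEnvelope

variable {F m M : ℝ → ℝ} {b κ s₀ : ℝ}

/-- One-sided comparison from below on a left half-line. -/
lemma lower_Iic (h : IsEnvelope F b κ s₀ m M) {O : Set ℝ} {z z₁ z₂ : ℝ → ℝ} {c : ℝ}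
    (hz : HasTwoDerivs O z z₁ z₂) (hO : Set.Iic c ⊆ O) (hc : c < s₀)
    (hlt : ∀ s ≤ c, F (z₁ s) + Real.exp (κ * (m s - b * s)) < z₂ s)
    (ht : Tendsto (fun s => m s - z s) atBot atTop) {s : ℝ} (hs : s ≤ c) :
    m c - z c ≤ m s - z s := by
  obtain ⟨a, ha, has⟩ :=
    ((ht.eventually_ge_atTop (m c - z c)).and (eventually_le_atBot s)).exists
  exact h.lower O z z₁ z₂ a c _ hz (fun t ht => hO ht.2) hc ha le_rfl
    (fun t ht _ => hlt t ht.2.le) s ⟨has, hs⟩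

/-- One-sided comparison from above on a left half-line. -/
lemma upper_Iic (h : IsEnvelope F b κ s₀ m M) {O : Set ℝ} {z z₁ z₂ : ℝ → ℝ} {c : ℝ}
    (hz : HasTwoDerivs O z z₁ z₂) (hO : Set.Iic c ⊆ O) (hc : c < s₀)
    (hlt : ∀ s ≤ c, z₂ s < F (z₁ s) + Real.exp (κ * (M s - b * s)))
    (ht : Tendsto (fun s => M s - z s) atBot atBot) {s : ℝ} (hs : s ≤ c) :
    M s - z s ≤ M c - z c := by
  obtain ⟨a, ha, has⟩ :=
    ((ht.eventually_le_atBot (M c - z c)).and (eventually_le_atBot s)).exists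
  exact h.upper O z z₁ z₂ a c _ hz (fun t ht => hO ht.2) hc ha le_rfl
    (fun t ht _ => hlt t ht.2.le) s ⟨has, hs⟩

/-- The lower envelope is quasi-concave relative to a strict sub-solution. -/
lemma lower_quasiconcave (h : IsEnvelope F b κ s₀ m M) {O : Set ℝ} {z z₁ z₂ : ℝ → ℝ} {c : ℝ}
    (hz : HasTwoDerivs O z z₁ z₂) (hO : Set.Iic c ⊆ O) (hc : c < s₀)
    (hlt : ∀ s ≤ c, F (z₁ s) + Real.exp (κ * (m s - b * s)) < z₂ s) (a d : ℝ) (hd : d ≤ c) :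
    ∀ t ∈ Set.Icc a d, min (m a - z a) (m d - z d) ≤ m t - z t :=
  h.lower O z z₁ z₂ a d _ hz (fun _ ht => hO (ht.2.trans hd)) (hd.trans_lt hc)
    (min_le_left _ _) (min_le_right _ _) fun t ht _ => hlt t (ht.2.le.trans hd)

/-- The upper envelope is quasi-convex relative to a strict super-solution. -/
lemma upper_quasiconvex (h : IsEnvelope F b κ s₀ m M) {O : Set ℝ} {z z₁ z₂ : ℝ → ℝ} {c : ℝ}
    (hz : HasTwoDerivs O z z₁ z₂) (hO : Set.Iic c ⊆ O) (hc : c < s₀)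
    (hlt : ∀ s ≤ c, z₂ s < F (z₁ s) + Real.exp (κ * (M s - b * s))) (a d : ℝ) (hd : d ≤ c) :
    ∀ t ∈ Set.Icc a d, M t - z t ≤ max (M a - z a) (M d - z d) :=
  h.upper O z z₁ z₂ a d _ hz (fun _ ht => hO (ht.2.trans hd)) (hd.trans_lt hc)
    (le_max_left _ _) (le_max_right _ _) fun t ht _ => hlt t (ht.2.le.trans hd)

/-- The upper envelope is eventually at most the constant-slope equilibrium. -/
lemma eventually_upper_le (h : IsEnvelope F b κ s₀ m M) (hκ : 0 < κ) (hF : Continuous F)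
    {L k : ℝ} (hL : Real.exp (κ * L) = -F b) (hk : ∀ᶠ s in atBot, M s ≤ b * s + k)
    {η : ℝ} (hη : 0 < η) : ∀ᶠ s in atBot, M s ≤ b * s + (L + η) := by
  obtain ⟨c₀, hc₀⟩ := eventually_atBot.1 hk
  set H : ℝ := max (k - (L + η)) 0 with hH
  have hH0 : 0 ≤ H := le_max_right _ _
  have hHk : k ≤ L + η + H := by linarith [le_max_left (k - (L + η)) 0]
  have hlim : Tendsto (fun T : ℝ => 2 * H / T) atTop (𝓝 0) :=
    tendsto_const_nhds.div_atTop tendsto_id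
  have hlim2 : Tendsto (fun T : ℝ => 2 * H / T ^ 2) atTop (𝓝 0) :=
    tendsto_const_nhds.div_atTop (tendsto_pow_atTop two_ne_zero)
  set e : ℝ := Real.exp (κ * (L + η)) - Real.exp (κ * L) with he
  have he0 : 0 < e := sub_pos.2 (Real.exp_lt_exp.2 (by nlinarith))
  obtain ⟨d, hd0, hd⟩ := Metric.continuousAt_iff.1 (hF.continuousAt (x := b)) (e / 2)
    (by positivity)
  obtain ⟨T, hT0, hT1, hT2⟩ := ((eventually_gt_atTop (0 : ℝ)).and
    ((hlim.eventually (gt_mem_nhds hd0)).and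
      (hlim2.eventually (gt_mem_nhds (half_pos he0))))).exists
  filter_upwards [eventually_le_atBot (c₀ - T), eventually_le_atBot (s₀ - T - 1)] with s hs hs'
  have key := h.upper Set.univ _ _ _ (s - T) (s + T) 0
    (hasTwoDerivs_parabola b (L + η) (H / T ^ 2) s) (Set.subset_univ _) (by linarith) ?_ ?_ ?_ s
    ⟨by linarith, by linarith⟩
  · simp only [sub_self] at key
    linarith
  · have := hc₀ (s - T) (by linarith)
    have e1 : H / T ^ 2 * (s - T - s) ^ 2 = H := by field_simp; ring
    rw [e1]
    linarith
  · have := hc₀ (s + T) (by linarith)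
    have e1 : H / T ^ 2 * (s + T - s) ^ 2 = H := by field_simp; ring
    rw [e1]
    linarith
  · intro t ht hlt
    have h1 : L + η ≤ M t - b * t := by
      have : 0 ≤ H / T ^ 2 * (t - s) ^ 2 := by positivity
      linarith
    have h2 : Real.exp (κ * (L + η)) ≤ Real.exp (κ * (M t - b * t)) :=
      Real.exp_le_exp.2 (mul_le_mul_of_nonneg_left h1 hκ.le)
    have h3 : |2 * (H / T ^ 2) * (t - s)| ≤ 2 * H / T := by
      rw [abs_mul, abs_of_nonneg (by positivity : 0 ≤ 2 * (H / T ^ 2))]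
      have : |t - s| ≤ T := abs_le.2 ⟨by linarith [ht.1], by linarith [ht.2]⟩
      calc 2 * (H / T ^ 2) * |t - s| ≤ 2 * (H / T ^ 2) * T :=
            mul_le_mul_of_nonneg_left this (by positivity)
        _ = 2 * H / T := by field_simp
    have h4 := hd (x := b + 2 * (H / T ^ 2) * (t - s))
      (by rw [Real.dist_eq, add_sub_cancel_left]; exact h3.trans_lt hT1)
    rw [Real.dist_eq] at h4
    have h5 := (abs_lt.1 h4).1
    have h6 : 2 * (H / T ^ 2) = 2 * H / T ^ 2 := by ring
    linarith

/-- If the lower envelope does not decay relative to the slope `b`, it is eventually at least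
the constant-slope equilibrium. -/
lemma eventually_le_lower (h : IsEnvelope F b κ s₀ m M) (hκ : 0 < κ) (hF : Continuous F)
    {L B : ℝ} (hL : Real.exp (κ * L) = -F b) (hB : ∀ᶠ s in atBot, b * s + B ≤ m s)
    {η : ℝ} (hη : 0 < η) : ∀ᶠ s in atBot, b * s + (L - η) ≤ m s := by
  obtain ⟨c₀, hc₀⟩ := eventually_atBot.1 hB
  set H : ℝ := max (L - η - B) 0 with hH
  have hH0 : 0 ≤ H := le_max_right _ _
  have hHk : L - η - H ≤ B := by linarith [le_max_left (L - η - B) 0]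
  have hlim : Tendsto (fun T : ℝ => 2 * H / T) atTop (𝓝 0) :=
    tendsto_const_nhds.div_atTop tendsto_id
  have hlim2 : Tendsto (fun T : ℝ => 2 * H / T ^ 2) atTop (𝓝 0) :=
    tendsto_const_nhds.div_atTop (tendsto_pow_atTop two_ne_zero)
  set e : ℝ := Real.exp (κ * L) - Real.exp (κ * (L - η)) with he
  have he0 : 0 < e := sub_pos.2 (Real.exp_lt_exp.2 (by nlinarith))
  obtain ⟨d, hd0, hd⟩ := Metric.continuousAt_iff.1 (hF.continuousAt (x := b)) (e / 2)
    (by positivity)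
  obtain ⟨T, hT0, hT1, hT2⟩ := ((eventually_gt_atTop (0 : ℝ)).and
    ((hlim.eventually (gt_mem_nhds hd0)).and
      (hlim2.eventually (gt_mem_nhds (half_pos he0))))).exists
  filter_upwards [eventually_le_atBot (c₀ - T), eventually_le_atBot (s₀ - T - 1)] with s hs hs'
  have key := h.lower Set.univ _ _ _ (s - T) (s + T) 0
    (hasTwoDerivs_parabola b (L - η) (-H / T ^ 2) s) (Set.subset_univ _) (by linarith) ?_ ?_ ?_ s
    ⟨by linarith, by linarith⟩
  · simp only [sub_self] at key
    linarith
  · have := hc₀ (s - T) (by linarith)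
    have e1 : -H / T ^ 2 * (s - T - s) ^ 2 = -H := by field_simp; ring
    rw [e1]
    linarith
  · have := hc₀ (s + T) (by linarith)
    have e1 : -H / T ^ 2 * (s + T - s) ^ 2 = -H := by field_simp; ring
    rw [e1]
    linarith
  · intro t ht hlt
    have h0 : -H / T ^ 2 = -(H / T ^ 2) := by ring
    rw [h0] at hlt ⊢
    have h1 : m t - b * t ≤ L - η := by
      have : 0 ≤ H / T ^ 2 * (t - s) ^ 2 := by positivity
      linarith
    have h2 : Real.exp (κ * (m t - b * t)) ≤ Real.exp (κ * (L - η)) :=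
      Real.exp_le_exp.2 (mul_le_mul_of_nonneg_left h1 hκ.le)
    have h3 : |2 * -(H / T ^ 2) * (t - s)| ≤ 2 * H / T := by
      rw [abs_mul, mul_neg, abs_neg, abs_of_nonneg (by positivity : 0 ≤ 2 * (H / T ^ 2))]
      have : |t - s| ≤ T := abs_le.2 ⟨by linarith [ht.1], by linarith [ht.2]⟩
      calc 2 * (H / T ^ 2) * |t - s| ≤ 2 * (H / T ^ 2) * T :=
            mul_le_mul_of_nonneg_left this (by positivity)
        _ = 2 * H / T := by field_simp
    have h4 := hd (x := b + 2 * -(H / T ^ 2) * (t - s))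
      (by rw [Real.dist_eq, add_sub_cancel_left]; exact h3.trans_lt hT1)
    rw [Real.dist_eq] at h4
    have h5 := (abs_lt.1 h4).2
    have h6 : 2 * -(H / T ^ 2) = -(2 * H / T ^ 2) := by ring
    linarith

/-- Either the lower envelope decays relative to slope `b`, or both envelopes are asymptotic to
the constant-slope equilibrium. -/
lemma tendsto_equilibrium_or (h : IsEnvelope F b κ s₀ m M) (hκ : 0 < κ) (hF : Continuous F)
    {L k : ℝ} (hL : Real.exp (κ * L) = -F b) (hk : ∀ᶠ s in atBot, M s ≤ b * s + k) :
    (Tendsto (fun s => m s - b * s) atBot (𝓝 L) ∧ Tendsto (fun s => M s - b * s) atBot (𝓝 L)) ∨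
      Tendsto (fun s => m s - b * s) atBot atBot := by
  by_cases hB : ∃ B, ∀ᶠ s in atBot, B ≤ min (m s - b * s) L
  · left
    obtain ⟨B, hB⟩ := hB
    have hup := fun η (hη : 0 < η) => h.eventually_upper_le hκ hF hL hk hη
    have hlo := fun η (hη : 0 < η) => h.eventually_le_lower hκ hF (B := B) hL
      (hB.mono fun s hs => by linarith [hs.trans (min_le_left _ _)]) hη
    have hle : ∀ᶠ s in atBot, m s ≤ M s := (eventually_lt_atBot s₀).mono h.le
    constructor <;> refine Metric.tendsto_nhds.2 fun ε hε => ?_ <;>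
      filter_upwards [hup _ (half_pos hε), hlo _ (half_pos hε), hle] with s h1 h2 h3 <;>
      rw [Real.dist_eq, abs_lt] <;> constructor <;> linarith
  · right
    have := (exists_monotoneOn_of_quasiconcave (c := s₀ - 1) (fun a d hd t ht => ?_) hB).1
    · refine this.congr' ?_
      filter_upwards [this.eventually_lt_atBot L] with s hs
      rcases min_lt_iff.1 hs with h1 | h1
      · exact min_eq_left h1.le
      · exact absurd h1 (lt_irrefl _)
    · set k₀ := min (min (m a - b * a) L) (min (m d - b * d) L) with hk₀
      have hk1 : k₀ ≤ m a - b * a := (min_le_left _ _).trans (min_le_left _ _)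
      have hk2 : k₀ ≤ m d - b * d := (min_le_right _ _).trans (min_le_left _ _)
      have hk3 : k₀ ≤ L := (min_le_right _ _).trans (min_le_right _ _)
      refine le_min (h.lower Set.univ _ _ _ a d k₀ (hasTwoDerivs_line b) (Set.subset_univ _)
        (by linarith) hk1 hk2 (fun r _ hr => ?_) t ht) hk3
      have : Real.exp (κ * (m r - b * r)) < Real.exp (κ * L) :=
        Real.exp_lt_exp.2 (mul_lt_mul_of_pos_left (hr.trans_le hk3) hκ)
      linarith

end IsEnvelope

lemma logistic_mem (x : ℝ) :
    0 < Real.exp x / (1 + Real.exp x) ∧ Real.exp x / (1 + Real.exp x) < 1 := by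
  have := Real.exp_pos x
  exact ⟨by positivity, by rw [div_lt_one (by positivity)]; linarith⟩

/-- Lowering the slope preserves divergence to `+∞` at `-∞`. -/
lemma tendsto_sub_mul_of_eventually_ge {m : ℝ → ℝ} {p q B : ℝ} (hpq : p < q)
    (hB : ∀ᶠ s in atBot, B ≤ m s - p * s) : Tendsto (fun s => m s - q * s) atBot atTop := by
  have h1 : Tendsto (fun s => B + (p - q) * s) atBot atTop :=
    tendsto_atTop_add_const_left _ _
      ((tendsto_id).const_mul_atBot_of_neg (sub_neg.2 hpq))
  refine tendsto_atTop_mono' _ ?_ h1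
  filter_upwards [hB] with s hs
  linarith

namespace IsEnvelope

variable {F m M : ℝ → ℝ} {b κ s₀ : ℝ}

/-- Propagation of a lower growth bound through an interval of slopes where `F < 0`. -/
lemma exists_antitoneOn (h : IsEnvelope F b κ s₀ m M) (hF : Continuous F) {q₀ q₁ : ℝ}
    (hq : q₀ < q₁) (hneg : ∀ p ∈ Set.Icc q₀ q₁, F p < 0)
    (hE : Tendsto (fun s => Real.exp (κ * (m s - b * s))) atBot (𝓝 0))
    (hm : Tendsto (fun s => m s - q₁ * s) atBot atTop) :
    ∃ c, AntitoneOn (fun s => m s - q₀ * s) (Set.Iic c) := by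
  obtain ⟨p₀, hp₀, hmax⟩ := (isCompact_Icc (a := q₀) (b := q₁)).exists_isMaxOn
    (Set.nonempty_Icc.2 hq.le) hF.continuousOn
  set e : ℝ := -F p₀ with he
  have he0 : 0 < e := neg_pos.2 (hneg p₀ hp₀)
  have hle : ∀ p ∈ Set.Icc q₀ q₁, F p ≤ -e := fun p hp => by
    rw [he, neg_neg]; exact hmax hp
  set δ : ℝ := q₁ - q₀ with hδ
  have hδ0 : 0 < δ := sub_pos.2 hq
  set γ : ℝ := e / (2 * δ) with hγ
  have hγ0 : 0 < γ := by positivity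
  have hδγ : δ * γ = e / 2 := by rw [hγ]; field_simp
  obtain ⟨c, hc⟩ := eventually_atBot.1 ((hE.eventually (gt_mem_nhds (half_pos he0))).and
    (eventually_lt_atBot s₀))
  refine ⟨c, fun s hs t ht hst => ?_⟩
  have key : ∀ x : ℝ, m t - (q₀ * t - δ / γ * Real.log (1 + Real.exp (γ * (x - t)))) ≤
      m s - (q₀ * s - δ / γ * Real.log (1 + Real.exp (γ * (x - s)))) := fun x => by
    refine h.lower_Iic (hasTwoDerivs_logistic q₀ δ x hγ0) (Set.subset_univ _) (hc t ht).2
      (fun r hr => ?_) ?_ hst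
    · obtain ⟨hσ0, hσ1⟩ := logistic_mem (γ * (x - r))
      set σ := Real.exp (γ * (x - r)) / (1 + Real.exp (γ * (x - r)))
      have h1 := hle (q₀ + δ * σ) ⟨by nlinarith, by nlinarith⟩
      have h2 := (hc r (hr.trans ht)).1
      have h3 : σ * (1 - σ) ≤ 1 := by nlinarith
      have h4 : 0 < δ * γ := by positivity
      have h5 : δ * γ * (σ * (1 - σ)) ≤ δ * γ * 1 := mul_le_mul_of_nonneg_left h3 h4.le
      have h6 : -(δ * γ) * σ * (1 - σ) = -(δ * γ * (σ * (1 - σ))) := by ring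
      rw [h6]
      linarith
    · refine tendsto_atTop_mono (fun r => ?_) (tendsto_atTop_add_const_right _ (δ * x) hm)
      have h1 := le_log_one_add_exp (γ * (x - r))
      have h2 : δ / γ * (γ * (x - r)) ≤ δ / γ * Real.log (1 + Real.exp (γ * (x - r))) :=
        mul_le_mul_of_nonneg_left h1 (by positivity)
      have h3 : δ / γ * (γ * (x - r)) = (q₁ - q₀) * (x - r) := by rw [← hδ]; field_simp
      rw [h3] at h2
      simp only [hδ] at h2 ⊢
      nlinarith
  exact le_of_tendsto_of_tendsto' ((tendsto_logistic q₀ δ γ t hγ0).const_sub (m t))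
    ((tendsto_logistic q₀ δ γ s hγ0).const_sub (m s)) key

/-- For slopes where `F < 0`, the lower envelope relative to a line is quasi-concave. -/
lemma exists_quasiconcave_line (h : IsEnvelope F b κ s₀ m M) {p : ℝ} (hp : F p < 0)
    (hE : Tendsto (fun s => Real.exp (κ * (m s - b * s))) atBot (𝓝 0)) :
    ∃ c, ∀ a d, d ≤ c → ∀ t ∈ Set.Icc a d,
      min (m a - p * a) (m d - p * d) ≤ m t - p * t := by
  obtain ⟨c, hc⟩ := eventually_atBot.1 ((hE.eventually (gt_mem_nhds (neg_pos.2 hp))).and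
    (eventually_lt_atBot s₀))
  exact ⟨c, h.lower_quasiconcave (hasTwoDerivs_line p) (Set.subset_univ _) (hc c le_rfl).2
    fun s hs => by linarith [(hc s hs).1]⟩

/-- In the decaying regime, the lower envelope is eventually monotone relative to every slope
below the smallest root. -/
lemma tendsto_atBot_of_lt_root (h : IsEnvelope F b κ s₀ m M) (hF : Continuous F) (hb : 0 < b)
    {p₂ : ℝ} (hneg : ∀ p, 0 < p → p < p₂ → F p < 0)
    (hE : Tendsto (fun s => Real.exp (κ * (m s - b * s))) atBot (𝓝 0))
    (hm : Tendsto (fun s => m s - b * s) atBot atBot) {p : ℝ} (hbp : b ≤ p) (hp : p < p₂) :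
    Tendsto (fun s => m s - p * s) atBot atBot ∧
      ∃ c, MonotoneOn (fun s => m s - p * s) (Set.Iic c) := by
  obtain ⟨c, hc⟩ := h.exists_quasiconcave_line (hneg p (hb.trans_le hbp) hp) hE
  have hnot : ¬ ∃ B, ∀ᶠ s in atBot, B ≤ m s - p * s := by
    rintro ⟨B, hB⟩
    have h1 := tendsto_sub_mul_of_eventually_ge (q := (p + p₂) / 2) (by linarith) hB
    obtain ⟨c', hc'⟩ := h.exists_antitoneOn hF (q₀ := b / 2) (by linarith)
      (fun r hr => hneg r (by linarith [hr.1]) (by linarith [hr.2])) hE h1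
    have h2 := tendsto_sub_mul_of_eventually_ge (m := m) (p := b / 2) (q := b)
      (B := m c' - b / 2 * c') (by linarith) ((eventually_le_atBot c').mono fun s hs =>
        hc' (Set.mem_Iic.2 hs) (Set.mem_Iic.2 le_rfl) hs)
    exact absurd hm (h2.not_tendsto disjoint_atTop_atBot)
  obtain ⟨h1, c', -, h2⟩ := exists_monotoneOn_of_quasiconcave hc hnot
  exact ⟨h1, c', h2⟩

/-- In the decaying regime the lower envelope diverges relative to every slope above the largest
root. -/
lemma tendsto_atTop_of_root_lt (h : IsEnvelope F b κ s₀ m M) (hF : Continuous F)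
    {p₁ : ℝ} (hneg : ∀ p, p₁ < p → F p < 0)
    (hE : Tendsto (fun s => Real.exp (κ * (m s - b * s))) atBot (𝓝 0))
    {Q : ℝ} (hQ : Tendsto (fun s => m s - Q * s) atBot atTop) {p : ℝ} (hp : p₁ < p) :
    Tendsto (fun s => m s - p * s) atBot atTop := by
  have hQ' : Tendsto (fun s => m s - (max Q p) * s) atBot atTop := by
    refine tendsto_atTop_mono' _ ?_ hQ
    filter_upwards [eventually_le_atBot 0] with s hs
    nlinarith [le_max_left Q p]
  obtain ⟨c, hc⟩ := h.exists_antitoneOn hF (q₀ := (p₁ + p) / 2)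
    (by linarith [le_max_right Q p]) (fun r hr => hneg r (by linarith [hr.1])) hE hQ'
  exact tendsto_sub_mul_of_eventually_ge (m := m) (p := (p₁ + p) / 2) (q := p)
      (B := m c - (p₁ + p) / 2 * c) (by linarith) ((eventually_le_atBot c).mono fun s hs =>
        hc (Set.mem_Iic.2 hs) (Set.mem_Iic.2 le_rfl) hs)

/-- The dichotomy at the largest root. -/
lemma tendsto_nhds_or_atTop (h : IsEnvelope F b κ s₀ m M)
    {p₁ σ : ℝ} (hσ : 0 < σ) (hneg : ∀ p, p₁ < p → F p < 0)
    (hE : ∀ᶠ s in atBot, Real.exp (κ * (m s - b * s)) ≤ Real.exp (σ * s))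
    (hm : ∀ p, p₁ < p → Tendsto (fun s => m s - p * s) atBot atTop) :
    (∃ l, Tendsto (fun s => m s - p₁ * s) atBot (𝓝 l)) ∨
      Tendsto (fun s => m s - p₁ * s) atBot atTop := by
  obtain ⟨c, hc⟩ := eventually_atBot.1 (hE.and (eventually_lt_atBot s₀))
  set A : ℝ := 2 / σ ^ 2 with hA
  have hA0 : 0 < A := by positivity
  have hAσ : A * σ ^ 2 = 2 := by rw [hA]; field_simp
  have hexp : Tendsto (fun s => A * Real.exp (σ * s)) atBot (𝓝 0) := by
    simpa using (Real.tendsto_exp_atBot.comp (tendsto_id.const_mul_atBot hσ)).const_mul A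
  have hanti : AntitoneOn (fun s => m s - p₁ * s - A * Real.exp (σ * s)) (Set.Iic c) := by
    intro s hs t ht hst
    have key : ∀ ε > 0, m t - ((p₁ + ε) * t + A * Real.exp (σ * t)) ≤
        m s - ((p₁ + ε) * s + A * Real.exp (σ * s)) := fun ε hε => by
      have hz := hasTwoDerivs_exp (p₁ + ε) A σ 0
      simp only [sub_zero] at hz
      refine h.lower_Iic hz (Set.subset_univ _) (hc t ht).2 (fun r hr => ?_) ?_ hst
      · have h1 := (hc r (hr.trans ht)).1
        have h2 := hneg (p₁ + ε + A * σ * Real.exp (σ * r)) (by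
          have : 0 < A * σ * Real.exp (σ * r) := by positivity
          linarith)
        rw [hAσ]
        linarith [Real.exp_pos (σ * r)]
      · have := (hm (p₁ + ε) (by linarith)).atTop_add hexp.neg
        refine this.congr fun r => ?_
        ring
    have hlim : ∀ r, Tendsto (fun ε => m r - ((p₁ + ε) * r + A * Real.exp (σ * r))) (𝓝[>] 0)
        (𝓝 (m r - ((p₁ + 0) * r + A * Real.exp (σ * r)))) := fun r =>
      tendsto_nhdsWithin_of_tendsto_nhds (Continuous.tendsto (by fun_prop) 0)
    have := le_of_tendsto_of_tendsto (hlim t) (hlim s)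
      (eventually_nhdsWithin_of_forall fun ε hε => key ε hε)
    simp only [add_zero] at this ⊢
    linarith
  rcases tendsto_atBot_of_antitoneOn hanti with h1 | ⟨l, h1⟩
  · exact Or.inr ((h1.atTop_add hexp).congr fun s => by ring)
  · exact Or.inl ⟨l, by simpa using h1.add hexp⟩

/-- The increments of the lower envelope over steps of fixed length are asymptotically at least
those of every slope below the smallest root. -/
lemma not_increment_le {p₂ : ℝ} (hmono : ∀ q, b ≤ q → q < p₂ →
      ∃ c, MonotoneOn (fun s => m s - q * s) (Set.Iic c)) (hbp : b < p₂) {r d : ℝ} (hr : 0 < r)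
    (hd : d < p₂ * r) : ¬ ∀ᶠ c in atBot, m c - m (c - r) ≤ d := by
  intro hev
  set q := max b ((d / r + p₂) / 2) with hq
  have hdr : d / r < p₂ := by rwa [div_lt_iff₀ hr]
  have hq1 : d / r < q := lt_of_lt_of_le (by linarith) (le_max_right _ _)
  obtain ⟨c, hc⟩ := hmono q (le_max_left _ _) (max_lt hbp (by linarith))
  obtain ⟨t, ht1, ht2⟩ := (hev.and (eventually_le_atBot c)).exists
  have h1 := hc (Set.mem_Iic.2 (by linarith : t - r ≤ c)) (Set.mem_Iic.2 ht2) (by linarith)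
  simp only at h1
  rw [div_lt_iff₀ hr] at hq1
  nlinarith

/-- The dichotomy is resolved at the smallest root when the two roots are distinct. -/
lemma exists_tendsto_of_simple_root (h : IsEnvelope F b κ s₀ m M)
    {p₁ p₂ σ C₀ c₀ γ₁ y₀ : ℝ} (hσ : 0 < σ) (hbp : b < p₂) (hp : p₂ < p₁) (hp₂ : F p₂ = 0)
    (hc₀ : 0 < c₀) (hpos : ∀ p ∈ Set.Icc p₂ p₁, c₀ * ((p - p₂) * (p₁ - p)) ≤ F p)
    (hγ₁ : 0 < γ₁) (hy₀ : 0 < y₀) (hneg : ∀ y, 0 ≤ y → y ≤ y₀ → F (p₂ - y) ≤ -(γ₁ * y))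
    (hE : ∀ᶠ s in atBot, Real.exp (κ * (m s - b * s)) ≤ Real.exp (σ * s))
    (hgap : ∀ᶠ s in atBot, M s ≤ m s + C₀)
    (hmono : ∀ q, b ≤ q → q < p₂ → ∃ c, MonotoneOn (fun s => m s - q * s) (Set.Iic c))
    (hm : Tendsto (fun s => m s - p₁ * s) atBot atTop) :
    ∃ l, Tendsto (fun s => M s - p₂ * s) atBot (𝓝 l) := by
  rcases tendsto_atBot_of_quasiconvex (h.upper_quasiconvex (c := s₀ - 1) (hasTwoDerivs_line p₂)
    (Set.subset_univ _) (by linarith) fun s _ => by rw [hp₂]; positivity) with h1 | h1 | h1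
  · exfalso
    set D := p₁ - p₂ with hD
    have hD0 : 0 < D := sub_pos.2 hp
    set γ := c₀ * D with hγ
    have hγ0 : 0 < γ := by positivity
    have key : ∀ s ≤ s₀ - 1, M s - p₁ * s ≤ M (s₀ - 1) - p₁ * (s₀ - 1) := fun s hs => by
      have key : ∀ x : ℝ, M s - (p₁ * s - -D / γ * Real.log (1 + Real.exp (γ * (x - s)))) ≤
          M (s₀ - 1) - (p₁ * (s₀ - 1)
            - -D / γ * Real.log (1 + Real.exp (γ * (x - (s₀ - 1))))) := fun x => by
        refine h.upper_Iic (hasTwoDerivs_logistic p₁ (-D) x hγ0) (Set.subset_univ _)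
          (by linarith) (fun r hr => ?_) ?_ hs
        · obtain ⟨hσ0, hσ1⟩ := logistic_mem (γ * (x - r))
          set σ' := Real.exp (γ * (x - r)) / (1 + Real.exp (γ * (x - r)))
          have h1 := hpos (p₁ + -D * σ') ⟨by nlinarith, by nlinarith⟩
          have h3 : c₀ * ((p₁ + -D * σ' - p₂) * (p₁ - (p₁ + -D * σ'))) =
              -(-D * γ) * σ' * (1 - σ') := by rw [hγ, hD]; ring
          linarith [Real.exp_pos (κ * (M r - b * r))]
        · refine tendsto_atBot_mono (fun r => ?_) (tendsto_atBot_add_const_right _ (-(D * x)) h1)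
          have h1 := le_log_one_add_exp (γ * (x - r))
          have h2 : D / γ * (γ * (x - r)) ≤ D / γ * Real.log (1 + Real.exp (γ * (x - r))) :=
            mul_le_mul_of_nonneg_left h1 (by positivity)
          have h3 : D / γ * (γ * (x - r)) = D * (x - r) := by field_simp
          rw [h3] at h2
          have h4 : -D / γ = -(D / γ) := by ring
          rw [h4]
          simp only [hD] at h2 ⊢
          nlinarith
      exact le_of_tendsto_of_tendsto' ((tendsto_logistic p₁ (-D) γ s hγ0).const_sub (M s))
        ((tendsto_logistic p₁ (-D) γ (s₀ - 1) hγ0).const_sub (M (s₀ - 1))) key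
    obtain ⟨s, hs1, hs2⟩ := ((hm.eventually_gt_atTop (M (s₀ - 1) - p₁ * (s₀ - 1))).and
      (eventually_le_atBot (s₀ - 1))).exists
    linarith [key s hs2, h.le s (by linarith)]
  · exfalso
    set γ := min (γ₁ / 2) σ with hγ
    have hγ0 : 0 < γ := lt_min (by positivity) hσ
    have hm2 : Tendsto (fun s => m s - p₂ * s) atBot atTop := by
      refine tendsto_atTop_mono' _ ?_ (tendsto_atTop_add_const_right _ (-C₀) h1)
      filter_upwards [hgap] with s hs
      linarith
    have hinc : ∀ᶠ c in atBot, m c - m (c - 1) ≤ p₂ * 1 - y₀ / γ * (1 - Real.exp (-γ)) := by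
      have hs : Tendsto (fun s => Real.exp (σ * s)) atBot (𝓝 0) :=
        Real.tendsto_exp_atBot.comp (tendsto_id.const_mul_atBot hσ)
      obtain ⟨c₁, hc₁⟩ := eventually_atBot.1 (hE.and (eventually_lt_atBot s₀))
      filter_upwards [eventually_le_atBot c₁,
        hs.eventually (gt_mem_nhds (by positivity : 0 < γ₁ / 2 * y₀))] with c hc hsc
      have key := h.lower_Iic (hasTwoDerivs_exp p₂ (-(y₀ / γ)) γ c) (Set.subset_univ _)
        (hc₁ c hc).2 (fun r hr => ?_) ?_ (by linarith : c - 1 ≤ c)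
      · have e1 : c - 1 - c = -1 := by ring
        rw [sub_self, mul_zero, Real.exp_zero, e1, mul_neg_one] at key
        linarith
      · have e0 : 0 < Real.exp (γ * (r - c)) := Real.exp_pos _
        have e1 : Real.exp (γ * (r - c)) ≤ 1 := Real.exp_le_one_iff.2 (by nlinarith)
        set e := Real.exp (γ * (r - c)) with he
        have e2 : p₂ + -(y₀ / γ) * γ * e = p₂ - y₀ * e := by field_simp; ring
        have e3 : -(y₀ / γ) * γ ^ 2 * e = -(γ * (y₀ * e)) := by field_simp
        rw [e2, e3]
        have h2 := hneg (y₀ * e) (by positivity) (by nlinarith)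
        have h3 := (hc₁ r (hr.trans hc)).1
        have h4 : Real.exp (σ * r) ≤ Real.exp (σ * c) * e := by
          rw [he, ← Real.exp_add]
          exact Real.exp_le_exp.2 (by nlinarith [min_le_right (γ₁ / 2) σ])
        have h5 : Real.exp (σ * c) * e < γ₁ / 2 * y₀ * e := mul_lt_mul_of_pos_right hsc e0
        have h6 : γ * (y₀ * e) ≤ γ₁ / 2 * (y₀ * e) :=
          mul_le_mul_of_nonneg_right (min_le_left _ _) (by positivity)
        nlinarith
      · refine tendsto_atTop_mono (fun r => ?_) hm2
        have : 0 ≤ y₀ / γ * Real.exp (γ * (r - c)) := by positivity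
        linarith
    refine not_increment_le hmono hbp one_pos ?_ hinc
    have : Real.exp (-γ) < 1 := Real.exp_lt_one_iff.2 (by linarith)
    have : 0 < y₀ / γ * (1 - Real.exp (-γ)) := mul_pos (by positivity) (by linarith)
    linarith
  · exact h1

end IsEnvelope

/-- The logarithmically corrected profile at a double root. -/
def logProfile (p A e B s : ℝ) : ℝ :=
  p * s + A * Real.log (B - s) + 2 * e * (√(B - s))⁻¹

lemma hasTwoDerivs_logProfile (p A e B : ℝ) :
    HasTwoDerivs (Set.Iio B) (logProfile p A e B)
      (fun s => p + (-A * (√(B - s))⁻¹ ^ 2 + e * (√(B - s))⁻¹ ^ 3))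
      (fun s => -A * (√(B - s))⁻¹ ^ 4 + 3 / 2 * e * (√(B - s))⁻¹ ^ 5) := by
  have hx : ∀ s ∈ Set.Iio B, HasDerivAt (fun s => (√(B - s))⁻¹) ((√(B - s))⁻¹ ^ 3 / 2) s := by
    intro s hs
    have h0 : 0 < B - s := sub_pos.2 hs
    have h1 : HasDerivAt (fun s => B - s) (-1) s := by simpa using (hasDerivAt_id s).const_sub B
    have hr : 0 < √(B - s) := Real.sqrt_pos.2 h0
    convert! (h1.sqrt h0.ne').inv hr.ne' using 1
    field_simp
  refine ⟨isOpen_Iio, fun s hs => ?_, fun s hs => ?_, ?_⟩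
  · have h0 : 0 < B - s := sub_pos.2 hs
    have h1 : HasDerivAt (fun s => B - s) (-1) s := by simpa using (hasDerivAt_id s).const_sub B
    convert! (((hasDerivAt_id s).const_mul p).add ((h1.log h0.ne').const_mul A)).add
      ((hx s hs).const_mul (2 * e)) using 1
    rw [inv_pow (√(B - s)) 2, Real.sq_sqrt h0.le]
    ring
  · convert! ((((hx s hs).pow 2).const_mul (-A)).add (((hx s hs).pow 3).const_mul e)).const_add p
      using 1
    simp only [Nat.cast_ofNat]
    ring
  · have : ContinuousOn (fun s => (√(B - s))⁻¹) (Set.Iio B) := fun s hs =>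
      (hx s hs).continuousAt.continuousWithinAt
    fun_prop

/-- Expansion of the residual of the corrected profile. -/
lemma exists_profile_estimate {F : ℝ → ℝ} {p a K y₀ : ℝ} (ha : 0 < a) (hy₀ : 0 < y₀) (hK : 0 ≤ K)
    (hF : ∀ y, |y| ≤ y₀ → |F (p + y) + a * y ^ 2| ≤ K * |y| ^ 3) :
    ∃ x₀ > 0, ∀ x, 0 < x → x ≤ x₀ → ∀ e : ℝ, e ^ 2 = 1 →
      |F (p + (-a⁻¹ * x ^ 2 + e * x ^ 3)) - (-a⁻¹ * x ^ 4 + 3 / 2 * e * x ^ 5) - e / 2 * x ^ 5|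
        ≤ x ^ 5 / 4 := by
  set A := a⁻¹ with hA
  have hA0 : 0 < A := inv_pos.2 ha
  have haA : a * A = 1 := mul_inv_cancel₀ ha.ne'
  set D := K * (A + 1) ^ 3 + a with hD
  have hD0 : 0 < D := by positivity
  refine ⟨min 1 (min (y₀ / (A + 1)) (1 / (4 * D))), by positivity, fun x hx0 hx e he => ?_⟩
  have hx1 : x ≤ 1 := hx.trans (min_le_left _ _)
  have hx2 : x ≤ y₀ / (A + 1) := hx.trans ((min_le_right _ _).trans (min_le_left _ _))
  have hx3 : x ≤ 1 / (4 * D) := hx.trans ((min_le_right _ _).trans (min_le_right _ _))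
  rw [le_div_iff₀ (by positivity)] at hx2 hx3
  have hea : |e| = 1 := by rw [← sq_eq_sq₀ (abs_nonneg e) zero_le_one, sq_abs, he, one_pow]
  set y := -A * x ^ 2 + e * x ^ 3 with hy
  have hyle : |y| ≤ (A + 1) * x ^ 2 := by
    calc |y| ≤ |-A * x ^ 2| + |e * x ^ 3| := abs_add_le _ _
      _ = A * x ^ 2 + x ^ 3 := by
        rw [abs_mul, abs_mul, abs_neg, abs_of_pos hA0, hea, abs_of_pos (by positivity : 0 < x ^ 2),
          abs_of_pos (by positivity : 0 < x ^ 3), one_mul]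
      _ ≤ (A + 1) * x ^ 2 := by nlinarith [sq_nonneg x]
  have hyy : |y| ≤ y₀ := hyle.trans (by nlinarith)
  have h1 := hF y hyy
  have h2 : K * |y| ^ 3 ≤ K * (A + 1) ^ 3 * x ^ 6 := by
    calc K * |y| ^ 3 ≤ K * ((A + 1) * x ^ 2) ^ 3 :=
          mul_le_mul_of_nonneg_left (pow_le_pow_left₀ (abs_nonneg y) hyle 3) hK
      _ = _ := by ring
  have h3 : F (p + y) - (-A * x ^ 4 + 3 / 2 * e * x ^ 5) - e / 2 * x ^ 5 =
      (F (p + y) + a * y ^ 2) - a * x ^ 6 := by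
    have : a * y ^ 2 = (a * A) * A * x ^ 4 - 2 * (a * A) * e * x ^ 5 + a * e ^ 2 * x ^ 6 := by
      rw [hy]; ring
    rw [this, haA, he]
    ring
  have h5 : D * x ^ 6 ≤ x ^ 5 / 4 := by
    have : x * (4 * D) * x ^ 5 ≤ 1 * x ^ 5 := mul_le_mul_of_nonneg_right hx3 (by positivity)
    nlinarith
  rw [h3]
  calc |F (p + y) + a * y ^ 2 - a * x ^ 6| ≤ |F (p + y) + a * y ^ 2| + |a * x ^ 6| := abs_sub _ _
    _ ≤ K * (A + 1) ^ 3 * x ^ 6 + a * x ^ 6 := by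
        rw [abs_of_pos (by positivity : 0 < a * x ^ 6)]
        linarith
    _ = D * x ^ 6 := by rw [hD]; ring
    _ ≤ _ := h5

lemma tendsto_inv_sqrt_sub (B : ℝ) : Tendsto (fun s => (√(B - s))⁻¹) atBot (𝓝 0) :=
  (Real.tendsto_sqrt_atTop.comp (tendsto_atTop_add_const_left _ B tendsto_neg_atBot_atTop)
    |>.congr fun s => by simp [sub_eq_add_neg]).inv_tendsto_atTop

lemma tendsto_inv_sqrt_sub' (s : ℝ) : Tendsto (fun B => (√(B - s))⁻¹) atTop (𝓝 0) :=
  (Real.tendsto_sqrt_atTop.comp (tendsto_atTop_add_const_right _ (-s) tendsto_id)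
    |>.congr fun s => by simp [sub_eq_add_neg]).inv_tendsto_atTop

lemma tendsto_log_sub_sub_log_sub (s c : ℝ) :
    Tendsto (fun B => Real.log (B - s) - Real.log (B - c)) atTop (𝓝 0) := by
  have h1 : Tendsto (fun B => 1 + (c - s) / (B - c)) atTop (𝓝 (1 + 0)) :=
    (tendsto_const_nhds.div_atTop (tendsto_atTop_add_const_right _ (-c) tendsto_id)).const_add 1
  have h2 := h1.log (by norm_num)
  simp only [add_zero, Real.log_one] at h2
  refine h2.congr' ?_
  filter_upwards [eventually_gt_atTop s, eventually_gt_atTop c] with B h3 h4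
  have h5 : 0 < B - s := by linarith
  have h6 : 0 < B - c := by linarith
  rw [← Real.log_div h5.ne' h6.ne']
  congr 1
  field_simp
  ring

/-- Exponential decay beats the residual of the corrected profile. -/
lemma eventually_exp_lt_inv_sqrt_pow {σ : ℝ} (hσ : 0 < σ) (T : ℝ) :
    ∀ᶠ s in atBot, Real.exp (σ * s) < (√(T - s))⁻¹ ^ 5 / 4 := by
  have h1 := tendsto_rpow_mul_exp_neg_mul_atTop_nhds_zero (5 / 2) σ hσ
  have h2 : Tendsto (fun s : ℝ => T - s) atBot atTop :=
    (tendsto_atTop_add_const_left _ T tendsto_neg_atBot_atTop)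
  filter_upwards [(h1.comp h2).eventually
    (gt_mem_nhds (by positivity : 0 < Real.exp (-(σ * T)) / 4)), h2.eventually_gt_atTop 0]
    with s hs hs0
  have hr : 0 < √(T - s) := Real.sqrt_pos.2 hs0
  have e1 : (T - s) ^ (5 / 2 : ℝ) = √(T - s) ^ 5 := by
    rw [Real.sqrt_eq_rpow, ← Real.rpow_natCast, ← Real.rpow_mul hs0.le]
    norm_num
  have e2 : Real.exp (-σ * (T - s)) = Real.exp (-(σ * T)) * Real.exp (σ * s) := by
    rw [← Real.exp_add]; congr 1; ring
  simp only [Function.comp_apply, e1, e2] at hs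
  rw [inv_pow, inv_eq_one_div, div_div, lt_div_iff₀ (by positivity)]
  have := Real.exp_pos (-(σ * T))
  by_contra hcon
  push Not at hcon
  nlinarith [mul_le_mul_of_nonneg_left hcon this.le]

namespace IsEnvelope

variable {F m M : ℝ → ℝ} {b κ s₀ : ℝ}

/-- The dichotomy is resolved with a logarithmic correction when the two roots coincide. -/
lemma exists_tendsto_of_double_root (h : IsEnvelope F b κ s₀ m M)
    {p σ C₀ a K y₀ : ℝ} (hσ : 0 < σ) (hbp : b < p) (ha : 0 < a) (hy₀ : 0 < y₀) (hK : 0 ≤ K)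
    (hF : ∀ y, |y| ≤ y₀ → |F (p + y) + a * y ^ 2| ≤ K * |y| ^ 3)
    (hE : ∀ᶠ s in atBot, Real.exp (κ * (m s - b * s)) ≤ Real.exp (σ * s))
    (hgap : ∀ᶠ s in atBot, M s ≤ m s + C₀)
    (hmono : ∀ q, b ≤ q → q < p → ∃ c, MonotoneOn (fun s => m s - q * s) (Set.Iic c))
    (hm : Tendsto (fun s => m s - p * s) atBot atTop) :
    ∃ l, Tendsto (fun s => M s - (p * s + a⁻¹ * Real.log (-s))) atBot (𝓝 l) := by
  obtain ⟨x₀, hx₀, hx⟩ := exists_profile_estimate ha hy₀ hK hF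
  have hA0 : 0 < a⁻¹ := inv_pos.2 ha
  set A := a⁻¹
  set T := (x₀⁻¹) ^ 2 with hT
  have hT0 : 0 < T := by positivity
  have hxT : ∀ t, T ≤ t → 0 < (√t)⁻¹ ∧ (√t)⁻¹ ≤ x₀ := fun t ht => by
    have h1 : x₀⁻¹ ≤ √t := Real.le_sqrt_of_sq_le ht
    exact ⟨inv_pos.2 ((inv_pos.2 hx₀).trans_le h1), inv_le_of_inv_le₀ hx₀ h1⟩
  have hsup : ∀ B s, T ≤ B - s → -A * (√(B - s))⁻¹ ^ 4 + 3 / 2 * 1 * (√(B - s))⁻¹ ^ 5 <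
      F (p + (-A * (√(B - s))⁻¹ ^ 2 + 1 * (√(B - s))⁻¹ ^ 3)) := fun B s hBs => by
    obtain ⟨h1, h2⟩ := hxT _ hBs
    have h3 := (abs_le.1 (hx _ h1 h2 1 (by norm_num))).1
    have : 0 < (√(B - s))⁻¹ ^ 5 := by positivity
    linarith
  have hsub : ∀ B s, T ≤ B - s → F (p + (-A * (√(B - s))⁻¹ ^ 2 + -1 * (√(B - s))⁻¹ ^ 3)) +
      (√(B - s))⁻¹ ^ 5 / 4 ≤ -A * (√(B - s))⁻¹ ^ 4 + 3 / 2 * -1 * (√(B - s))⁻¹ ^ 5 :=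
    fun B s hBs => by
    obtain ⟨h1, h2⟩ := hxT _ hBs
    have h3 := (abs_le.1 (hx _ h1 h2 (-1) (by norm_num))).2
    linarith
  set c₁ := min (s₀ - 1) (-T) with hc₁
  have hc₁s : c₁ ≤ s₀ - 1 := min_le_left _ _
  have hc₁T : c₁ ≤ -T := min_le_right _ _
  rcases tendsto_atBot_of_quasiconvex (h.upper_quasiconvex (c := c₁)
    (hasTwoDerivs_logProfile p A 1 0) (fun s hs => Set.mem_Iio.2 (by
      have : s ≤ c₁ := hs
      linarith)) (by linarith) fun s hs => by
        linarith [hsup 0 s (by linarith), Real.exp_pos (κ * (M s - b * s))]) with h1 | h1 | h1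
  · exfalso
    have key : ∀ s ≤ c₁, M s - p * s ≤ M c₁ - p * c₁ := fun s hs => by
      have key : ∀ B ≥ 0, M s - logProfile p A 1 B s ≤ M c₁ - logProfile p A 1 B c₁ :=
        fun B hB => by
        refine h.upper_Iic (hasTwoDerivs_logProfile p A 1 B) (fun s hs => Set.mem_Iio.2 (by
          have : s ≤ c₁ := hs
          linarith)) (by linarith) (fun r hr => by
            linarith [hsup B r (by linarith), Real.exp_pos (κ * (M r - b * r))]) ?_ hs
        refine tendsto_atBot_mono' _ ?_ (tendsto_atBot_add_const_right _ (2 * x₀) h1)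
        filter_upwards [eventually_le_atBot (-T)] with r hr
        obtain ⟨h2, h3⟩ := hxT (0 - r) (by linarith)
        obtain ⟨h4, h5⟩ := hxT (B - r) (by linarith)
        have h6 : Real.log (0 - r) ≤ Real.log (B - r) :=
          Real.log_le_log (by linarith) (by linarith)
        have h7 := mul_le_mul_of_nonneg_left h6 hA0.le
        unfold logProfile
        linarith
      have hlim := (((tendsto_log_sub_sub_log_sub s c₁).const_mul A).add
        (((tendsto_inv_sqrt_sub' s).sub (tendsto_inv_sqrt_sub' c₁)).const_mul 2)).const_add
          (p * (s - c₁))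
      have := ge_of_tendsto hlim (b := M s - M c₁) (by
        filter_upwards [eventually_ge_atTop 0] with B hB
        have := key B hB
        unfold logProfile at this
        linarith)
      linarith
    obtain ⟨s, hs1, hs2⟩ := ((hm.eventually_gt_atTop (M c₁ - p * c₁)).and
      (eventually_le_atBot c₁)).exists
    linarith [key s hs2, h.le s (by linarith)]
  · exfalso
    have hinc : ∀ᶠ c in atBot, m c - m (c - T) ≤ p * T - A * Real.log 2 := by
      obtain ⟨c₂, hc₂⟩ := eventually_atBot.1
        (hE.and (eventually_exp_lt_inv_sqrt_pow hσ T))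
      filter_upwards [eventually_le_atBot c₂, eventually_le_atBot c₁] with c hc hc'
      have key := h.lower_Iic (hasTwoDerivs_logProfile p A (-1) (c + T)) (fun s hs =>
        Set.mem_Iio.2 (by
          have : s ≤ c := hs
          linarith)) (by linarith) (fun r hr => ?_) ?_ (by linarith : c - T ≤ c)
      · have e1 : c + T - c = T := by ring
        have e2 : c + T - (c - T) = 2 * T := by ring
        unfold logProfile at key
        rw [e1, e2, Real.log_mul two_ne_zero hT0.ne'] at key
        have e3 : (√(2 * T))⁻¹ ≤ (√T)⁻¹ :=
          inv_anti₀ (Real.sqrt_pos.2 hT0) (Real.sqrt_le_sqrt (by linarith))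
        linarith
      · have h2 := hsub (c + T) r (by linarith)
        obtain ⟨h3, h4⟩ := hc₂ r (hr.trans hc)
        have h5 : (√(T - r))⁻¹ ≤ (√(c + T - r))⁻¹ :=
          inv_anti₀ (Real.sqrt_pos.2 (by linarith)) (Real.sqrt_le_sqrt (by linarith))
        have h6 := pow_le_pow_left₀ (by positivity) h5 5
        linarith
      · refine tendsto_atTop_mono' _ ?_ (tendsto_atTop_add_const_right _ (-C₀) h1)
        filter_upwards [hgap, eventually_le_atBot (c₁), eventually_lt_atBot c] with r hr hr2 hr3
        have h6 : Real.log (c + T - r) ≤ Real.log (0 - r) :=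
          Real.log_le_log (by linarith) (by linarith)
        have h7 := mul_le_mul_of_nonneg_left h6 hA0.le
        have h8 : 0 ≤ (√(0 - r))⁻¹ := by positivity
        have h9 : 0 ≤ (√(c + T - r))⁻¹ := by positivity
        unfold logProfile
        linarith
    refine not_increment_le hmono hbp hT0 ?_ hinc
    have := mul_pos hA0 (Real.log_pos one_lt_two)
    linarith
  · obtain ⟨l, hl⟩ := h1
    have := hl.add ((tendsto_inv_sqrt_sub 0).const_mul 2)
    refine ⟨l + 2 * 0, this.congr fun s => ?_⟩
    unfold logProfile
    rw [zero_sub]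
    ring

end IsEnvelope

lemma slopeFun_eq_neg_fRho (ρ lam τ p : ℝ) : slopeFun ρ lam τ p = -fRho ρ lam τ (-p) := by
  unfold slopeFun fRho
  rw [abs_neg]
  ring

lemma continuous_slopeFun {ρ lam τ : ℝ} (hτ1 : τ < 1) : Continuous (slopeFun ρ lam τ) := by
  unfold slopeFun
  have : Continuous fun p : ℝ => |p| ^ (1 - τ) :=
    continuous_abs.rpow_const fun _ => Or.inr (by linarith)
  fun_prop

/-- The quotient `F(p) / p` for positive slopes. -/
def slopeQuot (ρ lam τ p : ℝ) : ℝ := 2 * ρ - p - lam * p ^ (-τ)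

lemma slopeFun_eq_mul_slopeQuot {ρ lam τ p : ℝ} (hp : 0 < p) :
    slopeFun ρ lam τ p = p * slopeQuot ρ lam τ p := by
  unfold slopeFun slopeQuot
  rw [abs_of_pos hp, sub_eq_add_neg 1 τ, Real.rpow_add hp, Real.rpow_one]
  ring

/-- Tangent line inequality for negative powers. -/
lemma one_sub_mul_le_rpow_neg {τ x : ℝ} (hτ0 : 0 ≤ τ) (hx : 0 < x) :
    1 - τ * (x - 1) ≤ x ^ (-τ) := by
  rw [Real.rpow_def_of_pos hx]
  have h1 := Real.add_one_le_exp (Real.log x * -τ)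
  have h2 := Real.log_le_sub_one_of_pos hx
  nlinarith

lemma one_sub_mul_lt_rpow_neg {τ x : ℝ} (hτ0 : 0 < τ) (hx : 0 < x) (hx1 : x ≠ 1) :
    1 - τ * (x - 1) < x ^ (-τ) := by
  rw [Real.rpow_def_of_pos hx]
  have h1 := Real.add_one_le_exp (Real.log x * -τ)
  have h2 := Real.log_lt_sub_one_of_pos hx hx1
  nlinarith

lemma slopeQuot_le_tangent {ρ lam τ x y : ℝ} (hlam : 0 ≤ lam) (hτ0 : 0 ≤ τ) (hx : 0 < x)
    (hy : 0 < y) : slopeQuot ρ lam τ x ≤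
      slopeQuot ρ lam τ y + (-1 + lam * τ * (y ^ (-τ) / y)) * (x - y) := by
  have h1 := one_sub_mul_le_rpow_neg hτ0 (div_pos hx hy)
  rw [Real.div_rpow hx.le hy.le] at h1
  have hyp : 0 < y ^ (-τ) := Real.rpow_pos_of_pos hy _
  rw [le_div_iff₀ hyp] at h1
  have h2 := mul_le_mul_of_nonneg_left h1 hlam
  unfold slopeQuot
  have e : lam * ((1 - τ * (x / y - 1)) * y ^ (-τ)) =
      lam * y ^ (-τ) - lam * τ * (y ^ (-τ) / y) * (x - y) := by
    field_simp
  linarith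

lemma slopeQuot_concave {ρ lam τ x y z : ℝ} (hlam : 0 ≤ lam) (hτ0 : 0 ≤ τ) (hx : 0 < x)
    (hxy : x ≤ y) (hyz : y ≤ z) :
    slopeQuot ρ lam τ x * (z - y) + slopeQuot ρ lam τ z * (y - x) ≤
      slopeQuot ρ lam τ y * (z - x) := by
  have h1 := slopeQuot_le_tangent (ρ := ρ) hlam hτ0 hx (hx.trans_le hxy)
  have h2 := slopeQuot_le_tangent (ρ := ρ) hlam hτ0 ((hx.trans_le hxy).trans_le hyz)
    (hx.trans_le hxy)
  nlinarith [mul_le_mul_of_nonneg_right h1 (sub_nonneg.2 hyz),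
    mul_le_mul_of_nonneg_right h2 (sub_nonneg.2 hxy)]

/-- `F` is negative between `0` and the smallest positive root. -/
lemma slopeFun_neg_of_lt {ρ lam τ w2 : ℝ} (hlam : 0 < lam) (hτ0 : 0 < τ) (hτ1 : τ < 1)
    (hw2 : IsMaxNegRoot ρ lam τ w2) {p : ℝ} (hp : 0 < p) (hp2 : p < -w2) :
    slopeFun ρ lam τ p < 0 := by
  have hne : ∀ r, 0 < r → r < -w2 → slopeFun ρ lam τ r ≠ 0 := fun r hr hr2 h0 => by
    rw [slopeFun_eq_neg_fRho, neg_eq_zero] at h0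
    linarith [hw2.2.2 (-r) (by linarith) h0]
  by_contra hcon
  push Not at hcon
  obtain ⟨ε, ⟨hε1, hε2⟩, hε3⟩ : ∃ ε, (0 < ε ∧ ε < p) ∧ slopeFun ρ lam τ ε < 0 := by
    have h1 : Tendsto (fun ε : ℝ => ε ^ (-τ)) (𝓝[>] 0) atTop :=
      tendsto_rpow_neg_nhdsGT_zero (by linarith)
    obtain ⟨ε, h3, h4⟩ := ((h1.eventually_gt_atTop (2 * ρ / lam)).and
      (Ioo_mem_nhdsGT hp)).exists
    refine ⟨ε, h4, ?_⟩
    rw [slopeFun_eq_mul_slopeQuot h4.1]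
    rw [div_lt_iff₀ hlam] at h3
    unfold slopeQuot
    nlinarith [h4.1]
  obtain ⟨r, hr, hr0⟩ := intermediate_value_Icc hε2.le
    (continuous_slopeFun (ρ := ρ) (lam := lam) hτ1).continuousOn ⟨hε3.le, hcon⟩
  exact hne r (hε1.trans_le hr.1) (hr.2.trans_lt hp2) hr0

/-- `F` is negative above the largest positive root. -/
lemma slopeFun_neg_of_gt {ρ lam τ w1 : ℝ} (hlam : 0 < lam) (hτ1 : τ < 1)
    (hw1 : IsMinNegRoot ρ lam τ w1) {p : ℝ} (hp1 : -w1 < p) :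
    slopeFun ρ lam τ p < 0 := by
  have hw : 0 < -w1 := neg_pos.2 hw1.1
  have hne : ∀ r, -w1 < r → slopeFun ρ lam τ r ≠ 0 := fun r hr h0 => by
    rw [slopeFun_eq_neg_fRho, neg_eq_zero] at h0
    linarith [hw1.2.2 (-r) (by linarith) h0]
  by_contra hcon
  push Not at hcon
  set Q := max p (2 * ρ) with hQ
  have hpQ : p ≤ Q := le_max_left _ _
  have hQ0 : slopeFun ρ lam τ Q < 0 := by
    have h1 : 2 * ρ ≤ Q := le_max_right _ _
    have h2 : 0 < Q := by linarith
    rw [slopeFun_eq_mul_slopeQuot h2]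
    have h3 : 0 < lam * Q ^ (-τ) := mul_pos hlam (Real.rpow_pos_of_pos h2 _)
    unfold slopeQuot
    nlinarith
  obtain ⟨r, hr, hr0⟩ := intermediate_value_Icc' hpQ
    (continuous_slopeFun (ρ := ρ) (lam := lam) hτ1).continuousOn ⟨hQ0.le, hcon⟩
  exact hne r (hp1.trans_le hr.1) hr0

/-- The critical slope `(λτ)^(1/(τ+1))`. -/
lemma criticalSlope_facts {lam τ : ℝ} (hlam : 0 < lam) (hτ0 : 0 < τ) :
    ∃ p, 0 < p ∧ lam * τ * p ^ (-τ) = p ∧ ∀ ρ x, 0 < x →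
      slopeQuot ρ lam τ p = 2 * (ρ - Upsilon lam τ) ∧
      (x ≠ p → slopeQuot ρ lam τ x < 2 * (ρ - Upsilon lam τ)) := by
  set p := (lam * τ) ^ (1 / (τ + 1)) with hp
  have hlt : 0 < lam * τ := by positivity
  have hp0 : 0 < p := Real.rpow_pos_of_pos hlt _
  have h1 : p ^ (τ + 1) = lam * τ := by
    rw [hp, ← Real.rpow_mul hlt.le, one_div_mul_cancel (by positivity), Real.rpow_one]
  have h2 : lam * τ * p ^ (-τ) = p := by
    rw [← h1, ← Real.rpow_add hp0]
    simp
  have hU : 2 * Upsilon lam τ = p + p / τ := by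
    unfold Upsilon
    rw [← hp]
    field_simp
  have h3 : lam * p ^ (-τ) = p / τ := by
    rw [eq_div_iff hτ0.ne']
    linarith
  refine ⟨p, hp0, h2, fun ρ x hx => ⟨?_, fun hxp => ?_⟩⟩
  · unfold slopeQuot
    linarith
  · have h4 := one_sub_mul_lt_rpow_neg hτ0 (div_pos hx hp0)
      (fun h => hxp ((div_eq_one_iff_eq hp0.ne').1 h))
    rw [Real.div_rpow hx.le hp0.le, lt_div_iff₀ (Real.rpow_pos_of_pos hp0 _)] at h4
    have h5 := mul_lt_mul_of_pos_left h4 hlam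
    have h6 : lam * ((1 - τ * (x / p - 1)) * p ^ (-τ)) = p / τ - (x - p) := by
      rw [show lam * ((1 - τ * (x / p - 1)) * p ^ (-τ)) =
        (1 - τ * (x / p - 1)) * (lam * p ^ (-τ)) by ring, h3]
      field_simp
    unfold slopeQuot
    linarith

/-- Lower and upper estimates of `F` at two simple roots. -/
lemma exists_slopeFun_simple {ρ lam τ w1 w2 : ℝ} (hlam : 0 < lam) (hτ0 : 0 < τ) (hτ1 : τ < 1)
    (hρ : Upsilon lam τ < ρ) (hw1 : IsMinNegRoot ρ lam τ w1) (hw2 : IsMaxNegRoot ρ lam τ w2) :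
    -w2 < -w1 ∧ ∃ c₀ γ₁ y₀ : ℝ, 0 < c₀ ∧ 0 < γ₁ ∧ 0 < y₀ ∧
      (∀ p ∈ Set.Icc (-w2) (-w1), c₀ * ((p - -w2) * (-w1 - p)) ≤ slopeFun ρ lam τ p) ∧
      ∀ y, 0 ≤ y → y ≤ y₀ → slopeFun ρ lam τ (-w2 - y) ≤ -(γ₁ * y) := by
  obtain ⟨r, hr0, -, hr⟩ := criticalSlope_facts hlam hτ0
  have hkr := (hr ρ 1 one_pos).1
  have hk0 : 0 < slopeQuot ρ lam τ r := by linarith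
  have hFr : 0 < slopeFun ρ lam τ r := by
    rw [slopeFun_eq_mul_slopeQuot hr0]
    positivity
  have hp2 : 0 < -w2 := neg_pos.2 hw2.1
  have hF2 : slopeFun ρ lam τ (-w2) = 0 := by rw [slopeFun_eq_neg_fRho, neg_neg, hw2.2.1, neg_zero]
  have hF1 : slopeFun ρ lam τ (-w1) = 0 := by rw [slopeFun_eq_neg_fRho, neg_neg, hw1.2.1, neg_zero]
  have h2r : -w2 < r := by
    refine lt_of_le_of_ne ?_ fun h => by rw [h] at hF2; linarith
    by_contra hcon
    linarith [slopeFun_neg_of_lt hlam hτ0 hτ1 hw2 hr0 (not_le.1 hcon)]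
  have hr1 : r < -w1 := by
    refine lt_of_le_of_ne ?_ fun h => by rw [← h] at hF1; linarith
    by_contra hcon
    linarith [slopeFun_neg_of_gt hlam hτ1 hw1 (not_le.1 hcon)]
  have hk2 : slopeQuot ρ lam τ (-w2) = 0 := by
    rw [slopeFun_eq_mul_slopeQuot hp2] at hF2
    exact (mul_eq_zero.1 hF2).resolve_left hp2.ne'
  have hk1 : slopeQuot ρ lam τ (-w1) = 0 := by
    have h : 0 < -w1 := by linarith
    rw [slopeFun_eq_mul_slopeQuot h] at hF1
    exact (mul_eq_zero.1 hF1).resolve_left h.ne'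
  generalize -w2 = p₂ at *
  generalize -w1 = p₁ at *
  set κ := slopeQuot ρ lam τ r
  have hD : 0 < p₁ - p₂ := by linarith
  refine ⟨by linarith, p₂ * (κ / ((p₁ - p₂) * (p₁ - p₂))), p₂ / 2 * (κ / (r - p₂)), p₂ / 2,
    by positivity, ?_, by positivity, fun p hp => ?_, fun y hy hy2 => ?_⟩
  · have : 0 < r - p₂ := by linarith
    positivity
  · have hp0 : 0 < p := hp2.trans_le hp.1
    rw [slopeFun_eq_mul_slopeQuot hp0]
    have hk : κ * ((p - p₂) * (p₁ - p)) ≤ slopeQuot ρ lam τ p * ((p₁ - p₂) * (p₁ - p₂)) := by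
      have hk0' : 0 ≤ κ := hk0.le
      rcases le_total p r with hpr | hpr
      · have h1 := slopeQuot_concave (ρ := ρ) hlam.le hτ0.le hp2 hp.1 hpr
        rw [hk2] at h1
        have h2 : κ * (p - p₂) ≤ slopeQuot ρ lam τ p * (r - p₂) := by linarith
        have h3 : 0 ≤ slopeQuot ρ lam τ p := by
          by_contra hcon
          nlinarith [mul_nonneg hk0' (sub_nonneg.2 hp.1)]
        have h4 : κ * (p - p₂) ≤ slopeQuot ρ lam τ p * (p₁ - p₂) :=
          h2.trans (mul_le_mul_of_nonneg_left (by linarith) h3)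
        have h5 : κ * (p - p₂) * (p₁ - p) ≤ κ * (p - p₂) * (p₁ - p₂) :=
          mul_le_mul_of_nonneg_left (by linarith [hp.1]) (mul_nonneg hk0' (by linarith [hp.1]))
        have h6 := mul_le_mul_of_nonneg_right h4 hD.le
        nlinarith
      · have h1 := slopeQuot_concave (ρ := ρ) hlam.le hτ0.le hr0 hpr hp.2
        rw [hk1] at h1
        have h2 : κ * (p₁ - p) ≤ slopeQuot ρ lam τ p * (p₁ - r) := by linarith
        have h3 : 0 ≤ slopeQuot ρ lam τ p := by
          by_contra hcon
          nlinarith [mul_nonneg hk0' (sub_nonneg.2 hp.2)]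
        have h4 : κ * (p₁ - p) ≤ slopeQuot ρ lam τ p * (p₁ - p₂) :=
          h2.trans (mul_le_mul_of_nonneg_left (by linarith) h3)
        have h5 : κ * (p₁ - p) * (p - p₂) ≤ κ * (p₁ - p) * (p₁ - p₂) :=
          mul_le_mul_of_nonneg_left (by linarith [hp.2]) (mul_nonneg hk0' (by linarith [hp.2]))
        have h6 := mul_le_mul_of_nonneg_right h4 hD.le
        nlinarith
    have hk' : κ / ((p₁ - p₂) * (p₁ - p₂)) * ((p - p₂) * (p₁ - p)) ≤ slopeQuot ρ lam τ p := by
      rw [div_mul_eq_mul_div, div_le_iff₀ (by positivity)]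
      exact hk
    have h0 : 0 ≤ κ / ((p₁ - p₂) * (p₁ - p₂)) * ((p - p₂) * (p₁ - p)) :=
      mul_nonneg (by positivity) (mul_nonneg (by linarith [hp.1]) (by linarith [hp.2]))
    rw [mul_assoc]
    exact mul_le_mul hp.1 hk' h0 hp0.le
  · have hp0 : 0 < p₂ - y := by linarith
    rw [slopeFun_eq_mul_slopeQuot hp0]
    have h1 := slopeQuot_concave (ρ := ρ) hlam.le hτ0.le hp0 (by linarith : p₂ - y ≤ p₂) h2r.le
    rw [hk2] at h1
    have hrp : 0 < r - p₂ := by linarith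
    have h2 : slopeQuot ρ lam τ (p₂ - y) ≤ -(κ / (r - p₂) * y) := by
      rw [div_mul_eq_mul_div, ← neg_div, le_div_iff₀ hrp]
      linarith
    have h3 : 0 ≤ κ / (r - p₂) * y := by positivity
    nlinarith

/-- Integrating a polynomial derivative bound from the origin. -/
lemma abs_le_pow_succ_of_hasDerivAt {f f' : ℝ → ℝ} {δ K : ℝ} {n : ℕ} (hK : 0 ≤ K)
    (hf : ∀ y, |y| ≤ δ → HasDerivAt f (f' y) y) (hf' : ∀ y, |y| ≤ δ → |f' y| ≤ K * |y| ^ n)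
    (h0 : f 0 = 0) (y : ℝ) (hy : |y| ≤ δ) : |f y| ≤ K * |y| ^ (n + 1) := by
  have hmem : ∀ x ∈ Set.Icc (-|y|) |y|, |x| ≤ |y| := fun x hx => abs_le.2 hx
  have := (convex_Icc (-|y|) |y|).norm_image_sub_le_of_norm_hasDerivWithin_le (f := f) (f' := f')
    (C := K * |y| ^ n) (x := 0) (y := y)
    (fun x hx => (hf x ((hmem x hx).trans hy)).hasDerivWithinAt)
    (fun x hx => (hf' x ((hmem x hx).trans hy)).trans
      (mul_le_mul_of_nonneg_left (pow_le_pow_left₀ (abs_nonneg x) (hmem x hx) n) hK))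
    ⟨by simp, abs_nonneg y⟩ ⟨neg_abs_le y, le_abs_self y⟩
  rw [h0, sub_zero, sub_zero, Real.norm_eq_abs, Real.norm_eq_abs] at this
  rw [pow_succ, ← mul_assoc]
  exact this

/-- Expansion of `F` at a double root. -/
lemma exists_slopeFun_double {lam τ w1 w2 : ℝ} (hlam : 0 < lam) (hτ0 : 0 < τ) (hτ1 : τ < 1)
    (hw1 : IsMinNegRoot (Upsilon lam τ) lam τ w1)
    (hw2 : IsMaxNegRoot (Upsilon lam τ) lam τ w2) :
    w1 = w2 ∧ ∃ K y₀ : ℝ, 0 ≤ K ∧ 0 < y₀ ∧ ∀ y, |y| ≤ y₀ →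
      |slopeFun (Upsilon lam τ) lam τ (-w2 + y) + (1 + τ) / 2 * y ^ 2| ≤ K * |y| ^ 3 := by
  obtain ⟨p, hp0, hpe, hp⟩ := criticalSlope_facts hlam hτ0
  have hk := fun x hx => (hp (Upsilon lam τ) x hx).2
  have hkp := (hp (Upsilon lam τ) 1 one_pos).1
  rw [sub_self, mul_zero] at hk hkp
  have hroot : ∀ w, w < 0 → fRho (Upsilon lam τ) lam τ w = 0 → -w = p := fun w hw hw0 => by
    by_contra hne
    have h1 := hk (-w) (by linarith) hne
    have h2 : slopeFun (Upsilon lam τ) lam τ (-w) = 0 := by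
      rw [slopeFun_eq_neg_fRho, neg_neg, hw0, neg_zero]
    rw [slopeFun_eq_mul_slopeQuot (by linarith)] at h2
    nlinarith
  have e1 := hroot w1 hw1.1 hw1.2.1
  have e2 := hroot w2 hw2.1 hw2.2.1
  refine ⟨by linarith, ?_⟩
  rw [e2]
  set ρ := Upsilon lam τ
  have hpτ : 0 < p ^ (-τ) := Real.rpow_pos_of_pos hp0 _
  have hρ : 2 * ρ = p + lam * p ^ (-τ) := by unfold slopeQuot at hkp; linarith
  set f : ℝ → ℝ := fun y => 2 * ρ * (p + y) - (p + y) ^ 2 - lam * (p + y) ^ (1 - τ)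
    + (1 + τ) / 2 * y ^ 2
  set f1 : ℝ → ℝ := fun y => 2 * ρ - 2 * (p + y) - lam * ((1 - τ) * (p + y) ^ (-τ)) + (1 + τ) * y
  set f2 : ℝ → ℝ := fun y => -2 + lam * ((1 - τ) * (τ * (p + y) ^ (-τ - 1))) + (1 + τ)
  set f3 : ℝ → ℝ := fun y => lam * ((1 - τ) * (τ * ((-τ - 1) * (p + y) ^ (-τ - 1 - 1))))
  set K := lam * ((1 - τ) * (τ * ((τ + 1) * (p / 2) ^ (-τ - 1 - 1)))) with hK
  have hK0 : 0 ≤ K := by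
    have : 0 < 1 - τ := by linarith
    positivity
  have hpy : ∀ y, |y| ≤ p / 2 → p / 2 ≤ p + y := fun y hy => by linarith [(abs_le.1 hy).1]
  have hr : ∀ (α : ℝ) y, |y| ≤ p / 2 →
      HasDerivAt (fun y => (p + y) ^ α) (α * (p + y) ^ (α - 1)) y := fun α y hy => by
    have h1 : HasDerivAt (fun y => p + y) 1 y := (hasDerivAt_id y).const_add p
    convert! h1.rpow_const (p := α) (Or.inl (by linarith [hpy y hy])) using 1
    ring
  have hf : ∀ y, |y| ≤ p / 2 → HasDerivAt f (f1 y) y := fun y hy => by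
    have h1 : HasDerivAt (fun y => p + y) 1 y := (hasDerivAt_id y).const_add p
    convert! (((h1.const_mul (2 * ρ)).sub (h1.pow 2)).sub ((hr (1 - τ) y hy).const_mul lam)).add
      (((hasDerivAt_id y).pow 2).const_mul ((1 + τ) / 2)) using 1
    have : 1 - τ - 1 = -τ := by ring
    simp only [f1, this, id, Nat.cast_ofNat]
    ring
  have hf1 : ∀ y, |y| ≤ p / 2 → HasDerivAt f1 (f2 y) y := fun y hy => by
    have h1 : HasDerivAt (fun y => p + y) 1 y := (hasDerivAt_id y).const_add p
    convert! (((h1.const_mul 2).const_sub (2 * ρ)).sub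
      (((hr (-τ) y hy).const_mul (1 - τ)).const_mul lam)).add
      ((hasDerivAt_id y).const_mul (1 + τ)) using 1
    simp only [f2]
    ring
  have hf2 : ∀ y, |y| ≤ p / 2 → HasDerivAt f2 (f3 y) y := fun y hy => by
    convert! (((((hr (-τ - 1) y hy).const_mul τ).const_mul (1 - τ)).const_mul lam).const_add
      (-2)).add_const (1 + τ) using 1
  have hf3 : ∀ y, |y| ≤ p / 2 → |f3 y| ≤ K * |y| ^ 0 := fun y hy => by
    have h1 : (p + y) ^ (-τ - 1 - 1) ≤ (p / 2) ^ (-τ - 1 - 1) :=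
      Real.rpow_le_rpow_of_nonpos (by positivity) (hpy y hy) (by linarith)
    have h2 : 0 ≤ (p + y) ^ (-τ - 1 - 1) := Real.rpow_nonneg (by linarith [hpy y hy]) _
    have h3 : f3 y = -(lam * (1 - τ) * τ * (τ + 1) * (p + y) ^ (-τ - 1 - 1)) := by
      simp only [f3]; ring
    have h4 : 0 ≤ lam * (1 - τ) * τ * (τ + 1) := by
      have : 0 < 1 - τ := by linarith
      positivity
    rw [h3, abs_neg, abs_of_nonneg (mul_nonneg h4 h2), pow_zero, mul_one, hK]
    calc _ ≤ lam * (1 - τ) * τ * (τ + 1) * (p / 2) ^ (-τ - 1 - 1) :=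
          mul_le_mul_of_nonneg_left h1 h4
      _ = _ := by ring
  have z2 : f2 0 = 0 := by
    simp only [f2, add_zero]
    rw [Real.rpow_sub_one hp0.ne']
    have : lam * ((1 - τ) * (τ * (p ^ (-τ) / p))) = (1 - τ) * ((lam * τ * p ^ (-τ)) / p) := by ring
    rw [this, hpe, div_self hp0.ne']
    ring
  have z1 : f1 0 = 0 := by
    simp only [f1, add_zero, mul_zero]
    nlinarith
  have z0 : f 0 = 0 := by
    simp only [f, add_zero]
    rw [sub_eq_add_neg 1 τ, Real.rpow_add hp0, Real.rpow_one, hρ]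
    ring
  refine ⟨K, p / 2, hK0, by positivity, fun y hy => ?_⟩
  have b2 := abs_le_pow_succ_of_hasDerivAt hK0 hf2 hf3 z2
  have b1 := abs_le_pow_succ_of_hasDerivAt hK0 hf1 b2 z1
  have b0 := abs_le_pow_succ_of_hasDerivAt hK0 hf b1 z0 y hy
  have : slopeFun ρ lam τ (p + y) + (1 + τ) / 2 * y ^ 2 = f y := by
    simp only [slopeFun, f]
    rw [abs_of_pos (by linarith [hpy y hy])]
  rw [this]
  exact b0

section Angular

lemma tendsto_log_norm_nhdsNE {E : Type*} [NormedAddCommGroup E] :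
    Tendsto (fun x : E => Real.log ‖x‖) (𝓝[≠] 0) atBot :=
  Real.tendsto_log_nhdsGT_zero.comp tendsto_norm_nhdsNE_zero

lemma eventually_nhdsNE_iff_logBall {E : Type*} [NormedAddCommGroup E] {P : E → Prop} :
    (∀ᶠ x in 𝓝[≠] (0 : E), P x) ↔ ∃ s, ∀ x ∈ logBall E s, P x := by
  constructor
  · intro h
    rw [eventually_nhdsWithin_iff, Metric.eventually_nhds_iff] at h
    obtain ⟨δ, hδ, h⟩ := h
    refine ⟨Real.log δ, fun x hx => h ?_ (norm_pos_iff.1 hx.1)⟩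
    rw [dist_zero_right]
    exact hx.2.trans_le (Real.exp_log hδ).le
  · rintro ⟨s, h⟩
    filter_upwards [tendsto_log_norm_nhdsNE.eventually (eventually_lt_atBot s),
      self_mem_nhdsWithin] with x hx hx0
    have h0 : 0 < ‖x‖ := norm_pos_iff.2 hx0
    exact h x ⟨h0, (Real.log_lt_iff_lt_exp h0).1 hx⟩

lemma abs_rpow_sub_rpow_le {a v τ : ℝ} (ha : 0 ≤ a) (hv : 0 < v) (hτ0 : 0 ≤ τ) (hτ1 : τ < 1) :
    |a ^ (1 - τ) - v ^ (1 - τ)| ≤ v ^ (-τ) * |a - v| := by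
  obtain ⟨t, ht, rfl⟩ : ∃ t, 0 ≤ t ∧ a = t * v := ⟨a / v, by positivity, by field_simp⟩
  have h1 : |t ^ (1 - τ) - 1| ≤ |t - 1| := by
    rcases le_total 1 t with h | h
    · have h2 := Real.one_le_rpow h (by linarith : 0 ≤ 1 - τ)
      have h3 : t ^ (1 - τ) ≤ t ^ (1 : ℝ) := Real.rpow_le_rpow_of_exponent_le h (by linarith)
      rw [Real.rpow_one] at h3
      rw [abs_of_nonneg (by linarith), abs_of_nonneg (by linarith)]
      linarith
    · have h2 := Real.rpow_le_one ht h (by linarith : 0 ≤ 1 - τ)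
      have h3 : t ≤ t ^ (1 - τ) := by
        rcases ht.eq_or_lt with rfl | h0
        · positivity
        · calc t = t ^ (1 : ℝ) := (Real.rpow_one t).symm
            _ ≤ _ := Real.rpow_le_rpow_of_exponent_ge h0 h (by linarith)
      rw [abs_of_nonpos (by linarith), abs_of_nonpos (by linarith)]
      linarith
  have h4 : v ^ (1 - τ) = v ^ (-τ) * v := by
    rw [show 1 - τ = -τ + 1 by ring, Real.rpow_add_one hv.ne']
  have h5 : (t * v) ^ (1 - τ) - v ^ (1 - τ) = v ^ (-τ) * v * (t ^ (1 - τ) - 1) := by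
    rw [Real.mul_rpow ht hv.le, h4]; ring
  have h6 : t * v - v = v * (t - 1) := by ring
  have h7 : 0 < v ^ (-τ) := Real.rpow_pos_of_pos hv _
  rw [h5, h6, abs_mul, abs_mul v, abs_of_pos (mul_pos h7 hv), abs_of_pos hv, mul_assoc]
  exact mul_le_mul_of_nonneg_left (mul_le_mul_of_nonneg_left h1 hv.le) h7.le

/-- The defect between the logarithmic equation and a radial profile is controlled linearly by
the difference of the gradients. -/
lemma abs_logRhs_sub_radial_le {E : Type*} [NormedAddCommGroup E] [InnerProductSpace ℝ E]
    {n ρ lam τ b κ C p v v₂ : ℝ} {w : E → ℝ} {X : E → E} {x : E} (hτ0 : 0 ≤ τ) (hτ1 : τ < 1)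
    (hx : 0 < ‖x‖) (hC : ‖x‖ * ‖X x‖ ≤ C) (hp : 0 < p) (hv : p / 2 ≤ v) (hv' : v ≤ 2 * p) :
    |logRhs n ρ lam τ b κ w X x - (v₂ + (n - 2) * v) / ‖x‖ ^ 2| ≤
      ((|n - 2 + 2 * ρ| + |lam| * (p / 2) ^ (-τ) + (C + 2 * p)) *
        (‖x‖ * ‖X x - (v / ‖x‖ ^ 2) • x‖) + Real.exp (κ * (w x - b * Real.log ‖x‖))
          + |v₂ - slopeFun ρ lam τ v|) / ‖x‖ ^ 2 := by
  have hv0 : 0 < v := by linarith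
  have ha0 : 0 ≤ ‖x‖ * ‖X x‖ := by positivity
  have hin : ⟪x, X x⟫ = ⟪x, X x - (v / ‖x‖ ^ 2) • x⟫ + v := by
    rw [inner_sub_right, inner_smul_right, real_inner_self_eq_norm_sq]
    field_simp
    ring
  have hY1 : |⟪x, X x - (v / ‖x‖ ^ 2) • x⟫| ≤ ‖x‖ * ‖X x - (v / ‖x‖ ^ 2) • x‖ :=
    abs_real_inner_le_norm _ _
  have hnv : ‖x‖ * ‖(v / ‖x‖ ^ 2) • x‖ = v := by
    rw [norm_smul, Real.norm_of_nonneg (by positivity)]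
    field_simp
  have hav : |‖x‖ * ‖X x‖ - v| ≤ ‖x‖ * ‖X x - (v / ‖x‖ ^ 2) • x‖ := by
    have h := abs_norm_sub_norm_le (X x) ((v / ‖x‖ ^ 2) • x)
    have h2 : ‖x‖ * ‖X x‖ - v = ‖x‖ * (‖X x‖ - ‖(v / ‖x‖ ^ 2) • x‖) := by
      rw [mul_sub, hnv]
    rw [h2, abs_mul, abs_of_pos hx]
    exact mul_le_mul_of_nonneg_left h hx.le
  unfold logRhs
  rw [hin, ← sub_div, abs_div, abs_of_pos (by positivity : 0 < ‖x‖ ^ 2)]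
  refine div_le_div_of_nonneg_right ?_ (by positivity)
  generalize ‖x‖ * ‖X x - (v / ‖x‖ ^ 2) • x‖ = Y at *
  generalize ⟪x, X x - (v / ‖x‖ ^ 2) • x⟫ = i at *
  generalize ‖x‖ * ‖X x‖ = a at *
  have he := Real.exp_pos (κ * (w x - b * Real.log ‖x‖))
  generalize Real.exp (κ * (w x - b * Real.log ‖x‖)) = e at *
  have hY0 : 0 ≤ Y := (abs_nonneg _).trans hav
  have h1 : |(n - 2 + 2 * ρ) * i| ≤ |n - 2 + 2 * ρ| * Y := by
    rw [abs_mul]; exact mul_le_mul_of_nonneg_left hY1 (abs_nonneg _)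
  have h2 : |lam * (a ^ (1 - τ) - v ^ (1 - τ))| ≤ |lam| * (p / 2) ^ (-τ) * Y := by
    rw [abs_mul, mul_assoc]
    refine mul_le_mul_of_nonneg_left ((abs_rpow_sub_rpow_le ha0 hv0 hτ0 hτ1).trans ?_)
      (abs_nonneg _)
    exact mul_le_mul (Real.rpow_le_rpow_of_nonpos (by linarith) hv (by linarith)) hav
      (abs_nonneg _) (by positivity)
  have h3 : |a ^ 2 - v ^ 2| ≤ (C + 2 * p) * Y := by
    rw [show a ^ 2 - v ^ 2 = (a + v) * (a - v) by ring, abs_mul, abs_of_pos (by linarith)]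
    exact mul_le_mul (by linarith) hav (abs_nonneg _) (by linarith)
  have h4 : (n - 2 + 2 * ρ) * (i + v) - lam * a ^ (1 - τ) - a ^ 2 + e - (v₂ + (n - 2) * v)
      = (n - 2 + 2 * ρ) * i - lam * (a ^ (1 - τ) - v ^ (1 - τ)) - (a ^ 2 - v ^ 2) + e
        - (v₂ - slopeFun ρ lam τ v) := by
    simp only [slopeFun, abs_of_pos hv0]; ring
  rw [h4]
  generalize (n - 2 + 2 * ρ) * i = t1 at *
  generalize lam * (a ^ (1 - τ) - v ^ (1 - τ)) = t2 at *
  generalize v₂ - slopeFun ρ lam τ v = t5 at *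
  generalize a ^ 2 - v ^ 2 = t3 at *
  rw [add_mul, add_mul, abs_le]
  have := abs_le.1 h1; have := abs_le.1 h2; have := abs_le.1 h3
  have := neg_abs_le t5; have := le_abs_self t5
  constructor <;> linarith

variable {E : Type*} [NormedAddCommGroup E] [InnerProductSpace ℝ E] [FiniteDimensional ℝ E]
  [MeasurableSpace E] [BorelSpace E]

/-- Harnack estimate on spheres for a positive function with a controlled weak Laplacian. -/
lemma exists_harnack (E : Type*) [NormedAddCommGroup E] [InnerProductSpace ℝ E]
    [FiniteDimensional ℝ E] [MeasurableSpace E] [BorelSpace E]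
    (hdim : 2 ≤ Module.finrank ℝ E) (A : ℝ) (hA : 0 < A) : ∃ K, 0 < K ∧
    ∀ (s : ℝ) (f : E → ℝ) (Y : E → E) (g : E → ℝ), HasWeakLaplacian (logBall E s) f Y g →
      (∀ x ∈ logBall E s, 0 < f x) →
      (∀ x ∈ logBall E s, |g x| ≤ A * (‖Y x‖ / ‖x‖ + f x / ‖x‖ ^ 2)) →
      ∀ x ∈ logBall E (s - 1), ‖x‖ * ‖Y x‖ ≤ K * f x ∧ ∀ y, ‖y‖ = ‖x‖ → f x ≤ K * f y := by
  obtain ⟨C, hC, h⟩ := exists_norm_gradient_le_mul E A hA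
  refine ⟨max (6 * C) (Real.exp (8 * (6 * C))), by positivity, fun s f Y g hf hpos hg => ?_⟩
  have hgrad : ∀ x ∈ logBall E (s - 1), ‖x‖ * ‖Y x‖ ≤ 6 * C * f x := by
    intro x hx
    have hx0 := hx.1
    have hsub := closedBall_subset_logBall hx
    have h1 := h (logBall E s) f Y g x (‖x‖ / 6) hf (by positivity) hsub
      (fun y hy => hpos y (hsub hy)) (fun y hy => ?_)
    · linarith
    · have hy2 := (norm_bounds_of_mem_closedBall hy).1
      have hfy := hpos y (hsub hy)
      refine (hg y (hsub hy)).trans (mul_le_mul_of_nonneg_left ?_ hA.le)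
      have h3 : ‖x‖ / 6 ≤ ‖y‖ := by linarith
      have h4 : 0 < ‖x‖ / 6 := by positivity
      exact add_le_add (div_le_div_of_nonneg_left (norm_nonneg _) h4 h3)
        (div_le_div_of_nonneg_left hfy.le (by positivity) (pow_le_pow_left₀ h4.le h3 2))
  intro x hx
  have hsub : logBall E (s - 1) ⊆ logBall E s := fun z hz =>
    ⟨hz.1, hz.2.trans (Real.exp_lt_exp.2 (by linarith))⟩
  have hfx := hpos x (hsub hx)
  refine ⟨(hgrad x hx).trans (mul_le_mul_of_nonneg_right (le_max_left _ _) hfx.le),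
    fun y hy => ?_⟩
  have hz : ∀ z : E, ‖x‖ / 2 ≤ ‖z‖ → ‖z‖ ≤ ‖x‖ → z ∈ logBall E (s - 1) := fun z h1 h2 =>
    ⟨by linarith [hx.1], h2.trans_lt hx.2⟩
  have hyb : y ∈ logBall E (s - 1) := hz y (by linarith [hx.1]) hy.le
  have hfy := hpos y (hsub hyb)
  have hlog := hf.log hpos
  have h1 := abs_sub_le_of_norm_gradient_le hdim (f := fun z => Real.log (f z))
    (X := fun z => (f z)⁻¹ • Y z) (C := 6 * C) hx.1
    (fun z h1 h2 => hlog.grad z (hsub (hz z h1 h2))) (fun z h1 h2 => ?_) rfl hy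
  · have h2 : Real.log (f x) ≤ 8 * (6 * C) + Real.log (f y) := by
      linarith [(abs_le.1 h1).2]
    have h3 := Real.exp_le_exp.2 h2
    rw [Real.exp_add, Real.exp_log hfx, Real.exp_log hfy] at h3
    exact h3.trans (mul_le_mul_of_nonneg_right (le_max_right _ _) hfy.le)
  · have hzb := hz z h1 h2
    have hfz := hpos z (hsub hzb)
    rw [norm_smul, norm_inv, Real.norm_of_nonneg hfz.le]
    calc ‖z‖ * ((f z)⁻¹ * ‖Y z‖) = (‖z‖ * ‖Y z‖) / f z := by ring
      _ ≤ 6 * C := (div_le_iff₀ hfz).2 (hgrad z hzb)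

/-- If `w` approaches a radial profile from one side along the spheres, then it converges to this
profile together with its radial derivative. -/
theorem HasWeakLaplacian.tendsto_of_one_sided (hdim : 2 ≤ Module.finrank ℝ E)
    {ρ lam τ b κ s₀ C p ℓ c e : ℝ} {w : E → ℝ} {X : E → E} {V V₁ V₂ : ℝ → ℝ}
    (H : HasWeakLaplacian (logBall E s₀) w X (logRhs (Module.finrank ℝ E) ρ lam τ b κ w X))
    (hτ0 : 0 ≤ τ) (hτ1 : τ < 1) (hC : ∀ᶠ x in 𝓝[≠] 0, ‖x‖ * ‖X x‖ ≤ C)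
    (hV : HasTwoDerivs (Set.Iio c) V V₁ V₂) (hp : 0 < p) (hV₁ : Tendsto V₁ atBot (𝓝 p))
    (hV₂ : Tendsto (fun s => V₂ s - slopeFun ρ lam τ (V₁ s)) atBot (𝓝 0))
    (hE : Tendsto (fun x => Real.exp (κ * (w x - b * Real.log ‖x‖))) (𝓝[≠] 0) (𝓝 0))
    (he : |e| = 1)
    (hlow : ∀ ε > 0, ∀ᶠ x in 𝓝[≠] 0, -ε ≤ e * (w x - V (Real.log ‖x‖) - ℓ))
    (hup : ∀ ε > 0, ∀ᶠ s in atBot, ∃ y : E, ‖y‖ = Real.exp s ∧ e * (w y - V s - ℓ) ≤ ε) :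
    Tendsto (fun x => w x - V (Real.log ‖x‖)) (𝓝[≠] 0) (𝓝 ℓ) ∧
      Tendsto (fun x => ⟪x, X x⟫ - V₁ (Real.log ‖x‖)) (𝓝[≠] 0) (𝓝 0) := by
  obtain ⟨A₀, hA₀, hA₀'⟩ : ∃ A₀ : ℝ, 0 ≤ A₀ ∧ (|(Module.finrank ℝ E : ℝ) - 2 + 2 * ρ| +
      |lam| * (p / 2) ^ (-τ) + (C + 2 * p)) ≤ A₀ := ⟨_, abs_nonneg _, le_abs_self _⟩
  obtain ⟨K, hK, hharn⟩ := exists_harnack E hdim (A₀ + 1) (by linarith)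
  have key : ∀ ε > 0, ∀ᶠ x in 𝓝[≠] (0 : E), |w x - V (Real.log ‖x‖) - ℓ| ≤ (3 * K + 2) * ε ∧
      |⟪x, X x⟫ - V₁ (Real.log ‖x‖)| ≤ 3 * K ^ 2 * ε := by
    intro ε hε
    have hall : ∀ᶠ x in 𝓝[≠] (0 : E), (x ∈ logBall E s₀ ∧ Real.log ‖x‖ < c) ∧
        ‖x‖ * ‖X x‖ ≤ C ∧
        (p / 2 < V₁ (Real.log ‖x‖) ∧ V₁ (Real.log ‖x‖) < 2 * p) ∧
        |V₂ (Real.log ‖x‖) - slopeFun ρ lam τ (V₁ (Real.log ‖x‖))| < ε / 2 ∧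
        Real.exp (κ * (w x - b * Real.log ‖x‖)) < ε / 2 ∧
        -ε ≤ e * (w x - V (Real.log ‖x‖) - ℓ) ∧
        (∃ y : E, ‖y‖ = Real.exp (Real.log ‖x‖) ∧ e * (w y - V (Real.log ‖x‖) - ℓ) ≤ ε) := by
      have hL := tendsto_log_norm_nhdsNE (E := E)
      refine ((eventually_nhdsNE_iff_logBall.2 ⟨s₀, fun x hx => hx⟩).and
        (hL.eventually (eventually_lt_atBot c))).and (hC.and (Eventually.and ?_ (Eventually.and ?_
        ((hE.eventually (gt_mem_nhds (half_pos hε))).and ((hlow ε hε).and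
          (hL.eventually (hup ε hε)))))))
      · exact (hL.eventually (hV₁.eventually (lt_mem_nhds (half_lt_self hp)))).and
          (hL.eventually (hV₁.eventually (gt_mem_nhds (by linarith))))
      · have := hV₂.abs
        rw [abs_zero] at this
        exact hL.eventually (this.eventually (gt_mem_nhds (half_pos hε)))
    obtain ⟨s, hs⟩ := eventually_nhdsNE_iff_logBall.1 hall
    set Z : E → E := fun x => X x - (V₁ (Real.log ‖x‖) / ‖x‖ ^ 2) • x with hZ
    set f : E → ℝ := fun x => e * (w x - V (Real.log ‖x‖)) + (2 * ε - e * ℓ) with hf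
    have hfe : ∀ x, f x = e * (w x - V (Real.log ‖x‖) - ℓ) + 2 * ε := fun x => by
      simp only [hf]; ring
    have hfW := (((H.mono (isOpen_logBall s) fun x hx => (hs x hx).1.1).sub
      ((hV.hasWeakLaplacian (E := E)).mono (isOpen_logBall s)
        fun x hx => ⟨hx.1, (hs x hx).1.2⟩)).const_mul e).add_const (2 * ε - e * ℓ)
    have hfε : ∀ x ∈ logBall E s, ε ≤ f x := fun x hx => by
      rw [hfe]; linarith [(hs x hx).2.2.2.2.2.1]
    have hh := hharn s f _ _ hfW (fun x hx => hε.trans_le (hfε x hx)) (fun x hx => ?_)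
    · refine eventually_nhdsNE_iff_logBall.2 ⟨s - 1, fun x hx => ?_⟩
      have hxs : x ∈ logBall E s := ⟨hx.1, hx.2.trans (Real.exp_lt_exp.2 (by linarith))⟩
      obtain ⟨h1, h2⟩ := hh x hx
      obtain ⟨y, hy, hy'⟩ := (hs x hxs).2.2.2.2.2.2
      rw [Real.exp_log hx.1] at hy
      have h3 : f y ≤ 3 * ε := by rw [hfe, hy]; linarith
      have h4 : f x ≤ 3 * K * ε := (h2 y hy).trans (by nlinarith)
      have h5 : |w x - V (Real.log ‖x‖) - ℓ| = |f x - 2 * ε| := by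
        rw [hfe, add_sub_cancel_right, abs_mul, he, one_mul]
      refine ⟨?_, ?_⟩
      · have := hfε x hxs
        have : 0 < K * ε := by positivity
        rw [h5, abs_le]; constructor <;> nlinarith
      · have h6 : ⟪x, X x⟫ - V₁ (Real.log ‖x‖) = ⟪x, Z x⟫ := by
          have := hx.1
          simp only [hZ]
          rw [inner_sub_right, inner_smul_right, real_inner_self_eq_norm_sq]
          field_simp
        rw [norm_smul, Real.norm_eq_abs, he, one_mul] at h1
        rw [h6]
        calc |⟪x, Z x⟫| ≤ ‖x‖ * ‖Z x‖ := abs_real_inner_le_norm _ _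
          _ ≤ K * f x := h1
          _ ≤ 3 * K ^ 2 * ε := by nlinarith
    · obtain ⟨-, hCx, ⟨hv, hv'⟩, hr, hEx, -⟩ := hs x hx
      have hx0 := hx.1
      rw [abs_mul, he, one_mul, norm_smul, Real.norm_eq_abs, he, one_mul]
      refine (abs_logRhs_sub_radial_le hτ0 hτ1 hx0 hCx hp hv.le hv'.le).trans ?_
      have h1 := hfε x hx
      have h2 : (A₀ + 1) * (‖Z x‖ / ‖x‖ + f x / ‖x‖ ^ 2)
          = ((A₀ + 1) * (‖x‖ * ‖Z x‖) + (A₀ + 1) * f x) / ‖x‖ ^ 2 := by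
        field_simp
      change _ ≤ (A₀ + 1) * (‖Z x‖ / ‖x‖ + f x / ‖x‖ ^ 2)
      rw [h2]
      refine div_le_div_of_nonneg_right ?_ (by positivity)
      have h3 := mul_le_mul_of_nonneg_right hA₀' (by positivity : 0 ≤ ‖x‖ * ‖Z x‖)
      have h4 : 0 ≤ ‖x‖ * ‖Z x‖ := by positivity
      have h5 : 0 ≤ A₀ * f x := mul_nonneg hA₀ (hε.le.trans h1)
      simp only [hZ] at h3 h4 ⊢
      linarith
  constructor
  · rw [Metric.tendsto_nhds]
    intro δ hδ
    filter_upwards [key (δ / (2 * (3 * K + 2))) (by positivity)] with x hx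
    rw [Real.dist_eq]
    refine hx.1.trans_lt ?_
    field_simp
    linarith
  · rw [Metric.tendsto_nhds]
    intro δ hδ
    filter_upwards [key (δ / (2 * (3 * K ^ 2))) (by positivity)] with x hx
    rw [Real.dist_eq, sub_zero]
    refine hx.2.trans_lt ?_
    field_simp
    linarith

end Angular

section Classification

variable {E : Type*} [NormedAddCommGroup E] [InnerProductSpace ℝ E] [FiniteDimensional ℝ E]

lemma logProfile_zero_zero (p A s : ℝ) : logProfile p A 0 0 s = p * s + A * Real.log (-s) := by
  simp [logProfile]

lemma sphereMax_le_sphereMin_add (hdim : 2 ≤ Module.finrank ℝ E) {w : E → ℝ} {X : E → E}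
    {s₀ C s : ℝ} (hX : ∀ x ∈ logBall E s₀, HasGradientAt w (X x) x)
    (hC : ∀ x ∈ logBall E s₀, ‖x‖ * ‖X x‖ ≤ C) (hs : s < s₀) :
    sphereMax w s ≤ sphereMin w s + 8 * C := by
  have hw : ContinuousOn w (logBall E s₀) := fun x hx =>
    (hX x hx).continuousAt.continuousWithinAt
  obtain ⟨x, hx, hxM⟩ := (isGreatest_sphereMax hdim hs hw).1
  obtain ⟨y, hy, hym⟩ := (isLeast_sphereMin hdim hs hw).1
  have hmem : ∀ z : E, Real.exp s / 2 ≤ ‖z‖ → ‖z‖ ≤ Real.exp s → z ∈ logBall E s₀ :=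
    fun z h1 h2 => ⟨by linarith [Real.exp_pos s], h2.trans_lt (Real.exp_lt_exp.2 hs)⟩
  have h := abs_sub_le_of_norm_gradient_le hdim (f := w) (X := X) (C := C) (Real.exp_pos s)
    (fun z h1 h2 => hX z (hmem z h1 h2)) (fun z h1 h2 => hC z (hmem z h1 h2))
    (mem_sphere_zero_iff_norm.1 hx) (mem_sphere_zero_iff_norm.1 hy)
  rw [← hxM, ← hym]
  linarith [(abs_le.1 h).2]

/-- A bound on the scaled gradient gives a linear lower bound for the spherical minimum. -/
lemma sphereMin_sub_mul_le (hdim : 2 ≤ Module.finrank ℝ E) {w : E → ℝ} {X : E → E}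
    {s₀ C s t : ℝ} (hX : ∀ x ∈ logBall E s₀, HasGradientAt w (X x) x)
    (hC : ∀ x ∈ logBall E s₀, ‖x‖ * ‖X x‖ ≤ C) (hst : s ≤ t) (ht : t < s₀) :
    sphereMin w t - C * t ≤ sphereMin w s - C * s := by
  have hw : ContinuousOn w (logBall E s₀) := fun x hx =>
    (hX x hx).continuousAt.continuousWithinAt
  obtain ⟨y, hy, hym⟩ := (isLeast_sphereMin hdim (hst.trans_lt ht) hw).1
  rw [mem_sphere_zero_iff_norm] at hy
  have hnorm : ∀ r : ℝ, ‖Real.exp (r - s) • y‖ = Real.exp r := fun r => by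
    rw [norm_smul, hy, Real.norm_of_nonneg (Real.exp_pos _).le, ← Real.exp_add, sub_add_cancel]
  have hmem : ∀ r ∈ Set.Iic t, Real.exp (r - s) • y ∈ logBall E s₀ := fun r hr => by
    refine ⟨?_, ?_⟩
    · rw [hnorm]; exact Real.exp_pos r
    · rw [hnorm]; exact Real.exp_lt_exp.2 (lt_of_le_of_lt hr ht)
  have hder : ∀ r ∈ Set.Iic t, HasDerivWithinAt (fun r => w (Real.exp (r - s) • y))
      ⟪X (Real.exp (r - s) • y), Real.exp (r - s) • y⟫ (Set.Iic t) r := fun r hr => by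
    have h1 : HasDerivAt (fun r : ℝ => Real.exp (r - s) • y) (Real.exp (r - s) • y) r := by
      have := (((hasDerivAt_id r).sub_const s).exp).smul_const y
      simpa using this
    have h2 := (hX _ (hmem r hr)).hasFDerivAt.comp_hasDerivAt r h1
    exact h2.hasDerivWithinAt
  have hb : ∀ r ∈ Set.Iic t,
      ‖⟪X (Real.exp (r - s) • y), Real.exp (r - s) • y⟫‖ ≤ C := fun r hr => by
    refine (norm_inner_le_norm _ _).trans ?_
    rw [mul_comm]
    exact hC _ (hmem r hr)
  have h := (convex_Iic t).norm_image_sub_le_of_norm_hasDerivWithin_le hder hb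
    (Set.mem_Iic.2 hst) (Set.mem_Iic.2 le_rfl)
  rw [Real.norm_eq_abs, Real.norm_of_nonneg (sub_nonneg.2 hst), sub_self, Real.exp_zero,
    one_smul, hym] at h
  have h3 := sphereMin_le hdim hw (hmem t (Set.mem_Iic.2 le_rfl))
  rw [hnorm, Real.log_exp] at h3
  linarith [(abs_le.1 h).2]

variable [MeasurableSpace E] [BorelSpace E]

/-- One-sided convergence to a logarithmic profile whose slope is a root of `slopeFun`. -/
lemma HasWeakLaplacian.tendsto_logProfile (hdim : 2 ≤ Module.finrank ℝ E)
    {ρ lam τ b κ s₀ C p A ℓ e : ℝ} {w : E → ℝ} {X : E → E}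
    (H : HasWeakLaplacian (logBall E s₀) w X (logRhs (Module.finrank ℝ E) ρ lam τ b κ w X))
    (hτ0 : 0 ≤ τ) (hτ1 : τ < 1) (hC : ∀ᶠ x in 𝓝[≠] 0, ‖x‖ * ‖X x‖ ≤ C)
    (hp : 0 < p) (hroot : slopeFun ρ lam τ p = 0)
    (hE : Tendsto (fun x => Real.exp (κ * (w x - b * Real.log ‖x‖))) (𝓝[≠] 0) (𝓝 0))
    (he : |e| = 1)
    (hlow : ∀ ε > 0, ∀ᶠ x in 𝓝[≠] 0, -ε ≤ e * (w x - logProfile p A 0 0 (Real.log ‖x‖) - ℓ))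
    (hup : ∀ ε > 0, ∀ᶠ s in atBot, ∃ y : E, ‖y‖ = Real.exp s ∧
      e * (w y - logProfile p A 0 0 s - ℓ) ≤ ε) :
    Tendsto (fun x => w x - logProfile p A 0 0 (Real.log ‖x‖)) (𝓝[≠] 0) (𝓝 ℓ) ∧
      Tendsto (fun x => ⟪x, X x⟫) (𝓝[≠] 0) (𝓝 p) := by
  have hx := tendsto_inv_sqrt_sub 0
  have hV₁ : Tendsto (fun s : ℝ => p + (-A * (√(0 - s))⁻¹ ^ 2 + 0 * (√(0 - s))⁻¹ ^ 3))
      atBot (𝓝 p) := by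
    simpa using ((hx.pow 2).const_mul (-A)).const_add p
  have hV₂ : Tendsto (fun s : ℝ => (-A * (√(0 - s))⁻¹ ^ 4 + 3 / 2 * 0 * (√(0 - s))⁻¹ ^ 5)
      - slopeFun ρ lam τ (p + (-A * (√(0 - s))⁻¹ ^ 2 + 0 * (√(0 - s))⁻¹ ^ 3)))
      atBot (𝓝 0) := by
    have h1 := ((continuous_slopeFun (ρ := ρ) (lam := lam) hτ1).tendsto p).comp hV₁
    have h2 : Tendsto (fun s : ℝ => -A * (√(0 - s))⁻¹ ^ 4 + 3 / 2 * 0 * (√(0 - s))⁻¹ ^ 5)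
        atBot (𝓝 0) := by
      simpa using (hx.pow 4).const_mul (-A)
    simpa [hroot] using h2.sub h1
  obtain ⟨h1, h2⟩ := H.tendsto_of_one_sided hdim hτ0 hτ1 hC (hasTwoDerivs_logProfile p A 0 0) hp
    hV₁ hV₂ hE he hlow hup
  refine ⟨h1, ?_⟩
  have h3 := h2.add (hV₁.comp tendsto_log_norm_nhdsNE)
  rw [zero_add] at h3
  exact h3.congr fun x => by simp only [Function.comp]; ring

/-- The exponent of the logarithm in `Φ_{ϖ₂}`. -/
def phiExponent (ρ lam τ : ℝ) : ℝ := if ρ = Upsilon lam τ then 2 / (1 + τ) else 0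

/-- Classification of the behaviour at the origin for the logarithm of a solution. -/
theorem HasWeakLaplacian.classification (hdim : 2 ≤ Module.finrank ℝ E)
    {ρ lam τ b κ s₀ C k L w1 w2 : ℝ} {w : E → ℝ} {X : E → E}
    (H : HasWeakLaplacian (logBall E s₀) w X (logRhs (Module.finrank ℝ E) ρ lam τ b κ w X))
    (hcase : CaseN2 ρ lam τ) (hw1 : IsMinNegRoot ρ lam τ w1) (hw2 : IsMaxNegRoot ρ lam τ w2)
    (hκ : 0 < κ) (hb : 0 < b) (hbw : b < -w2) (hL : Real.exp (κ * L) = -slopeFun ρ lam τ b)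
    (hk : ∀ᶠ s in atBot, sphereMax w s ≤ b * s + k)
    (hC : ∀ x ∈ logBall E s₀, ‖x‖ * ‖X x‖ ≤ C) :
    (∃ ℓ, Tendsto (fun x => w x - logProfile (-w1) 0 0 0 (Real.log ‖x‖)) (𝓝[≠] 0) (𝓝 ℓ) ∧
        Tendsto (fun x => ⟪x, X x⟫) (𝓝[≠] 0) (𝓝 (-w1))) ∨
      (∃ ℓ, Tendsto (fun x => w x - logProfile (-w2) (phiExponent ρ lam τ) 0 0 (Real.log ‖x‖))
          (𝓝[≠] 0) (𝓝 ℓ) ∧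
        Tendsto (fun x => ⟪x, X x⟫) (𝓝[≠] 0) (𝓝 (-w2))) ∨
      Tendsto (fun x => w x - logProfile b 0 0 0 (Real.log ‖x‖)) (𝓝[≠] 0) (𝓝 L) := by
  obtain ⟨hlam, hτ0, hτ1, hρ⟩ := hcase
  have henv := H.isEnvelope hdim
  have hw := H.contf
  have hF := continuous_slopeFun (ρ := ρ) (lam := lam) hτ1
  have hlog := tendsto_log_norm_nhdsNE (E := E)
  have hball : ∀ᶠ x in 𝓝[≠] (0 : E), x ∈ logBall E s₀ :=
    eventually_nhdsNE_iff_logBall.2 ⟨s₀, fun x hx => hx⟩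
  have hgap : ∀ᶠ s in atBot, sphereMax w s ≤ sphereMin w s + 8 * C :=
    (eventually_lt_atBot s₀).mono fun s hs => sphereMax_le_sphereMin_add hdim H.grad hC hs
  have hroot1 : slopeFun ρ lam τ (-w1) = 0 := by
    rw [slopeFun_eq_neg_fRho, neg_neg, hw1.2.1, neg_zero]
  have hroot2 : slopeFun ρ lam τ (-w2) = 0 := by
    rw [slopeFun_eq_neg_fRho, neg_neg, hw2.2.1, neg_zero]
  rcases henv.tendsto_equilibrium_or hκ hF hL hk with ⟨h1, h2⟩ | hm
  · right; right
    refine tendsto_of_tendsto_of_tendsto_of_le_of_le' (h1.comp hlog) (h2.comp hlog) ?_ ?_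
    · filter_upwards [hball] with x hx
      have := sphereMin_le hdim hw hx
      simp only [Function.comp, logProfile_zero_zero]
      linarith
    · filter_upwards [hball] with x hx
      have := le_sphereMax hdim hw hx
      simp only [Function.comp, logProfile_zero_zero]
      linarith
  have hEm : Tendsto (fun s => Real.exp (κ * (sphereMin w s - b * s))) atBot (𝓝 0) :=
    Real.tendsto_exp_atBot.comp (hm.const_mul_atBot hκ)
  have hEw : Tendsto (fun x => Real.exp (κ * (w x - b * Real.log ‖x‖))) (𝓝[≠] 0) (𝓝 0) := by
    refine Real.tendsto_exp_atBot.comp (Tendsto.const_mul_atBot hκ ?_)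
    refine tendsto_atBot_mono' _ ?_
      (tendsto_atBot_add_const_right _ (8 * C) (hm.comp hlog))
    filter_upwards [hball, hlog.eventually hgap] with x hx hg
    have := le_sphereMax hdim hw hx
    simp only [Function.comp]
    linarith
  have hneg2 : ∀ p, 0 < p → p < -w2 → slopeFun ρ lam τ p < 0 := fun p h1 h2 =>
    slopeFun_neg_of_lt hlam hτ0 hτ1 hw2 h1 h2
  have hneg1 : ∀ p, -w1 < p → slopeFun ρ lam τ p < 0 := fun p h1 =>
    slopeFun_neg_of_gt hlam hτ1 hw1 h1
  have hbelow := fun p (h1 : b ≤ p) (h2 : p < -w2) =>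
    henv.tendsto_atBot_of_lt_root hF hb hneg2 hEm hm h1 h2
  have hmono := fun p (h1 : b ≤ p) (h2 : p < -w2) => (hbelow p h1 h2).2
  have hσ : 0 < κ * ((b + -w2) / 2 - b) := mul_pos hκ (by linarith)
  have hEσ : ∀ᶠ s in atBot, Real.exp (κ * (sphereMin w s - b * s)) ≤
      Real.exp (κ * ((b + -w2) / 2 - b) * s) := by
    filter_upwards [(hbelow ((b + -w2) / 2) (by linarith) (by linarith)).1.eventually
      (eventually_le_atBot 0)] with s hs
    rw [mul_assoc]
    exact Real.exp_le_exp.2 (mul_le_mul_of_nonneg_left (by linarith) hκ.le)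
  have hQ : Tendsto (fun s => sphereMin w s - (C + 1) * s) atBot atTop :=
    tendsto_sub_mul_of_eventually_ge (p := C) (B := sphereMin w (s₀ - 1) - C * (s₀ - 1))
      (by linarith) ((eventually_le_atBot (s₀ - 1)).mono fun s hs =>
        sphereMin_sub_mul_le hdim H.grad hC hs (by linarith))
  have hCev : ∀ᶠ x in 𝓝[≠] (0 : E), ‖x‖ * ‖X x‖ ≤ C := hball.mono hC
  rcases henv.tendsto_nhds_or_atTop hσ hneg1 hEσ
    (fun p hp => henv.tendsto_atTop_of_root_lt hF hneg1 hEm hQ hp) with ⟨l, hl⟩ | hm1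
  · left
    refine ⟨l, H.tendsto_logProfile hdim hτ0.le hτ1 hCev (neg_pos.2 hw1.1) hroot1 hEw
      (e := 1) abs_one (fun ε hε => ?_) fun ε hε => ?_⟩
    · filter_upwards [hball, hlog.eventually (hl.eventually (lt_mem_nhds (sub_lt_self l hε)))]
        with x hx h1
      have := sphereMin_le hdim hw hx
      rw [logProfile_zero_zero]
      linarith
    · filter_upwards [eventually_lt_atBot s₀,
        hl.eventually (gt_mem_nhds (lt_add_of_pos_right l hε))] with s hs h1
      obtain ⟨y, hy, hym⟩ := (isLeast_sphereMin hdim hs hw).1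
      refine ⟨y, mem_sphere_zero_iff_norm.1 hy, ?_⟩
      rw [logProfile_zero_zero, hym]
      linarith
  · right; left
    obtain ⟨l, hl⟩ : ∃ l, Tendsto (fun s => sphereMax w s
        - logProfile (-w2) (phiExponent ρ lam τ) 0 0 s) atBot (𝓝 l) := by
      simp only [logProfile_zero_zero]
      rcases hρ.eq_or_lt with rfl | hρ
      · obtain ⟨h12, K, y₀, hK, hy₀, hexp⟩ := exists_slopeFun_double hlam hτ0 hτ1 hw1 hw2
        rw [h12] at hm1
        simpa [phiExponent] using henv.exists_tendsto_of_double_root hσ hbw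
          (by linarith : 0 < (1 + τ) / 2) hy₀ hK hexp hEσ hgap hmono hm1
      · obtain ⟨h12, c₀, γ₁, y₀, hc₀, hγ₁, hy₀, hpos, hneg⟩ :=
          exists_slopeFun_simple hlam hτ0 hτ1 hρ hw1 hw2
        simpa [phiExponent, hρ.ne'] using henv.exists_tendsto_of_simple_root hσ hbw h12 hroot2
          hc₀ hpos hγ₁ hy₀ hneg hEσ hgap hmono hm1
    refine ⟨l, H.tendsto_logProfile hdim hτ0.le hτ1 hCev (neg_pos.2 hw2.1) hroot2 hEw
      (e := -1) (by simp) (fun ε hε => ?_) fun ε hε => ?_⟩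
    · filter_upwards [hball, hlog.eventually (hl.eventually
        (gt_mem_nhds (lt_add_of_pos_right l hε)))] with x hx h1
      have := le_sphereMax hdim hw hx
      linarith
    · filter_upwards [eventually_lt_atBot s₀,
        hl.eventually (lt_mem_nhds (sub_lt_self l hε))] with s hs h1
      obtain ⟨y, hy, hym⟩ := (isGreatest_sphereMax hdim hs hw).1
      refine ⟨y, mem_sphere_zero_iff_norm.1 hy, ?_⟩
      rw [hym]
      linarith

end Classification

section Translation

/-- The parameters of a logarithmic profile are determined by the function. -/
lemma logProfile_unique {E : Type*} [NormedAddCommGroup E] [(𝓝[≠] (0 : E)).NeBot]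
    {w : E → ℝ} {p p' A A' ℓ ℓ' : ℝ}
    (h : Tendsto (fun x => w x - logProfile p A 0 0 (Real.log ‖x‖)) (𝓝[≠] 0) (𝓝 ℓ))
    (h' : Tendsto (fun x => w x - logProfile p' A' 0 0 (Real.log ‖x‖)) (𝓝[≠] 0) (𝓝 ℓ')) :
    p = p' ∧ A = A' := by
  have hlog := tendsto_neg_atBot_atTop.comp (tendsto_log_norm_nhdsNE (E := E))
  have hd : Tendsto (fun x : E => (p - p') * Real.log ‖x‖ +
      (A - A') * Real.log (-Real.log ‖x‖)) (𝓝[≠] 0) (𝓝 (ℓ' - ℓ)) :=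
    (h'.sub h).congr fun x => by simp only [logProfile_zero_zero]; ring
  have hpp : p = p' := by
    have h1 := hd.mul hlog.inv_tendsto_atTop
    have h2 : Tendsto (fun x : E => Real.log (-Real.log ‖x‖) / (-Real.log ‖x‖)) (𝓝[≠] 0) (𝓝 0) :=
      Real.isLittleO_log_id_atTop.tendsto_div_nhds_zero.comp hlog
    have h3 := (h1.sub (h2.const_mul (A - A')))
    have h4 : Tendsto (fun _ : E => -(p - p')) (𝓝[≠] 0)
        (𝓝 ((ℓ' - ℓ) * 0 - (A - A') * 0)) := by
      refine h3.congr' ?_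
      filter_upwards [hlog.eventually (eventually_gt_atTop 0)] with x hx
      simp only [Function.comp, Pi.inv_apply] at hx ⊢
      have : Real.log ‖x‖ ≠ 0 := by linarith
      field_simp
      ring
    have := tendsto_nhds_unique h4 tendsto_const_nhds
    linarith
  refine ⟨hpp, ?_⟩
  subst hpp
  have hll := (Real.tendsto_log_atTop.comp hlog)
  have h1 := hd.mul hll.inv_tendsto_atTop
  have h4 : Tendsto (fun _ : E => A - A') (𝓝[≠] 0) (𝓝 ((ℓ' - ℓ) * 0)) := by
    refine h1.congr' ?_
    filter_upwards [hll.eventually (eventually_gt_atTop 0)] with x hx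
    simp only [Function.comp, Pi.inv_apply] at hx ⊢
    field_simp
    ring
  have := tendsto_nhds_unique h4 tendsto_const_nhds
  linarith

lemma tendsto_log_sub_of_tendsto_div_exp {α : Type*} {l : Filter α} {u g : α → ℝ} {a : ℝ}
    (hpos : ∀ᶠ x in l, 0 < u x) (ha : 0 < a)
    (h : Tendsto (fun x => u x / Real.exp (g x)) l (𝓝 a)) :
    Tendsto (fun x => Real.log (u x) - g x) l (𝓝 (Real.log a)) := by
  refine (h.log ha.ne').congr' ?_
  filter_upwards [hpos] with x hx
  rw [Real.log_div hx.ne' (Real.exp_pos _).ne', Real.log_exp]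

lemma tendsto_div_exp_of_tendsto_log_sub {α : Type*} {l : Filter α} {u g : α → ℝ} {ℓ : ℝ}
    (hpos : ∀ᶠ x in l, 0 < u x) (h : Tendsto (fun x => Real.log (u x) - g x) l (𝓝 ℓ)) :
    Tendsto (fun x => u x / Real.exp (g x)) l (𝓝 (Real.exp ℓ)) := by
  refine ((Real.continuous_exp.tendsto ℓ).comp h).congr' ?_
  filter_upwards [hpos] with x hx
  simp only [Function.comp]
  rw [Real.exp_sub, Real.exp_log hx]

lemma tendsto_inner_gradient_div_exp {E : Type*} [NormedAddCommGroup E] [InnerProductSpace ℝ E]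
    {l : Filter E} {u g : E → ℝ} {Y : E → E} {a p : ℝ} (hpos : ∀ᶠ x in l, 0 < u x)
    (h : Tendsto (fun x => u x / Real.exp (g x)) l (𝓝 a))
    (h' : Tendsto (fun x => ⟪x, (u x)⁻¹ • Y x⟫) l (𝓝 p)) :
    Tendsto (fun x => ⟪x, Y x⟫ / Real.exp (g x)) l (𝓝 (a * p)) := by
  refine (h.mul h').congr' ?_
  filter_upwards [hpos] with x hx
  rw [inner_smul_right]
  have := Real.exp_pos (g x)
  field_simp

lemma eventually_norm_rpow_neg {E : Type*} [NormedAddCommGroup E] (w : ℝ) :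
    ∀ᶠ x in 𝓝[≠] (0 : E), ‖x‖ ^ (-w) = Real.exp (logProfile (-w) 0 0 0 (Real.log ‖x‖)) := by
  filter_upwards [self_mem_nhdsWithin] with x hx
  rw [logProfile_zero_zero, Real.rpow_def_of_pos (norm_pos_iff.2 hx)]
  ring_nf

lemma eventually_Phi2 {E : Type*} [NormedAddCommGroup E] (ρ lam τ w2 : ℝ) :
    ∀ᶠ x in 𝓝[≠] (0 : E), Phi2 ρ lam τ w2 ‖x‖ =
      Real.exp (logProfile (-w2) (phiExponent ρ lam τ) 0 0 (Real.log ‖x‖)) := by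
  filter_upwards [eventually_norm_rpow_neg w2,
    (tendsto_log_norm_nhdsNE (E := E)).eventually (eventually_lt_atBot 0)] with x hx hx1
  rw [logProfile_zero_zero] at hx ⊢
  unfold Phi2 phiExponent
  split_ifs with h
  · rw [hx, abs_of_neg hx1, Real.rpow_def_of_pos (neg_pos.2 hx1), ← Real.exp_add]
    ring_nf
  · exact hx

variable {N : ℕ} {ρ lam τ θ q : ℝ} {u : EuclideanSpace ℝ (Fin N) → ℝ}

lemma altI_iff (w1 : ℝ) : AltI N w1 u ↔ ∃ a : ℝ, 0 < a ∧
    Tendsto (fun x => u x / Real.exp (logProfile (-w1) 0 0 0 (Real.log ‖x‖))) (𝓝[≠] 0) (𝓝 a) ∧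
    Tendsto (fun x => ⟪x, gradient u x⟫ / Real.exp (logProfile (-w1) 0 0 0 (Real.log ‖x‖)))
      (𝓝[≠] 0) (𝓝 (a * -w1)) := by
  have h : ∀ v : EuclideanSpace ℝ (Fin N) → ℝ, (fun x => ‖x‖ ^ w1 * v x) =ᶠ[𝓝[≠] 0]
      fun x => v x / Real.exp (logProfile (-w1) 0 0 0 (Real.log ‖x‖)) := fun v => by
    filter_upwards [eventually_norm_rpow_neg w1] with x hx
    rw [← hx, Real.rpow_neg (norm_nonneg _), div_inv_eq_mul, mul_comm]
  unfold AltI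
  simp only [mul_neg, tendsto_congr' (h _)]

lemma altII_iff (w2 : ℝ) : AltII N ρ lam τ w2 u ↔ ∃ a : ℝ, 0 < a ∧
    Tendsto (fun x => u x / Real.exp (logProfile (-w2) (phiExponent ρ lam τ) 0 0 (Real.log ‖x‖)))
      (𝓝[≠] 0) (𝓝 a) ∧
    Tendsto (fun x => ⟪x, gradient u x⟫ /
      Real.exp (logProfile (-w2) (phiExponent ρ lam τ) 0 0 (Real.log ‖x‖)))
      (𝓝[≠] 0) (𝓝 (a * -w2)) := by
  have h : ∀ v : EuclideanSpace ℝ (Fin N) → ℝ, (fun x => v x / Phi2 ρ lam τ w2 ‖x‖) =ᶠ[𝓝[≠] 0]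
      fun x => v x / Real.exp (logProfile (-w2) (phiExponent ρ lam τ) 0 0 (Real.log ‖x‖)) :=
    fun v => by
      filter_upwards [eventually_Phi2 ρ lam τ w2] with x hx
      rw [hx]
  unfold AltII
  simp only [mul_neg, tendsto_congr' (h _)]

lemma altIII_iff (hf : 0 < fRho ρ lam τ ((θ + 2) / (q - 1))) : AltIII N ρ lam τ θ q u ↔
    Tendsto (fun x => u x / Real.exp (logProfile (-((θ + 2) / (q - 1))) 0 0 0 (Real.log ‖x‖)))
      (𝓝[≠] 0) (𝓝 (fRho ρ lam τ ((θ + 2) / (q - 1)) ^ (1 / (q - 1)))) := by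
  have hc := Real.rpow_pos_of_pos hf (1 / (q - 1))
  unfold AltIII
  generalize fRho ρ lam τ ((θ + 2) / (q - 1)) ^ (1 / (q - 1)) = c at *
  have h : (fun x : EuclideanSpace ℝ (Fin N) => u x / (c * ‖x‖ ^ (-((θ + 2) / (q - 1)))))
      =ᶠ[𝓝[≠] 0] fun x => c⁻¹ * (u x /
        Real.exp (logProfile (-((θ + 2) / (q - 1))) 0 0 0 (Real.log ‖x‖))) := by
    filter_upwards [eventually_norm_rpow_neg ((θ + 2) / (q - 1))] with x hx
    rw [← hx, div_mul_eq_div_div, div_right_comm]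
    ring
  rw [tendsto_congr' h]
  constructor
  · intro h1
    have := h1.const_mul c
    simpa [hc.ne'] using this
  · intro h1
    have := h1.const_mul c⁻¹
    simpa [hc.ne'] using this

end Translation

/-- The logarithm of a positive solution satisfies, on a punctured ball, the logarithmic equation
together with an upper bound and a scaled gradient bound. -/
lemma IsSolutionE.exists_log_bounds {N : ℕ} (hN : 2 ≤ N) {ρ lam τ θ q : ℝ} (hτ0 : 0 ≤ τ)
    (hτ1 : τ < 1) (hq : 1 < q) {Ω : Set (EuclideanSpace ℝ (Fin N))} (hΩ : IsOpen Ω)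
    (h0 : (0 : EuclideanSpace ℝ (Fin N)) ∈ Ω) {u : EuclideanSpace ℝ (Fin N) → ℝ}
    (hu : IsSolutionE N ρ lam τ θ q Ω u) : ∃ s k C : ℝ,
    HasWeakLaplacian (logBall (EuclideanSpace ℝ (Fin N)) s) (fun x => Real.log (u x))
      (fun x => (u x)⁻¹ • gradient u x)
      (logRhs (Module.finrank ℝ (EuclideanSpace ℝ (Fin N))) ρ lam τ (-((θ + 2) / (q - 1))) (q - 1)
        (fun x => Real.log (u x)) (fun x => (u x)⁻¹ • gradient u x)) ∧
    (∀ᶠ r in atBot, sphereMax (fun x => Real.log (u x)) r ≤ -((θ + 2) / (q - 1)) * r + k) ∧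
    ∀ x ∈ logBall (EuclideanSpace ℝ (Fin N)) s, ‖x‖ * ‖(u x)⁻¹ • gradient u x‖ ≤ C := by
  have hdim : 2 ≤ Module.finrank ℝ (EuclideanSpace ℝ (Fin N)) := by
    rwa [finrank_euclideanSpace_fin]
  obtain ⟨s₀, hs₀⟩ := eventually_nhdsNE_iff_logBall.1
    (sdiff_mem_nhdsWithin_compl (hΩ.mem_nhds h0) {0} : ∀ᶠ x in 𝓝[≠] 0, x ∈ Ω \ {0})
  have H := (hu.log hΩ hτ1 hq).mono (isOpen_logBall s₀) hs₀
  rw [show (N : ℝ) = Module.finrank ℝ (EuclideanSpace ℝ (Fin N)) by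
    rw [finrank_euclideanSpace_fin]] at H
  obtain ⟨k, hk⟩ := (H.isEnvelope hdim).exists_upper_bound (by linarith) (by positivity)
    (neg_mul_one_add_sq_le_slopeFun hτ0 hτ1)
    (fun a c hc => exists_sphereMax_le hdim H.contf a c hc)
  have hsub : ∀ t ≤ s₀, logBall (EuclideanSpace ℝ (Fin N)) t ⊆ logBall _ s₀ := fun t ht x hx =>
    ⟨hx.1, hx.2.trans_le (Real.exp_le_exp.2 ht)⟩
  obtain ⟨C, -, hC⟩ := hu.exists_norm_gradient_log_le hΩ hτ0 hτ1 hq (s₀ := s₀ - 2) (k := k)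
    ((hsub _ (by linarith)).trans hs₀) (fun x hx =>
      (le_sphereMax hdim H.contf (hsub _ (by linarith) hx)).trans
        (hk _ (log_norm_lt hx).le))
  exact ⟨s₀ - 2 - 1, k, C, H.mono (isOpen_logBall _) (hsub _ (by linarith)),
    (eventually_le_atBot _).mono hk, hC⟩

/-- If `β ∈ (ϖ₂, 0)` in Case [N₂], every positive solution `u` of (E) in
`Ω \ {0}` satisfies exactly one of the alternatives (i), (ii), (iii) as `|x| → 0`. -/
theorem stmt13_trichotomy
    (N : ℕ) (hN : 2 ≤ N) (ρ lam τ θ q : ℝ)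
    (hτ0 : 0 ≤ τ) (hτ1 : τ < 1) (hq : 1 < q)
    (Ω : Set (EuclideanSpace ℝ (Fin N))) (hΩ : IsOpen Ω) (h0 : (0 : EuclideanSpace ℝ (Fin N)) ∈ Ω)
    (hcase : CaseN2 ρ lam τ)
    (w1 w2 : ℝ) (hw1 : IsMinNegRoot ρ lam τ w1) (hw2 : IsMaxNegRoot ρ lam τ w2)
    (hβ1 : w2 < (θ + 2) / (q - 1)) (hβ2 : (θ + 2) / (q - 1) < 0)
    (u : EuclideanSpace ℝ (Fin N) → ℝ)
    (hu : IsSolutionE N ρ lam τ θ q Ω u) :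
    (AltI N w1 u ∧ ¬ AltII N ρ lam τ w2 u ∧ ¬ AltIII N ρ lam τ θ q u) ∨
    (¬ AltI N w1 u ∧ AltII N ρ lam τ w2 u ∧ ¬ AltIII N ρ lam τ θ q u) ∨
    (¬ AltI N w1 u ∧ ¬ AltII N ρ lam τ w2 u ∧ AltIII N ρ lam τ θ q u) := by
  have hκ : 0 < q - 1 := by linarith
  have hb : 0 < -((θ + 2) / (q - 1)) := neg_pos.2 hβ2
  have hbw : -((θ + 2) / (q - 1)) < -w2 := neg_lt_neg hβ1
  have hw12 : w1 ≤ w2 := hw1.2.2 w2 hw2.1 hw2.2.1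
  have hf : 0 < fRho ρ lam τ ((θ + 2) / (q - 1)) := by
    have := slopeFun_neg_of_lt hcase.1 hcase.2.1 hτ1 hw2 hb hbw
    rwa [slopeFun_eq_neg_fRho, neg_neg, neg_lt_zero] at this
  have hL : Real.exp (Real.log (fRho ρ lam τ ((θ + 2) / (q - 1)) ^ (1 / (q - 1)))) =
      fRho ρ lam τ ((θ + 2) / (q - 1)) ^ (1 / (q - 1)) :=
    Real.exp_log (Real.rpow_pos_of_pos hf _)
  have hpos : ∀ᶠ x in 𝓝[≠] (0 : EuclideanSpace ℝ (Fin N)), 0 < u x :=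
    Eventually.mono (sdiff_mem_nhdsWithin_compl (hΩ.mem_nhds h0) {0}) hu.1.2
  have hdim : 2 ≤ Module.finrank ℝ (EuclideanSpace ℝ (Fin N)) := by
    rwa [finrank_euclideanSpace_fin]
  have : Nontrivial (EuclideanSpace ℝ (Fin N)) :=
    Module.nontrivial_of_finrank_pos (R := ℝ) (by linarith)
  have : (𝓝[≠] (0 : EuclideanSpace ℝ (Fin N))).NeBot := inferInstance
  have hex : AltI N w1 u ∨ AltII N ρ lam τ w2 u ∨ AltIII N ρ lam τ θ q u := by
    obtain ⟨s, k, C, H, hk, hC⟩ := hu.exists_log_bounds hN hτ0 hτ1 hq hΩ h0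
    rw [altI_iff, altII_iff, altIII_iff hf, ← hL]
    have hexp : Real.exp ((q - 1) *
        Real.log (fRho ρ lam τ ((θ + 2) / (q - 1)) ^ (1 / (q - 1)))) =
          -slopeFun ρ lam τ (-((θ + 2) / (q - 1))) := by
      rw [slopeFun_eq_neg_fRho, neg_neg, neg_neg, Real.log_rpow hf, ← mul_assoc,
        mul_one_div_cancel hκ.ne', one_mul, Real.exp_log hf]
    refine (H.classification hdim hcase hw1 hw2 hκ hb hbw hexp hk hC).imp ?_ (Or.imp ?_ ?_)
    · rintro ⟨ℓ, h1, h2⟩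
      have h3 := tendsto_div_exp_of_tendsto_log_sub hpos h1
      exact ⟨_, Real.exp_pos ℓ, h3, tendsto_inner_gradient_div_exp hpos h3 h2⟩
    · rintro ⟨ℓ, h1, h2⟩
      have h3 := tendsto_div_exp_of_tendsto_log_sub hpos h1
      exact ⟨_, Real.exp_pos ℓ, h3, tendsto_inner_gradient_div_exp hpos h3 h2⟩
    · exact tendsto_div_exp_of_tendsto_log_sub hpos
  have h12 : AltI N w1 u → ¬ AltII N ρ lam τ w2 u := by
    rw [altI_iff, altII_iff]
    rintro ⟨a, ha, h1, -⟩ ⟨c, hc, h2, -⟩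
    obtain ⟨h3, h4⟩ := logProfile_unique (tendsto_log_sub_of_tendsto_div_exp hpos ha h1)
      (tendsto_log_sub_of_tendsto_div_exp hpos hc h2)
    rcases hcase.2.2.2.eq_or_lt with h | h
    · have : 0 < 2 / (1 + τ) := by positivity
      rw [phiExponent, if_pos h.symm] at h4
      linarith
    · linarith [(exists_slopeFun_simple hcase.1 hcase.2.1 hτ1 h hw1 hw2).1]
  have h13 : AltI N w1 u → ¬ AltIII N ρ lam τ θ q u := by
    rw [altI_iff, altIII_iff hf]
    rintro ⟨a, ha, h1, -⟩ h2
    linarith [(logProfile_unique (tendsto_log_sub_of_tendsto_div_exp hpos ha h1)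
      (tendsto_log_sub_of_tendsto_div_exp hpos (Real.rpow_pos_of_pos hf _) h2)).1]
  have h23 : AltII N ρ lam τ w2 u → ¬ AltIII N ρ lam τ θ q u := by
    rw [altII_iff, altIII_iff hf]
    rintro ⟨a, ha, h1, -⟩ h2
    linarith [(logProfile_unique (tendsto_log_sub_of_tendsto_div_exp hpos ha h1)
      (tendsto_log_sub_of_tendsto_div_exp hpos (Real.rpow_pos_of_pos hf _) h2)).1]
  tauto

end
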